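/- Let ϑ be the Riemann–Siegel theta branch and let N ∈ ℤ_{≥0}. There exist functions C_0, C_1, …, C_{N−1} : [0,1) → ℂ and a constant K depending only on N such that for all s = 1/2 + it with t ≥ 2π, setting α := √(t/(2π)) and a := α − ⌊α⌋, one has |e^{iϑ(s)}ζ(s) − e^{iϑ(s)}·Σ_{n ≤ α} n^{−s} − e^{iϑ(1−s)}·Σ_{n ≤ α} n^{−(1−s)} − (−1)^{⌊α⌋+1}·(2π/t)^{1/4}·Σ_{m=0}^{N−1} C_m(a)·t^{−m/2}| ≤ K·t^{−N/2 − 1/4}, where the sums over n run over positive integers n ≤ α. -/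

import Mathlib

open Complex Real MeasureTheory

noncomputable section

def chi (s : ℂ) : ℂ := (π : ℂ) ^ (s - 1/2) * Complex.Gamma ((1 - s)/2) / Complex.Gamma (s/2)

def RSOmega : Set ℂ := {s : ℂ | s.im ≠ 0 ∨ (0 < s.re ∧ s.re < 1)}

def IsRSTheta (ϑ : ℂ → ℂ) : Prop :=
  DifferentiableOn ℂ ϑ RSOmega ∧ (∀ s ∈ RSOmega, Complex.exp (-2 * I * ϑ s) = chi s) ∧
    ϑ (1/2) = 0

def zetaSum (x : ℝ) (s : ℂ) : ℂ := ∑ n ∈ Finset.Icc 1 ⌊x⌋₊, (n : ℂ) ^ (-s)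

def Upsilon (u τ : ℂ) : ℂ :=
  ∫ v : ℝ, Complex.exp (3 * (π:ℂ) * I / 4) *
    (Complex.exp (-(π:ℂ) * I * τ * (1/2 + Complex.exp (3 * (π:ℂ) * I / 4) * v) ^ 2
        + 2 * (π:ℂ) * I * u * (1/2 + Complex.exp (3 * (π:ℂ) * I / 4) * v)) /
      (Complex.exp (2 * (π:ℂ) * I * (1/2 + Complex.exp (3 * (π:ℂ) * I / 4) * v)) - 1))

def G (u τ : ℂ) : ℂ :=
  τ ^ ((1:ℂ)/4) * Complex.exp (-(π:ℂ) * I * u ^ 2 / 2 + (π:ℂ) * I / 8) *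
    Upsilon (τ ^ ((1:ℂ)/2) * u) τ

def Gderiv (k : ℕ) (u τ : ℂ) : ℂ := iteratedDeriv k (fun w => G w τ) u

def hermiteH (n : ℕ) (x : ℂ) : ℂ :=
  (Nat.factorial n : ℂ) * ∑ j ∈ Finset.range (n / 2 + 1),
    (-1:ℂ) ^ j / ((Nat.factorial j : ℂ) * (Nat.factorial (n - 2*j) : ℂ)) * (2 * x) ^ (n - 2*j)

def obell (p : ℕ → ℂ) (i j : ℕ) : ℂ :=
  ∑ f ∈ (Finset.Nat.antidiagonalTuple j i).filter (fun f => ∀ l, 1 ≤ f l), ∏ l, p (f l)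

def bernoulliPoly (n : ℕ) (x : ℂ) : ℂ := Polynomial.aeval x (Polynomial.bernoulli n)

def fseq (σ : ℝ) (n : ℕ) : ℂ :=
  (bernoulliPoly (n+1) ((σ:ℂ)/2) + (-1:ℂ)^(n+1) * bernoulliPoly (n+1) ((1-(σ:ℂ))/2)) /
    (2*(n:ℂ)*((n:ℂ)+1))

def um (m : ℕ) (σ : ℝ) : ℂ :=
  (-2:ℂ)^m * ∑ k ∈ Finset.range (m+1), obell (fseq σ) m k / (Nat.factorial k : ℂ)

def seqA (j : ℕ) : ℂ := (-1:ℂ)^(j+1) / ((j:ℂ) + 2)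

def seqB (j : ℕ) : ℂ := (-1:ℂ)^(j+1) / (j:ℂ)

def dd (m r : ℕ) (σ : ℝ) : ℂ :=
  ∑ n ∈ Finset.Icc r m, (obell seqA n r / (Nat.factorial r : ℂ)) *
    ∑ k ∈ Finset.range (m - n + 1),
      (obell seqB (m - n) k / (Nat.factorial k : ℂ)) * ((σ:ℂ) - 1)^k

def qq (n ℓ : ℕ) (σ : ℝ) : ℂ :=
  ∑ m ∈ Finset.Icc (ℓ - n) (ℓ / 3), um m σ * dd (n - 2*m) (n + m - ℓ) σ

def PP (n k : ℕ) (x : ℂ) (σ : ℝ) : ℂ :=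
  Complex.exp (3 * (π:ℂ) * I * (k:ℂ) / 4) * ∑ ℓ ∈ Finset.range (k/2 + 1),
    (Nat.choose (3*n - 2*ℓ) (3*n - k) : ℂ) * (-1:ℂ)^(n + ℓ) * 2^(2*ℓ) / 2^k *
      qq n ℓ σ * hermiteH (k - 2*ℓ) (Complex.exp (-(π:ℂ) * I / 4) * x)

def IsAk (s : ℂ) (a : ℕ → ℂ) : Prop :=
  a 0 = 1 ∧ ∀ k : ℕ, ((k:ℂ) + 1) * (Real.sqrt s.im : ℂ) * a (k+1) =
    -((k:ℂ) + 1 - (s.re:ℂ)) * a k + I * (if 2 ≤ k then a (k-2) else 0)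

def IsPsi (Ψ : ℂ → ℂ) : Prop :=
  Differentiable ℂ Ψ ∧ ∀ u : ℂ, Complex.cos ((π:ℂ)*u) ≠ 0 →
    Ψ u = Complex.cos ((π:ℂ)*(u^2/2 - u - 1/8)) / Complex.cos ((π:ℂ)*u)

def wfun (s z : ℂ) : ℂ :=
  Complex.exp ((s - 1) * Complex.log (1 + z / (Real.sqrt s.im : ℂ))
    - I * (Real.sqrt s.im : ℂ) * z + I * z^2 / 2)

def rn (n : ℕ) (s z : ℂ) : ℂ :=
  wfun s z - ∑ k ∈ Finset.range n, (iteratedDeriv k (wfun s) 0 / (Nat.factorial k : ℂ)) * z^k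

def GammaOmega : Set ℂ := {s : ℂ | s.im ≠ 0 ∨ 0 < s.re}

def IsLogGamma (L : ℂ → ℂ) : Prop :=
  DifferentiableOn ℂ L GammaOmega ∧ (∀ s ∈ GammaOmega, Complex.exp (L s) = Complex.Gamma s) ∧
    L 1 = 0

def gseq (σ : ℝ) (n : ℕ) : ℂ := -(bernoulliPoly (n+1) (σ:ℂ)) / ((n:ℂ)*((n:ℂ)+1))

def gammam (m : ℕ) (σ : ℝ) : ℂ :=
  I^m * ∑ k ∈ Finset.range (m+1), obell (gseq σ) m k / (Nat.factorial k : ℂ)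


lemma rs_rect_limit (F : ℂ → ℂ) (a b C : ℝ) (hab : a < b)
    (hc : ContinuousOn F {z : ℂ | a ≤ z.im ∧ z.im ≤ b})
    (hd : DifferentiableOn ℂ F {z : ℂ | a < z.im ∧ z.im < b})
    (hb : ∀ z : ℂ, a ≤ z.im → z.im ≤ b → 1 ≤ |z.re| → ‖F z‖ ≤ C * |z.re|⁻¹) :
    Filter.Tendsto (fun T : ℝ => (∫ p in (-T)..T, F (p + a * I)) - ∫ p in (-T)..T, F (p + b * I))
      Filter.atTop (nhds 0) := by
  have h0 : Filter.Tendsto (fun T : ℝ => (2 * C * (b - a)) * T⁻¹) Filter.atTop (nhds 0) := by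
    simpa using (tendsto_inv_atTop_zero (𝕜 := ℝ)).const_mul (2 * C * (b - a))
  refine squeeze_zero_norm' ?_ h0
  filter_upwards [Filter.eventually_ge_atTop (1:ℝ)] with T hT
  have hT' : -T ≤ T := by linarith
  have key := Complex.integral_boundary_rect_eq_zero_of_continuousOn_of_differentiableOn F
    (⟨-T, a⟩ : ℂ) (⟨T, b⟩ : ℂ) (hc.mono ?_) (hd.mono ?_)
  · simp only [] at key
    have e : (∫ p in (-T)..T, F (p + a * I)) - ∫ p in (-T)..T, F (p + b * I)
        = I • (∫ y : ℝ in a..b, F ((-T:ℝ) + y * I)) - I • (∫ y : ℝ in a..b, F ((T:ℝ) + y * I)) := by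
      linear_combination key
    rw [e]
    have n1 : ∀ S : ℝ, |S| = T → ‖∫ y : ℝ in a..b, F ((S:ℝ) + y * I)‖ ≤ C * T⁻¹ * |b - a| := by
      intro S hS
      apply intervalIntegral.norm_integral_le_of_norm_le_const
      intro y hy
      rw [Set.uIoc_of_le hab.le] at hy
      have := hb ((S:ℝ) + y * I) (by simpa using hy.1.le) (by simpa using hy.2)
        (by simpa [hS] using hT)
      simpa [hS] using this
    have m1 := n1 (-T) (by rw [abs_neg, abs_of_nonneg (by linarith)])
    have m2 := n1 T (by rw [abs_of_nonneg (by linarith)])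
    rw [abs_of_pos (by linarith)] at m1 m2
    refine (norm_sub_le _ _).trans ?_
    rw [norm_smul, norm_smul, norm_I]
    linarith
  · intro z hz
    rw [Complex.mem_reProdIm] at hz
    simpa [Set.uIcc_of_le hab.le] using hz.2
  · intro z hz
    rw [Complex.mem_reProdIm] at hz
    simpa [hab.le] using hz.2

lemma rs_line_integrable (f : ℝ → ℂ) (C : ℝ) (hf : Continuous f)
    (hb : ∀ p : ℝ, 1 ≤ |p| → ‖f p‖ ≤ C * (1 + p^2)⁻¹) : Integrable f := by
  obtain ⟨M, hM⟩ := (isCompact_Icc (a := (-1:ℝ)) (b := 1)).exists_bound_of_continuousOn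
    hf.continuousOn
  have hM0 : 0 ≤ M := (norm_nonneg _).trans (hM 0 (by simp))
  refine Integrable.mono' (integrable_inv_one_add_sq.const_mul (|C| + 2 * M))
    hf.aestronglyMeasurable ?_
  refine Filter.Eventually.of_forall fun p => ?_
  have hp : 0 < (1 + p^2)⁻¹ := by positivity
  by_cases h : 1 ≤ |p|
  · refine (hb p h).trans ?_
    apply mul_le_mul_of_nonneg_right _ hp.le
    linarith [le_abs_self C]
  · push Not at h
    rw [abs_lt] at h
    refine (hM p ⟨h.1.le, h.2.le⟩).trans ?_
    have : (1/2:ℝ) ≤ (1 + p^2)⁻¹ := by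
      rw [one_div]
      apply inv_anti₀ (by positivity)
      nlinarith
    nlinarith [abs_nonneg C]

lemma rs_dec {p C : ℝ} (hC : 0 ≤ C) (hp : 1 ≤ |p|) : C * (1 + p^2)⁻¹ ≤ C * |p|⁻¹ := by
  apply mul_le_mul_of_nonneg_left _ hC
  apply inv_anti₀ (by linarith)
  nlinarith [sq_abs p]

lemma rs_strip (F : ℂ → ℂ) (a b C : ℝ) (hab : a < b)
    (hc : ContinuousOn F {z : ℂ | a ≤ z.im ∧ z.im ≤ b})
    (hd : DifferentiableOn ℂ F {z : ℂ | a < z.im ∧ z.im < b})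
    (hb : ∀ z : ℂ, a ≤ z.im → z.im ≤ b → 1 ≤ |z.re| → ‖F z‖ ≤ C * (1 + z.re^2)⁻¹) :
    ∫ p : ℝ, F (p + a * I) = ∫ p : ℝ, F (p + b * I) := by
  have hC : 0 ≤ C := by
    have := (norm_nonneg _).trans (hb (1 + a * I) (by simp) (by simpa using hab.le) (by simp))
    simp at this
    linarith
  have hl := rs_rect_limit F a b C hab hc hd
    (fun z h1 h2 h3 => (hb z h1 h2 h3).trans (rs_dec hC h3))
  have hi : ∀ q : ℝ, a ≤ q → q ≤ b → Integrable (fun p : ℝ => F (p + q * I)) := by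
    intro q h1 h2
    refine rs_line_integrable _ C ?_ ?_
    · refine hc.comp_continuous (by fun_prop) ?_
      intro p; simp [h1, h2]
    · intro p hp
      simpa using hb (p + q * I) (by simpa using h1) (by simpa using h2) (by simpa using hp)
  have ia := intervalIntegral_tendsto_integral (hi a le_rfl hab.le) Filter.tendsto_neg_atTop_atBot
    Filter.tendsto_id
  have ib := intervalIntegral_tendsto_integral (hi b hab.le le_rfl) Filter.tendsto_neg_atTop_atBot
    Filter.tendsto_id
  exact sub_eq_zero.mp (tendsto_nhds_unique (ia.sub ib) hl)

lemma rs_pole_int (d : ℝ) (hd : 0 < d) :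
    Integrable (fun p : ℝ => ((p:ℂ) + (-d:ℝ) * I)⁻¹ - ((p:ℂ) + (d:ℝ) * I)⁻¹) ∧
    ∫ p : ℝ, (((p:ℂ) + (-d:ℝ) * I)⁻¹ - ((p:ℂ) + (d:ℝ) * I)⁻¹) = 2 * π * I := by
  have e : (fun p : ℝ => ((p:ℂ) + (-d:ℝ) * I)⁻¹ - ((p:ℂ) + (d:ℝ) * I)⁻¹)
      = fun p : ℝ => (2 * I / d) * (((1 + (p * d⁻¹)^2)⁻¹ : ℝ) : ℂ) := by
    funext p
    have h1 : ((p:ℂ) + (-d:ℝ) * I) ≠ 0 := fun h => by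
      have := congrArg Complex.im h; simp at this; linarith
    have h2 : ((p:ℂ) + (d:ℝ) * I) ≠ 0 := fun h => by
      have := congrArg Complex.im h; simp at this; linarith
    have h3 : (d:ℂ) ≠ 0 := by exact_mod_cast hd.ne'
    have h4 : (1 + ((p:ℂ) * (d:ℂ)⁻¹)^2) ≠ 0 := by
      have : (0:ℝ) < 1 + (p * d⁻¹)^2 := by positivity
      exact_mod_cast this.ne'
    have h4' : (d:ℂ)^2 + p^2 ≠ 0 := by
      have : (0:ℝ) < d^2 + p^2 := by positivity
      exact_mod_cast this.ne'
    have h5 : (1 + ((p:ℂ) * (d:ℂ)⁻¹)^2) = ((d:ℂ)^2 + p^2)/d^2 := by field_simp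
    push_cast at h1 h2 ⊢
    rw [h5, inv_sub_inv h1 h2]
    have : ((p:ℂ) + -d * I) * (p + d * I) = (d:ℂ)^2 + p^2 := by
      ring_nf; rw [I_sq]; ring
    rw [this]
    field_simp
    ring
  have i0 : Integrable (fun p : ℝ => (1 + (p * d⁻¹)^2)⁻¹) :=
    (integrable_inv_one_add_sq).comp_mul_right' (inv_ne_zero hd.ne')
  rw [e]
  refine ⟨(i0.ofReal).const_mul _, ?_⟩
  rw [integral_const_mul, integral_complex_ofReal,
    Measure.integral_comp_mul_right (fun x => (1 + x^2)⁻¹) d⁻¹, integral_univ_inv_one_add_sq]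
  have h3 : (d:ℂ) ≠ 0 := by exact_mod_cast hd.ne'
  rw [inv_inv, abs_of_pos hd, smul_eq_mul]
  push_cast
  field_simp

lemma rs_pole (N : ℂ → ℂ) (d e C : ℝ) (hd : 0 < d) (hde : d < e)
    (hN : DifferentiableOn ℂ N {z : ℂ | |z.im| < e})
    (hb : ∀ z : ℂ, |z.im| ≤ d → 1 ≤ |z.re| → ‖N z / z‖ ≤ C * (1 + z.re^2)⁻¹) :
    (∫ p : ℝ, N (p + (-d:ℝ) * I) / (p + (-d:ℝ) * I)) - ∫ p : ℝ, N (p + (d:ℝ) * I) / (p + (d:ℝ) * I)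
      = 2 * π * I * N 0 := by
  have hopen : IsOpen {z : ℂ | |z.im| < e} := isOpen_lt (by fun_prop) (by fun_prop)
  have hC : 0 ≤ C := by
    have := (norm_nonneg _).trans (hb 1 (by simpa using hd.le) (by simp))
    simp at this
    linarith
  have hH : DifferentiableOn ℂ (dslope N 0) {z : ℂ | |z.im| < e} :=
    (Complex.differentiableOn_dslope (hopen.mem_nhds (by simp; linarith))).2 hN
  have hHe : ∀ z : ℂ, z ≠ 0 → dslope N 0 z = N z / z - N 0 * z⁻¹ := by
    intro z hz
    rw [dslope_of_ne _ hz, slope_def_field]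
    simp; ring
  have hl := rs_rect_limit (dslope N 0) (-d) d (C + ‖N 0‖) (by linarith)
    (hH.continuousOn.mono (fun z hz => by
      have := abs_le.2 hz
      exact lt_of_le_of_lt this hde))
    (hH.mono (fun z hz => by
      have := abs_lt.2 hz
      exact lt_trans this hde))
    (by
      intro z h1 h2 h3
      have hz : z ≠ 0 := fun h => by rw [h] at h3; simp at h3; linarith
      rw [hHe z hz, add_mul]
      refine (norm_sub_le _ _).trans (add_le_add ?_ ?_)
      · exact (hb z (abs_le.2 ⟨h1, h2⟩) h3).trans (rs_dec hC h3)
      · rw [norm_mul, norm_inv]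
        apply mul_le_mul_of_nonneg_left _ (norm_nonneg _)
        exact inv_anti₀ (by linarith) (Complex.abs_re_le_norm z))
  have hne : ∀ q : ℝ, q ≠ 0 → ∀ p : ℝ, ((p:ℂ) + q * I) ≠ 0 := fun q hq p h => by
      have := congrArg Complex.im h; simp at this; exact hq this
  have hcont : ∀ q : ℝ, q ≠ 0 → |q| ≤ d → Continuous (fun p : ℝ => N (p + q * I) / (p + q * I)) := by
    intro q hq hqd
    refine Continuous.div ?_ (by fun_prop) (hne q hq)
    refine hN.continuousOn.comp_continuous (by fun_prop) ?_
    intro p; simp; linarith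
  have hi : ∀ q : ℝ, q ≠ 0 → |q| ≤ d → Integrable (fun p : ℝ => N (p + q * I) / (p + q * I)) := by
    intro q hq hqd
    refine rs_line_integrable _ C (hcont q hq hqd) ?_
    intro p hp
    simpa using hb (p + q * I) (by simpa using hqd) (by simpa using hp)
  have hd1 : |(-d)| ≤ d := by rw [abs_neg, abs_of_pos hd]
  have hd2 : |d| ≤ d := by rw [abs_of_pos hd]
  obtain ⟨pi1, pi2⟩ := rs_pole_int d hd
  have T0 := Filter.tendsto_neg_atTop_atBot (G := ℝ)
  have ia := intervalIntegral_tendsto_integral (hi (-d) (by linarith) hd1) T0 Filter.tendsto_id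
  have ib := intervalIntegral_tendsto_integral (hi d hd.ne' hd2) T0 Filter.tendsto_id
  have ic := (intervalIntegral_tendsto_integral pi1 T0 Filter.tendsto_id).const_mul (N 0)
  rw [pi2] at ic
  have hfin := tendsto_nhds_unique ((ia.sub ib).sub ic) (hl.congr ?_)
  · linear_combination hfin
  · intro T
    have i1 : ∀ q : ℝ, q ≠ 0 → Continuous (fun p : ℝ => ((p:ℂ) + q * I)⁻¹) := fun q hq =>
      Continuous.inv₀ (by fun_prop) (hne q hq)
    have c1 := i1 (-d) (by linarith)
    have c2 := i1 d hd.ne'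
    have f1 : ∀ q : ℝ, q ≠ 0 → |q| ≤ d → (∫ p in (-T)..T, dslope N 0 (p + q * I))
        = (∫ p in (-T)..T, N (p + q * I) / (p + q * I)) - N 0 * ∫ p in (-T)..T, ((p:ℂ) + q * I)⁻¹ := by
      intro q hq hqd
      rw [← intervalIntegral.integral_const_mul, ← intervalIntegral.integral_sub]
      · exact intervalIntegral.integral_congr fun p _ => hHe _ (hne q hq p)
      · exact (hcont q hq hqd).intervalIntegrable _ _
      · exact ((i1 q hq).const_mul _).intervalIntegrable _ _
    rw [f1 _ (by linarith) hd1, f1 _ hd.ne' hd2]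
    simp only [id]
    rw [intervalIntegral.integral_sub (c1.intervalIntegrable _ _) (c2.intervalIntegrable _ _)]
    ring



lemma rs_normsq_sin (w : ℂ) : ‖Complex.sin w‖^2 = Real.sin w.re ^2 + Real.sinh w.im ^2 := by
  rw [← Complex.normSq_eq_norm_sq, Complex.sin_eq w, ← ofReal_sin, ← ofReal_cos, ← ofReal_cosh,
    ← ofReal_sinh, ← ofReal_mul, ← ofReal_mul, Complex.normSq_add_mul_I]
  have h1 := Real.cosh_sq w.im
  have h2 := Real.sin_sq_add_cos_sq w.re
  rw [mul_pow, mul_pow, h1]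
  linear_combination (Real.sinh w.im)^2 * h2

lemma rs_abs_le_sinh (y : ℝ) : |y| ≤ |Real.sinh y| := by
  rw [Real.abs_sinh]
  exact Real.self_le_sinh_iff.2 (abs_nonneg y)

lemma rs_im_le_sin (w : ℂ) : |w.im| ≤ ‖Complex.sin w‖ := by
  apply abs_le_of_sq_le_sq' _ (norm_nonneg _) |>.2
  have := sq_le_sq.2 (rs_abs_le_sinh w.im)
  rw [sq_abs, rs_normsq_sin]
  nlinarith [sq_nonneg (Real.sin w.re)]

lemma rs_cos_ge (p : ℝ) : 1 ≤ ‖Complex.cos (π * (1 + I) * p)‖ := by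
  rw [← Complex.sin_add_pi_div_two]
  have h := rs_normsq_sin ((π:ℂ) * (1 + I) * p + π/2)
  have e1 : ((π:ℂ) * (1 + I) * p + π/2).re = π * p + π / 2 := by simp
  have e2 : ((π:ℂ) * (1 + I) * p + π/2).im = π * p := by simp
  rw [e1, e2, Real.sin_add_pi_div_two] at h
  have h2 := sq_le_sq.2 (rs_abs_le_sinh (π * p))
  have h3 := Real.sin_sq_le_sq (x := π * p)
  have h4 := Real.sin_sq_add_cos_sq (π * p)
  have : 1 ≤ ‖Complex.sin ((π:ℂ) * (1 + I) * p + π/2)‖^2 := by rw [h]; nlinarith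
  exact (one_le_sq_iff₀ (norm_nonneg _)).1 this

lemma rs_one_add_I_ne : (1 + I : ℂ) ≠ 0 := fun h => by
  have := congrArg Complex.re h; simp at this

lemma rs_sin_zero (z : ℂ) (hz : |z.im| < 1/2) (h : Complex.sin (π * (1 + I) * z) = 0) : z = 0 := by
  rw [Complex.sin_eq_zero_iff] at h
  obtain ⟨k, hk⟩ := h
  have hpi : (π:ℂ) ≠ 0 := by exact_mod_cast Real.pi_ne_zero
  have hk' : (1 + I) * z = k := by
    have : (π:ℂ) * ((1 + I) * z) = π * k := by linear_combination hk
    exact mul_left_cancel₀ hpi this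
  have r := congrArg Complex.re hk'
  have i := congrArg Complex.im hk'
  simp at r i
  have hk0 : (k:ℝ) = -2 * z.im := by linarith
  have : |(k:ℝ)| < 1 := by rw [hk0, abs_mul]; norm_num; linarith
  have hkz : k = 0 := by
    rw [← Int.cast_abs] at this
    exact_mod_cast Int.abs_lt_one_iff.1 (by exact_mod_cast this)
  rw [hkz] at hk'
  simpa [rs_one_add_I_ne] using hk'

def rsS (z : ℂ) : ℂ := Complex.sin (π * (1 + I) * z)

lemma rsS_diff : Differentiable ℂ rsS := by unfold rsS; fun_prop

lemma rsS_zero : rsS 0 = 0 := by simp [rsS]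

lemma rsS_deriv : deriv rsS 0 = π * (1 + I) := by
  have : HasDerivAt rsS (Complex.cos (π * (1 + I) * 0) * (π * (1 + I) * 1)) 0 :=
    ((hasDerivAt_id (0:ℂ)).const_mul (π * (1 + I) : ℂ)).csin
  rw [this.deriv]; simp

lemma rs_piI_ne : (π * (1 + I) : ℂ) ≠ 0 :=
  mul_ne_zero (by exact_mod_cast Real.pi_ne_zero) rs_one_add_I_ne

lemma rsS_dslope_diff : Differentiable ℂ (dslope rsS 0) := by
  rw [← differentiableOn_univ]
  exact (Complex.differentiableOn_dslope Filter.univ_mem).2 rsS_diff.differentiableOn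

lemma rsS_dslope_ne (z : ℂ) (hz : |z.im| < 1/2) : dslope rsS 0 z ≠ 0 := by
  by_cases h : z = 0
  · rw [h, dslope_same, rsS_deriv]; exact rs_piI_ne
  · rw [dslope_of_ne _ h, slope_def_field, rsS_zero]
    simp only [sub_zero]
    exact div_ne_zero (fun h' => h (rs_sin_zero z hz h')) h

lemma rsS_eq (z : ℂ) : rsS z = z * dslope rsS 0 z := by
  have := sub_smul_dslope rsS 0 z
  simpa [rsS_zero] using this.symm

lemma rsS_ge_one (z : ℂ) (h1 : |z.im| ≤ 1/2) (h2 : 1 ≤ |z.re|) : 1 ≤ ‖rsS z‖ := by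
  refine le_trans ?_ (rs_im_le_sin _)
  have e : ((π:ℂ) * (1 + I) * z).im = π * (z.re + z.im) := by simp; ring
  rw [e, abs_mul, abs_of_pos Real.pi_pos]
  have : 1/2 ≤ |z.re + z.im| := by
    have := abs_sub_abs_le_abs_sub z.re (-z.im)
    rw [abs_neg, sub_neg_eq_add] at this
    linarith
  nlinarith [Real.pi_gt_three]

lemma rs_sin_pole (Ψ : ℂ → ℂ) (C : ℝ) (hΨ : DifferentiableOn ℂ Ψ {z : ℂ | |z.im| < 1/2})
    (hb : ∀ z : ℂ, |z.im| ≤ 1/4 → 1 ≤ |z.re| → ‖Ψ z‖ ≤ C * (1 + z.re^2)⁻¹) :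
    (∫ p : ℝ, Ψ (p + (-(1/4):ℝ) * I) / rsS (p + (-(1/4):ℝ) * I))
      - ∫ p : ℝ, Ψ (p + (1/4:ℝ) * I) / rsS (p + (1/4:ℝ) * I)
      = (1 + I) * Ψ 0 := by
  have e : ∀ z : ℂ, (Ψ z / dslope rsS 0 z) / z = Ψ z / rsS z := by
    intro z; rw [rsS_eq z, div_div, mul_comm z]
  have := rs_pole (fun z => Ψ z / dslope rsS 0 z) (1/4) (1/2) C (by norm_num) (by norm_num)
    (hΨ.div rsS_dslope_diff.differentiableOn (fun z hz => rsS_dslope_ne z hz))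
    (by
      intro z h1 h2
      rw [e, norm_div]
      refine (div_le_self (norm_nonneg _) (rsS_ge_one z (by linarith) h2)).trans (hb z h1 h2))
  simp only [e] at this
  rw [this, dslope_same, rsS_deriv]
  have h1 := rs_one_add_I_ne
  have hpi : (π:ℂ) ≠ 0 := by exact_mod_cast Real.pi_ne_zero
  field_simp
  ring_nf
  rw [I_sq]; ring



def rsL (f : ℂ → ℂ) (c : ℝ) : ℂ := ∫ p : ℝ, f (c + (1 + I) * p)

lemma rsL_shift (f : ℂ → ℂ) (k q : ℝ) :
    ∫ p : ℝ, f (k + (1 + I) * (p + q * I)) = rsL f (k - 2 * q) := by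
  unfold rsL
  rw [← integral_add_right_eq_self (fun p : ℝ => f (((k - 2 * q : ℝ) : ℂ) + (1 + I) * p)) q]
  congr 1; funext p; congr 1
  push_cast
  ring_nf; rw [I_sq]; ring

lemma rs_gauss (K p : ℝ) : Real.exp (-p^2 + K * |p|) ≤ 2 * Real.exp (K^2/2) * (1 + p^2)⁻¹ := by
  have h1 : -p^2 + K * |p| ≤ -(p^2/2) + K^2/2 := by nlinarith [sq_nonneg (|p| - K), sq_abs p]
  have h2 : Real.exp (-(p^2/2)) ≤ 2 * (1 + p^2)⁻¹ := by
    rw [Real.exp_neg]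
    have : (1 + p^2)/2 ≤ Real.exp (p^2/2) := by
      have := Real.add_one_le_exp (p^2/2); linarith
    have h3 := inv_anti₀ (by positivity) this
    rw [inv_div] at h3
    simpa [div_eq_mul_inv] using h3
  calc Real.exp (-p^2 + K * |p|) ≤ Real.exp (-(p^2/2) + K^2/2) := Real.exp_le_exp.2 h1
    _ = Real.exp (-(p^2/2)) * Real.exp (K^2/2) := Real.exp_add _ _
    _ ≤ (2 * (1 + p^2)⁻¹) * Real.exp (K^2/2) := by gcongr
    _ = _ := by ring

lemma rs_residue (Φ : ℂ → ℂ) (C : ℝ) (k : ℕ)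
    (hΦ : DifferentiableOn ℂ Φ {x : ℂ | k - 1 < x.re - x.im ∧ x.re - x.im < k + 1})
    (hb : ∀ z : ℂ, |z.im| ≤ 1/4 → 1 ≤ |z.re| → ‖Φ (k + (1 + I) * z)‖ ≤ C * (1 + z.re^2)⁻¹) :
    rsL (fun x => Φ x / Complex.sin (π * x)) (k + 1/2) -
      rsL (fun x => Φ x / Complex.sin (π * x)) (k - 1/2) = (-1)^k * (1 + I) * Φ k := by
  have h := rs_sin_pole (fun z => (-1)^k * Φ (k + (1 + I) * z)) C ?_ ?_
  · have e : ∀ z : ℂ, (-1)^k * Φ (k + (1 + I) * z) / rsS z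
        = Φ (k + (1 + I) * z) / Complex.sin (π * (k + (1 + I) * z)) := by
      intro z
      have : (π:ℂ) * (k + (1 + I) * z) = π * (1 + I) * z + k * π := by ring
      rw [this, Complex.sin_antiperiodic.add_nat_mul_eq, rsS]
      have h1 : ((-1:ℂ)^k) * (-1)^k = 1 := by rw [← mul_pow]; simp
      have h2 : ((-1:ℂ)^k) ≠ 0 := by simp
      have h3 : ((-1:ℂ)^k)⁻¹ = (-1)^k := by
        rw [inv_eq_iff_eq_inv, eq_comm]; exact inv_eq_of_mul_eq_one_left h1
      rw [div_eq_mul_inv, div_eq_mul_inv, mul_inv, h3]; ring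
    simp only [e] at h
    have s1 := rsL_shift (fun x => Φ x / Complex.sin (π * x)) k (-(1/4))
    have s2 := rsL_shift (fun x => Φ x / Complex.sin (π * x)) k (1/4)
    have t1 : (k:ℝ) - 2 * (-(1/4)) = k + 1/2 := by ring
    have t2 : (k:ℝ) - 2 * (1/4) = k - 1/2 := by ring
    rw [t1] at s1; rw [t2] at s2
    simp only [ofReal_natCast] at s1 s2
    rw [← s1, ← s2, h]
    simp; ring
  · refine DifferentiableOn.const_mul ?_ _
    refine hΦ.comp (by fun_prop) ?_
    intro z hz
    simp only [Set.mem_ofPred_eq, abs_lt] at hz ⊢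
    simp
    constructor <;> linarith [hz.1, hz.2]
  · intro z h1 h2
    simp only [norm_mul, norm_pow, norm_neg, norm_one, one_pow, one_mul]
    exact hb z h1 h2

def rsE (w x : ℂ) : ℂ := Complex.exp (π * I * x^2 - 2 * π * I * x * w)

def rsN (w : ℂ) : ℂ := rsL (fun x => rsE w x / Complex.sin (π * x)) (1/2)

lemma rsE_line (w : ℂ) (p : ℝ) : rsE w ((1/2:ℝ) + (1 + I) * p) =
    Complex.exp ((-2 * π : ℂ) * p^2 + (2 * π * I * (1 + I) * (1/2 - w)) * p + (π * I /4 - π * I * w)) := by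
  unfold rsE; congr 1; push_cast; ring_nf; simp only [I_sq, I_pow_three]; ring

lemma rs_sin_line (p : ℝ) : Complex.sin (π * ((1/2:ℝ) + (1 + I) * p)) = Complex.cos (π * (1 + I) * p) := by
  rw [← Complex.sin_add_pi_div_two]; congr 1; push_cast; ring

lemma rs_cos_cont : Continuous (fun p : ℝ => (Complex.cos (π * (1 + I) * p))⁻¹) := by
  refine Continuous.inv₀ (by fun_prop) ?_
  intro p h
  have := rs_cos_ge p
  rw [h] at this; simp at this; linarith

lemma rs_cos_inv_le (p : ℝ) : ‖(Complex.cos (π * (1 + I) * p))⁻¹‖ ≤ 1 := by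
  rw [norm_inv]; exact inv_le_one_of_one_le₀ (rs_cos_ge p)

lemma rs_bddmul {f : ℝ → ℂ} (hf : Integrable f) :
    Integrable (fun p : ℝ => f p / Complex.cos (π * (1 + I) * p)) := by
  simp only [div_eq_mul_inv]
  exact hf.mul_bdd (c := 1) rs_cos_cont.aestronglyMeasurable (Filter.Eventually.of_forall rs_cos_inv_le)

lemma rsE_int (w : ℂ) : Integrable (fun p : ℝ => rsE w ((1/2:ℝ) + (1 + I) * p)) := by
  simp only [rsE_line]
  have h := integrable_cexp_quadratic (b := (2 * π : ℂ)) (by simp [Real.pi_pos]) (2 * π * I * (1 + I) * (1/2 - w)) (π * I /4 - π * I * w)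
  have e : (-(2 * π) : ℂ) = -2 * π := by ring
  rw [e] at h; exact h

lemma rsE_integral (w : ℂ) : ∫ p : ℝ, rsE w ((1/2:ℝ) + (1 + I) * p)
    = (1/2:ℂ)^(1/2:ℂ) * Complex.exp (- π * I * w^2) := by
  simp only [rsE_line]
  rw [integral_cexp_quadratic (by simp [Real.pi_pos])]
  have hpi : (π:ℂ) ≠ 0 := by exact_mod_cast Real.pi_ne_zero
  congr 1
  · congr 1; field_simp
  · congr 1; field_simp; ring_nf; simp only [I_sq, I_pow_three]; ring_nf

lemma rsN_rel1 (w : ℂ) : rsN (w - 1) - rsN w = (2 * I) * ((1/2:ℂ)^(1/2:ℂ) * Complex.exp (- π * I * (w-1/2)^2)) := by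
  rw [← rsE_integral, ← integral_const_mul]
  unfold rsN rsL
  simp only [rs_sin_line]
  rw [← integral_sub (rs_bddmul (rsE_int _)) (rs_bddmul (rsE_int _))]
  congr 1; funext p
  have hc : Complex.cos (π * (1 + I) * p) ≠ 0 := fun h => by
    have := rs_cos_ge p
    rw [h] at this; simp at this; linarith
  rw [← sub_div, div_eq_iff hc, ← rs_sin_line, Complex.sin]
  set x : ℂ := ((1/2:ℝ) + (1 + I) * p)
  have e1 : rsE (w-1) x = rsE (w-1/2) x * Complex.exp (π * x * I) := by
    unfold rsE; rw [← Complex.exp_add]; congr 1; ring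
  have e2 : rsE w x = rsE (w-1/2) x * Complex.exp (-(π * x) * I) := by
    unfold rsE; rw [← Complex.exp_add]; congr 1; ring
  rw [e1, e2]; ring_nf; rw [I_sq]; ring

lemma rsE_bound (w : ℂ) (k : ℝ) : ∃ C : ℝ, ∀ z : ℂ, |z.im| ≤ 1/2 →
    ‖rsE w (k + (1 + I) * z)‖ ≤ C * (1 + z.re^2)⁻¹ := by
  set A : ℂ := π * I * k^2 - 2 * π * I * k * w
  set B : ℂ := 2 * π * I * k * (1 + I) - 2 * π * I * (1 + I) * w
  refine ⟨Real.exp (2 * π + ‖A‖ + ‖B‖) * (2 * Real.exp (‖B‖^2/2)), fun z hz => ?_⟩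
  have e : rsE w (k + (1 + I) * z) = Complex.exp (-2 * π * z^2 + A + B * z) := by
    unfold rsE; congr 1; simp only [A, B]; ring_nf; simp only [I_sq, I_pow_three]; ring
  rw [e, Complex.norm_exp, mul_assoc (Real.exp _)]
  refine le_trans ?_ (mul_le_mul_of_nonneg_left (rs_gauss ‖B‖ z.re) (Real.exp_pos _).le)
  rw [← Real.exp_add, Real.exp_le_exp]
  have h1 : ((-2 * π * z^2 : ℂ)).re = -2 * π * (z.re^2 - z.im^2) := by
    have : (-2 * π * z^2 : ℂ) = ((-2 * π : ℝ) : ℂ) * z^2 := by push_cast; ring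
    rw [this, Complex.re_ofReal_mul, pow_two z, Complex.mul_re]; ring
  rw [Complex.add_re, Complex.add_re, h1]
  have h2 := Complex.re_le_norm A
  have h3 : (B * z).re ≤ ‖B‖ * (|z.re| + 1) := by
    refine (Complex.re_le_norm _).trans ?_
    rw [norm_mul]
    gcongr
    refine (Complex.norm_le_abs_re_add_abs_im z).trans ?_
    linarith
  have h4 : z.im^2 ≤ 1 := by rw [← sq_abs]; nlinarith [abs_nonneg z.im]
  nlinarith [Real.pi_gt_three, sq_nonneg z.re, mul_le_mul_of_nonneg_left h4 Real.pi_pos.le, mul_nonneg (sub_nonneg.2 Real.pi_gt_three.le) (sq_nonneg z.re)]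

lemma rsN_rel2 (w : ℂ) : Complex.exp (-2 * π * I * w) * rsN (w - 1) - rsN w
    = (1 + I) * Complex.exp (-2 * π * I * w) := by
  obtain ⟨C, hC⟩ := rsE_bound w 1
  have h := rs_residue (rsE w) C 1 (by unfold rsE; fun_prop)
    (fun z h1 _ => by simpa using hC z (by linarith))
  have e0 : rsL (fun x => rsE w x / Complex.sin (π * x)) ((1:ℕ) - 1/2) = rsN w := by
    unfold rsN; congr 1; norm_num
  have e1 : rsL (fun x => rsE w x / Complex.sin (π * x)) ((1:ℕ) + 1/2)
      = Complex.exp (-2 * π * I * w) * rsN (w - 1) := by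
    unfold rsN rsL
    rw [← integral_const_mul]
    congr 1; funext p
    have hs : ((((1:ℕ) + 1/2 : ℝ) : ℂ) + (1 + I) * p) = (((1/2:ℝ):ℂ) + (1 + I) * p) + 1 := by
      push_cast; ring
    rw [hs]
    set x : ℂ := ((1/2:ℝ) + (1 + I) * p)
    have hs2 : Complex.sin (π * (x + 1)) = - Complex.sin (π * x) := by
      rw [mul_add, mul_one, Complex.sin_add_pi]
    have he : rsE w (x + 1) = - (Complex.exp (-2 * π * I * w) * rsE (w-1) x) := by
      unfold rsE
      rw [← Complex.exp_add, ← mul_neg_one, ← Complex.exp_pi_mul_I, ← Complex.exp_add]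
      congr 1; ring
    simp only
    rw [hs2, he, neg_div_neg_eq, mul_div_assoc]
  rw [e0, e1] at h
  rw [h]
  unfold rsE
  have : Complex.exp (π * I * ((1:ℕ):ℂ)^2 - 2 * π * I * ((1:ℕ):ℂ) * w) = - Complex.exp (-2 * π * I * w) := by
    rw [← mul_neg_one, ← Complex.exp_pi_mul_I, ← Complex.exp_add]
    congr 1; push_cast; ring
  rw [this]; ring

lemma rs_sqrt_half : (2 * I) * ((1/2:ℂ)^(1/2:ℂ) * Complex.exp (- π * I / 4)) = 1 + I := by
  have h1 : (1/2:ℂ)^(1/2:ℂ) = ((Real.sqrt 2 / 2 : ℝ) : ℂ) := by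
    have : (1/2:ℂ)^(1/2:ℂ) = (((1/2:ℝ)^(1/2:ℝ) : ℝ) : ℂ) := by
      rw [Complex.ofReal_cpow (by norm_num)]; push_cast; rfl
    rw [this, ← Real.sqrt_eq_rpow]
    congr 1
    rw [one_div, Real.sqrt_inv]
    have := Real.mul_self_sqrt (show (0:ℝ) ≤ 2 by norm_num)
    field_simp
    linarith [this]
  have h2 : Complex.exp (- π * I / 4) = ((Real.sqrt 2 / 2 : ℝ) : ℂ) * (1 - I) := by
    have : (-π * I / 4 : ℂ) = ((-(π/4) : ℝ) : ℂ) * I := by push_cast; ring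
    rw [this, Complex.exp_mul_I, ← Complex.ofReal_cos, ← Complex.ofReal_sin, Real.cos_neg, Real.sin_neg,
      Real.cos_pi_div_four, Real.sin_pi_div_four]
    push_cast; ring
  rw [h1, h2]
  have h3 : ((Real.sqrt 2 / 2 : ℝ) : ℂ) * ((Real.sqrt 2 / 2 : ℝ) : ℂ) = 1/2 := by
    rw [← Complex.ofReal_mul]
    have := Real.mul_self_sqrt (show (0:ℝ) ≤ 2 by norm_num)
    have : Real.sqrt 2 / 2 * (Real.sqrt 2 / 2) = 1/2 := by nlinarith
    rw [this]; push_cast; rfl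
  linear_combination (2 * I * (1 - I)) * h3 - I_sq

lemma rsN_eq (w : ℂ) : rsN w * (Complex.exp (2 * π * I * w) - 1)
    = (1 + I) * (Complex.exp (-π * I * w^2 + π * I * w) - 1) := by
  have r1 := rsN_rel1 w
  have r2 := rsN_rel2 w
  have e1 : Complex.exp (- π * I * (w-1/2)^2) = Complex.exp (-π * I * w^2 + π * I * w) * Complex.exp (-π * I / 4) := by
    rw [← Complex.exp_add]; congr 1; ring
  have r3 : rsN (w-1) - rsN w = (1 + I) * Complex.exp (-π * I * w^2 + π * I * w) := by
    rw [r1, e1, ← rs_sqrt_half]; ring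
  have e2 : Complex.exp (2 * π * I * w) * Complex.exp (-2 * π * I * w) = 1 := by
    rw [← Complex.exp_add]; ring_nf; simp
  linear_combination (-Complex.exp (2 * π * I * w)) * r2 + r3 +
    ( (rsN (w-1)) - (1+I)) * e2


lemma rs_mul_cpow {a b : ℂ} (ha : 0 < a.re) (hb : 0 < b.re) (s : ℂ) : (a * b)^s = a^s * b^s := by
  have ha0 : a ≠ 0 := fun h => by simp [h] at ha
  have hb0 : b ≠ 0 := fun h => by simp [h] at hb
  have h1 := Complex.abs_arg_lt_pi_div_two_iff.2 (Or.inl ha)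
  have h2 := Complex.abs_arg_lt_pi_div_two_iff.2 (Or.inl hb)
  rw [abs_lt] at h1 h2
  have : Complex.log (a * b) = Complex.log a + Complex.log b :=
    (Complex.log_mul_eq_add_log_iff ha0 hb0).2 ⟨by linarith, by linarith⟩
  rw [cpow_def_of_ne_zero (mul_ne_zero ha0 hb0), cpow_def_of_ne_zero ha0, cpow_def_of_ne_zero hb0,
    this, ← Complex.exp_add]
  congr 1; ring

lemma rs_gamma_diff (s : ℂ) (hs : 0 < s.re) (r : ℂ) (hr : 0 < r.re) : DifferentiableAt ℂ
    (fun r : ℂ => ∫ ρ : ℝ in Set.Ioi 0, (ρ:ℂ)^(s-1) * Complex.exp (-(r * ρ))) r := by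
  have hI : ∀ (a : ℝ) (b : ℂ), -1 < a → 0 < b.re → IntegrableOn (fun ρ : ℝ => ρ^a * Real.exp (-(b.re * ρ))) (Set.Ioi 0) := by
    intro a b ha hb
    have h2 := integrableOn_rpow_mul_exp_neg_mul_rpow (p := 1) (s := a) ha one_pos hb
    refine h2.congr_fun (fun ρ _ => by simp) measurableSet_Ioi
  refine (hasDerivAt_integral_of_dominated_loc_of_deriv_le (μ := volume.restrict (Set.Ioi 0))
    (F := fun (r : ℂ) (ρ : ℝ) => (ρ:ℂ)^(s-1) * Complex.exp (-(r * ρ)))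
    (F' := fun (r : ℂ) (ρ : ℝ) => (ρ:ℂ)^(s-1) * (Complex.exp (-(r * ρ)) * (-ρ)))
    (bound := fun ρ : ℝ => ρ^s.re * Real.exp (-(((r/2).re) * ρ)))
    (s := Metric.ball r (r.re/2)) (Metric.ball_mem_nhds _ (by linarith)) ?_ ?_ ?_ ?_ ?_ ?_).2.differentiableAt
  · exact Filter.Eventually.of_forall fun r => Measurable.aestronglyMeasurable (by fun_prop)
  · refine Integrable.mono (hI (s.re - 1) r (by linarith) hr) (Measurable.aestronglyMeasurable (by fun_prop)) ?_
    refine (ae_restrict_iff' measurableSet_Ioi).2 (Filter.Eventually.of_forall fun ρ hρ => ?_)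
    have hρ : 0 < ρ := hρ
    rw [norm_mul, Complex.norm_cpow_eq_rpow_re_of_pos hρ, Complex.norm_exp, Real.norm_of_nonneg (by positivity)]
    simp
  · exact Measurable.aestronglyMeasurable (by fun_prop)
  · refine (ae_restrict_iff' measurableSet_Ioi).2 (Filter.Eventually.of_forall fun ρ hρ z hz => ?_)
    have hρ : 0 < ρ := hρ
    rw [norm_mul, norm_mul, Complex.norm_cpow_eq_rpow_re_of_pos hρ, Complex.norm_exp, norm_neg, Complex.norm_of_nonneg hρ.le]
    have e3 : ρ^s.re = ρ^((s-1).re) * ρ := by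
      rw [← Real.rpow_add_one hρ.ne']; congr 1; simp
    rw [e3]
    have h1 : Real.exp ((-(z * ρ)).re) ≤ Real.exp (-((r/2).re * ρ)) := by
      rw [Real.exp_le_exp]
      simp only [neg_re, mul_re, ofReal_re, ofReal_im, mul_zero, sub_zero]
      have h2 : |(z - r).re| < r.re/2 := lt_of_le_of_lt (Complex.abs_re_le_norm _) (by simpa [dist_eq_norm] using hz)
      rw [abs_lt, Complex.sub_re] at h2
      have h3 : (r/2).re = r.re/2 := by simp
      rw [h3]; nlinarith
    have : 0 ≤ ρ^((s-1).re) * ρ := by positivity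
    nlinarith
  · exact hI s.re (r/2) (by linarith) (by simpa using hr)
  · refine Filter.Eventually.of_forall fun ρ z _ => ?_
    refine HasDerivAt.const_mul _ ?_
    refine HasDerivAt.cexp ?_
    have h := (((hasDerivAt_id z).mul_const (ρ:ℂ)).neg)
    rw [one_mul] at h
    exact h

lemma rs_gamma_r (s : ℂ) (hs : 0 < s.re) (r : ℂ) (hr : 0 < r.re) : 
    ∫ ρ : ℝ in Set.Ioi 0, (ρ:ℂ)^(s-1) * Complex.exp (-(r * ρ)) = (1/r)^s * Complex.Gamma s := by
  have hU : IsOpen {r : ℂ | 0 < r.re} := isOpen_lt continuous_const Complex.continuous_re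
  have hpre : IsPreconnected {r : ℂ | 0 < r.re} := (convex_halfSpace_re_gt 0).isPreconnected
  have h1 : AnalyticOnNhd ℂ (fun r : ℂ => ∫ ρ : ℝ in Set.Ioi 0, (ρ:ℂ)^(s-1) * Complex.exp (-(r * ρ))) {r : ℂ | 0 < r.re} :=
    DifferentiableOn.analyticOnNhd (fun r hr => (rs_gamma_diff s hs r hr).differentiableWithinAt) hU
  have h2 : AnalyticOnNhd ℂ (fun r : ℂ => (1/r)^s * Complex.Gamma s) {r : ℂ | 0 < r.re} := by
    refine DifferentiableOn.analyticOnNhd (fun r hr => ?_) hU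
    have hr : 0 < r.re := hr
    have hr0 : r ≠ 0 := fun h => by simp [h] at hr
    refine DifferentiableAt.differentiableWithinAt ?_
    refine DifferentiableAt.mul_const ?_ _
    refine DifferentiableAt.cpow_const ?_ ?_
    · exact (differentiableAt_const _).div differentiableAt_id hr0
    · left
      rw [one_div, Complex.inv_re]
      have := Complex.normSq_pos.2 hr0
      simpa using div_pos hr this
  refine h1.eqOn_of_preconnected_of_frequently_eq h2 hpre (z₀ := 1) (by simp) ?_ hr
  have ht : Filter.Tendsto (fun n : ℕ => ((1 + 1/((n:ℝ)+1) : ℝ) : ℂ)) Filter.atTop (nhdsWithin 1 {1}ᶜ) := by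
    refine tendsto_nhdsWithin_iff.2 ⟨?_, Filter.Eventually.of_forall fun n => ?_⟩
    · have := (tendsto_one_div_add_atTop_nhds_zero_nat (𝕜 := ℝ)).const_add 1
      have h3 := (Complex.continuous_ofReal.tendsto _).comp this
      simp only [add_zero, Complex.ofReal_one] at h3
      exact h3
    · simp only [Set.mem_compl_iff, Set.mem_singleton_iff]
      intro h
      have h4 := congrArg Complex.re h
      simp only [ofReal_re, one_re] at h4
      have : 0 < 1/((n:ℝ)+1) := by positivity
      linarith
  refine ht.frequently (Filter.Frequently.of_forall fun n => ?_)
  have := Complex.integral_cpow_mul_exp_neg_mul_Ioi (a := s) (r := 1 + 1/((n:ℝ)+1)) hs (by positivity)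
  exact this

def rsκ (s : ℂ) : ℂ := (2 * π * (1 + I) : ℂ)^s

/-- the Riemann integrand -/
def rsX (s x : ℂ) : ℂ := x^(-s) * Complex.exp (π * I * x^2)

def rsQ (s : ℂ) (c : ℝ) : ℂ := rsL (fun x => rsX s x / Complex.sin (π * x)) c

lemma rs_inv_cpow {a : ℂ} (ha : 0 < a.re) (s : ℂ) : (1/a)^s = a^(-s) := by
  have h1 := Complex.abs_arg_lt_pi_div_two_iff.2 (Or.inl ha)
  rw [abs_lt] at h1
  rw [one_div, Complex.inv_cpow _ _ (by linarith [Real.pi_pos]), Complex.cpow_neg]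

lemma rs_gamma_line (s x : ℂ) (hs : 0 < s.re) (hx : 0 < x.re - x.im) :
    x^(-s) * Complex.Gamma s = rsκ s * ∫ ρ : ℝ in Set.Ioi 0, (ρ:ℂ)^(s-1) * Complex.exp (-(2 * π * (1 + I) * x * ρ)) := by
  have hpi : (π:ℂ) ≠ 0 := by exact_mod_cast Real.pi_ne_zero
  set r : ℂ := 2 * π * (1 + I) * x with hr
  have hrre : 0 < r.re := by
    have : r = ((2 * π : ℝ) : ℂ) * ((1 + I) * x) := by rw [hr]; push_cast; ring
    rw [this, Complex.re_ofReal_mul]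
    have : ((1 + I) * x).re = x.re - x.im := by simp
    rw [this]; positivity
  set q : ℂ := ((1 / (4 * π) : ℝ) : ℂ) * (1 - I) with hq
  have hqre : 0 < q.re := by
    rw [hq, Complex.re_ofReal_mul]; simp; positivity
  have hxr : x = r * q := by
    rw [hr, hq]; push_cast; field_simp; ring_nf; rw [I_sq]; ring
  have hκ : rsκ s = q^(-s) := by
    rw [← rs_inv_cpow hqre, rsκ]; congr 1
    rw [hq]; push_cast
    have : (1 - I) ≠ 0 := fun h => by have := congrArg Complex.re h; simp at this
    field_simp; ring_nf; rw [I_sq]; ring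
  rw [rs_gamma_r s hs r hrre, hκ, rs_inv_cpow hrre, hxr, rs_mul_cpow hrre hqre]
  ring

def rsKi (s : ℂ) (ρ : ℝ) : ℂ := (ρ:ℂ)^(s-1) * (Complex.exp (-2 * π * ρ^2) / (2 * I * Complex.sin (π * (1 - I) * ρ)))
def rsK (s : ℂ) : ℂ := ∫ ρ : ℝ in Set.Ioi 0, rsKi s ρ

lemma rsKi_int (s : ℂ) (hs : 1 < s.re) : IntegrableOn (rsKi s) (Set.Ioi 0) := by
  have h := integrableOn_rpow_mul_exp_neg_mul_sq (b := 2 * π) (by positivity) (s := s.re - 2) (by linarith)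
  refine Integrable.mono' h ?_ ?_
  · refine (Measurable.aestronglyMeasurable ?_)
    unfold rsKi
    fun_prop
  · refine (ae_restrict_iff' measurableSet_Ioi).2 (Filter.Eventually.of_forall fun ρ hρ => ?_)
    have hρ : 0 < ρ := hρ
    unfold rsKi
    rw [norm_mul, Complex.norm_cpow_eq_rpow_re_of_pos hρ, norm_div, norm_mul, norm_mul]
    have e1 : ‖Complex.exp (-2 * π * ρ^2)‖ = Real.exp (-(2 * π) * ρ^2) := by
      rw [Complex.norm_exp]; congr 1
      have : (-2 * π * ρ^2 : ℂ) = ((-(2 * π) * ρ^2 : ℝ) : ℂ) := by push_cast; ring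
      rw [this, ofReal_re]
    have e2 : ρ ≤ ‖Complex.sin (π * (1 - I) * ρ)‖ := by
      refine le_trans ?_ (rs_im_le_sin _)
      have : ((π * (1 - I) * ρ : ℂ)).im = - (π * ρ) := by simp
      rw [this, abs_neg, abs_of_pos (by positivity)]
      nlinarith [Real.pi_gt_three]
    have e3 : ρ^((s-1).re) = ρ^(s.re - 2) * ρ := by
      rw [← Real.rpow_add_one hρ.ne']; congr 1; simp; ring
    rw [e1, e3, mul_div_assoc', div_le_iff₀ (by simp; intro h; rw [h] at e2; simp at e2; linarith)]
    simp only [Complex.norm_ofNat, norm_I, mul_one]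
    have : 0 ≤ ρ^(s.re-2) * Real.exp (-(2*π) * ρ^2) := by positivity
    nlinarith

lemma rsX_half (s : ℂ) (p : ℝ) : 0 < (((1/2:ℝ):ℂ) + (1 + I) * p).re - (((1/2:ℝ):ℂ) + (1 + I) * p).im := by
  simp

lemma rs_fubini (s : ℂ) (hs : 0 < s.re) :
    IntegrableOn (fun ρ : ℝ => (ρ:ℂ)^(s-1) * rsN ((1 - I) * ρ)) (Set.Ioi 0) ∧
    Complex.Gamma s * rsQ s (1/2) = rsκ s * ∫ ρ : ℝ in Set.Ioi 0, (ρ:ℂ)^(s-1) * rsN ((1 - I) * ρ) := by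
  set X : ℝ → ℂ := fun p => (((1/2:ℝ):ℂ) + (1 + I) * p) with hX
  set F : ℝ → ℝ → ℂ := fun p ρ => ((ρ:ℂ)^(s-1) * Complex.exp (-(2 * π * (1 + I) * X p * ρ))) *
    (rsE 0 (X p) / Complex.sin (π * X p)) with hF
  have hint : Integrable (Function.uncurry F) (volume.prod (volume.restrict (Set.Ioi 0))) := by
    have i1 : Integrable (fun p : ℝ => rsE 0 (X p) / Complex.sin (π * X p)) := by
      have := rs_bddmul (rsE_int 0)
      refine this.congr (Filter.Eventually.of_forall fun p => ?_)
      simp only [hX]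
      rw [rs_sin_line]
    have i2 : Integrable (fun ρ : ℝ => (ρ:ℂ)^(s-1) * Complex.exp (-(π * ρ))) (volume.restrict (Set.Ioi 0)) := by
      have := (Complex.GammaIntegral_convergent hs)
      have h2 := integrableOn_rpow_mul_exp_neg_mul_rpow (p := 1) (s := s.re - 1) (by linarith) one_pos Real.pi_pos
      refine Integrable.mono h2 (Measurable.aestronglyMeasurable (by fun_prop)) ?_
      refine (ae_restrict_iff' measurableSet_Ioi).2 (Filter.Eventually.of_forall fun ρ hρ => ?_)
      have hρ : 0 < ρ := hρ
      rw [norm_mul, Complex.norm_cpow_eq_rpow_re_of_pos hρ, Complex.norm_exp, Real.norm_of_nonneg (by positivity)]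
      simp
    have i3 := i1.mul_prod i2
    refine i3.mono ?_ ?_
    · refine Measurable.aestronglyMeasurable ?_
      simp only [Function.uncurry_def, hF, hX, rsE]
      fun_prop
    · refine Filter.Eventually.of_forall fun ⟨p, ρ⟩ => ?_
      simp only [Function.uncurry_def, hF, norm_mul]
      refine le_of_eq ?_
      have : ‖Complex.exp (-(2 * π * (1 + I) * X p * ρ))‖ = ‖Complex.exp (-(π * ρ))‖ := by
        rw [Complex.norm_exp, Complex.norm_exp]; congr 1
        simp [hX]; left; ring
      rw [this]; ring
  have hN : ∀ ρ : ℝ, ∫ p : ℝ, F p ρ = (ρ:ℂ)^(s-1) * rsN ((1 - I) * ρ) := by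
    intro ρ
    unfold rsN rsL
    rw [← integral_const_mul]
    congr 1; funext p
    simp only [hF]
    have : rsE ((1 - I) * ρ) (X p) = Complex.exp (-(2 * π * (1 + I) * X p * ρ)) * rsE 0 (X p) := by
      unfold rsE; rw [← Complex.exp_add]; congr 1
      ring_nf; rw [I_sq]; ring
    rw [this]; ring
  constructor
  · have := hint.integral_prod_right
    refine this.congr (Filter.Eventually.of_forall fun ρ => ?_)
    exact hN ρ
  · simp only [← hN]
    rw [← integral_integral_swap hint, ← integral_const_mul]
    unfold rsQ rsL
    rw [← integral_const_mul]
    congr 1; funext p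
    simp only [hF]
    rw [integral_mul_const, ← mul_assoc, ← rs_gamma_line s (X p) hs (rsX_half s p)]
    unfold rsX rsE
    simp only [hX]; ring_nf

lemma rs_series (s : ℂ) (hs : 1 < s.re) :
    rsκ s * ∫ ρ : ℝ in Set.Ioi 0, (ρ:ℂ)^(s-1) * (Complex.exp (2 * π * (1 + I) * ρ) - 1)⁻¹
      = Complex.Gamma s * riemannZeta s := by
  set f : ℕ → ℝ → ℂ := fun m ρ => (ρ:ℂ)^(s-1) * Complex.exp (-(2 * π * (1 + I) * ((m:ℂ) + 1) * ρ)) with hf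
  have hm : ∀ m : ℕ, 0 < ((m:ℂ) + 1).re - ((m:ℂ)+1).im := fun m => by simp; positivity
  have hnorm : ∀ m : ℕ, ∀ ρ : ℝ, 0 < ρ → ‖f m ρ‖ = ρ^(s.re - 1) * Real.exp (-((2 * π * (m+1)) * ρ)) := by
    intro m ρ hρ
    simp only [hf, norm_mul]
    rw [Complex.norm_cpow_eq_rpow_re_of_pos hρ, Complex.norm_exp]
    congr 2
    simp
  have hint : ∀ m, Integrable (f m) (volume.restrict (Set.Ioi 0)) := by
    intro m
    have h2 := integrableOn_rpow_mul_exp_neg_mul_rpow (p := 1) (s := s.re - 1) (b := 2 * π * (m+1)) (by linarith) one_pos (by positivity)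
    refine Integrable.mono h2 (Measurable.aestronglyMeasurable (by fun_prop)) ?_
    refine (ae_restrict_iff' measurableSet_Ioi).2 (Filter.Eventually.of_forall fun ρ hρ => ?_)
    have hρ : 0 < ρ := hρ
    rw [hnorm m ρ hρ, Real.norm_of_nonneg (by positivity)]
    simp
  have hni : ∀ m : ℕ, ∫ ρ : ℝ in Set.Ioi 0, ‖f m ρ‖ = (1/(2 * π * (m+1)))^s.re * Real.Gamma s.re := by
    intro m
    rw [← Real.integral_rpow_mul_exp_neg_mul_Ioi (by linarith) (by positivity)]
    exact setIntegral_congr_fun measurableSet_Ioi (fun ρ hρ => hnorm m ρ hρ)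
  have hsum : Summable (fun m => ∫ ρ : ℝ in Set.Ioi 0, ‖f m ρ‖) := by
    simp only [hni]
    refine Summable.mul_right _ ?_
    have h0 := (summable_nat_add_iff 1).2 (Real.summable_one_div_nat_rpow.2 hs)
    have := h0.mul_left ((1/(2*π))^s.re)
    refine this.congr fun m => ?_
    rw [← Real.one_rpow (s.re), ← Real.div_rpow zero_le_one (by positivity), ← Real.mul_rpow (by positivity) (by positivity)]
    congr 1
    push_cast; simp; ring
  have h := hasSum_integral_of_summable_integral_norm hint hsum
  have hz : riemannZeta s = ∑' m : ℕ, 1/((m:ℂ)+1)^s := zeta_eq_tsum_one_div_nat_add_one_cpow hs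
  have h1 := h.mul_left (rsκ s)
  have h2 : ∀ m : ℕ, rsκ s * ∫ ρ : ℝ in Set.Ioi 0, f m ρ = Complex.Gamma s * (1/((m:ℂ)+1)^s) := by
    intro m
    simp only [hf]
    rw [← rs_gamma_line s _ (by linarith) (hm m), Complex.cpow_neg]; ring
  simp only [h2] at h1
  rw [hz, ← tsum_mul_left, h1.tsum_eq]
  congr 1
  refine setIntegral_congr_fun measurableSet_Ioi (fun ρ hρ => ?_)
  have hρ : 0 < ρ := hρ
  simp only [hf]
  rw [tsum_mul_left]
  congr 1
  set u : ℂ := Complex.exp (2 * π * (1 + I) * ρ) with hu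
  have hu1 : 1 < ‖u‖ := by
    rw [hu, Complex.norm_exp]; refine Real.one_lt_exp_iff.2 ?_
    simp; positivity
  have hu0 : u ≠ 0 := Complex.exp_ne_zero _
  have e : ∀ m : ℕ, Complex.exp (-(2 * π * (1 + I) * ((m:ℂ) + 1) * ρ)) = u⁻¹ * u⁻¹^m := by
    intro m
    rw [← pow_succ', hu, ← Complex.exp_neg, ← Complex.exp_nat_mul]; congr 1; push_cast; ring
  simp only [e]
  rw [tsum_mul_left, tsum_geometric_of_norm_lt_one (by rw [norm_inv]; exact inv_lt_one_of_one_lt₀ hu1)]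
  have : u - 1 ≠ 0 := fun h => by rw [sub_eq_zero.1 h] at hu1; simp at hu1
  have h3 : 1 - u⁻¹ ≠ 0 := by
    intro h; apply this; field_simp at h; simpa using h
  field_simp

lemma rs_main1 (s : ℂ) (hs : 1 < s.re) :
    Complex.Gamma s * ((1 + I) * riemannZeta s + rsQ s (1/2)) = (1 + I) * (rsκ s * rsK s) := by
  obtain ⟨i1, e1⟩ := rs_fubini s (by linarith)
  have i2 := rsKi_int s hs
  rw [mul_add, e1, mul_left_comm, ← rs_series s hs]
  have key : ∀ ρ : ℝ, 0 < ρ → (ρ:ℂ)^(s-1) * (Complex.exp (2 * π * (1 + I) * ρ) - 1)⁻¹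
      = rsKi s ρ - (1 + I)⁻¹ * ((ρ:ℂ)^(s-1) * rsN ((1 - I) * ρ)) := by
    intro ρ hρ
    have hN := rsN_eq ((1 - I) * ρ)
    set u : ℂ := Complex.exp (π * (1 + I) * ρ) with hu
    have a1 : Complex.exp (2 * π * I * ((1 - I) * ρ)) = u^2 := by
      rw [hu, ← Complex.exp_nat_mul]; congr 1; push_cast; ring_nf; rw [I_sq]; ring
    have a1' : Complex.exp (2 * π * (1 + I) * ρ) = u^2 := by
      rw [hu, ← Complex.exp_nat_mul]; congr 1; push_cast; ring
    have a2 : Complex.exp (-π * I * ((1 - I) * ρ)^2 + π * I * ((1 - I) * ρ)) = Complex.exp (-2 * π * ρ^2) * u := by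
      rw [hu, ← Complex.exp_add]; congr 1; ring_nf; simp only [I_sq, I_pow_three]; ring
    have hu1 : 1 < ‖u^2‖ := by
      rw [← a1', Complex.norm_exp]; refine Real.one_lt_exp_iff.2 ?_
      simp; positivity
    have hu0 : u ≠ 0 := Complex.exp_ne_zero _
    have hu2 : u^2 - 1 ≠ 0 := fun h => by rw [sub_eq_zero.1 h] at hu1; simp at hu1
    have a3 : 2 * I * Complex.sin (π * (1 - I) * ρ) = (u^2 - 1)/u := by
      rw [Complex.sin]
      have b1 : Complex.exp (π * (1 - I) * ρ * I) = u := by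
        rw [hu]; congr 1; ring_nf; rw [I_sq]; ring
      have b2 : Complex.exp (-(π * (1 - I) * ρ) * I) = u⁻¹ := by
        rw [neg_mul, Complex.exp_neg, b1]
      rw [b1, b2]; field_simp; rw [I_sq]; ring
    rw [a1, a2] at hN
    rw [a1']
    unfold rsKi
    rw [a3]
    have h1 := rs_one_add_I_ne
    have hN' : rsN ((1 - I) * ρ) = (1 + I) * (Complex.exp (-2 * π * ρ^2) * u - 1) / (u^2 - 1) := by
      rw [eq_div_iff hu2, hN]
    rw [hN']
    field_simp
    ring
  have e2 : ∫ ρ : ℝ in Set.Ioi 0, (ρ:ℂ)^(s-1) * (Complex.exp (2 * π * (1 + I) * ρ) - 1)⁻¹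
      = rsK s - (1 + I)⁻¹ * ∫ ρ : ℝ in Set.Ioi 0, (ρ:ℂ)^(s-1) * rsN ((1 - I) * ρ) := by
    rw [setIntegral_congr_fun measurableSet_Ioi (fun ρ hρ => key ρ hρ), integral_sub i2 (i1.const_mul _), integral_const_mul]
    rfl
  rw [e2]
  have h1 := rs_one_add_I_ne
  field_simp
  ring


lemma rs_log_bound (x : ℂ) (δ : ℝ) (hδ : 0 < δ) (hx : δ ≤ ‖x‖) : ‖Complex.log x‖ ≤ ‖x‖ + (1/δ + π) := by
  refine (Complex.norm_le_abs_re_add_abs_im _).trans ?_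
  rw [Complex.log_re, Complex.log_im]
  have h0 : 0 < ‖x‖ := lt_of_lt_of_le hδ hx
  have h1 := Complex.abs_arg_le_pi x
  have h2 : |Real.log ‖x‖| ≤ ‖x‖ + 1/δ := by
    rw [abs_le]
    have a1 := Real.log_le_sub_one_of_pos h0
    have a2 := Real.log_le_sub_one_of_pos (inv_pos.2 h0)
    rw [Real.log_inv] at a2
    have a3 : ‖x‖⁻¹ ≤ 1/δ := by rw [one_div]; exact inv_anti₀ hδ hx
    have : 0 < 1/δ := by positivity
    constructor <;> linarith
  linarith

lemma rs_cpow_bound (x w : ℂ) (δ W : ℝ) (hδ : 0 < δ) (hx : δ ≤ ‖x‖) (hw : ‖w‖ ≤ W) :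
    ‖x^w‖ ≤ Real.exp (W * (‖x‖ + (1/δ + π))) := by
  have h0 : x ≠ 0 := norm_pos_iff.1 (lt_of_lt_of_le hδ hx)
  rw [Complex.cpow_def_of_ne_zero h0, Complex.norm_exp, Real.exp_le_exp]
  refine (Complex.re_le_norm _).trans ?_
  rw [norm_mul, mul_comm]
  exact mul_le_mul hw (rs_log_bound x δ hδ hx) (norm_nonneg _) ((norm_nonneg _).trans hw)

lemma rsG_bound (k m W D : ℝ) (hm : 0 ≤ m) (hW : 0 ≤ W) : ∃ C : ℝ, ∀ z : ℂ, |z.im| ≤ m →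
    Real.exp (W * (‖(k:ℂ) + (1 + I) * z‖ + D)) * ‖Complex.exp (π * I * ((k:ℂ) + (1 + I) * z)^2)‖
      ≤ C * (1 + z.re^2)⁻¹ := by
  set A : ℂ := π * I * k^2
  set B : ℂ := 2 * π * I * k * (1 + I)
  set K : ℝ := ‖B‖ + 2 * W with hK
  refine ⟨Real.exp (W * (|k| + 2 * m + D) + 2 * π * m^2 + ‖A‖ + ‖B‖ * m) * (2 * Real.exp (K^2/2)), fun z hz => ?_⟩
  have e : Complex.exp (π * I * ((k:ℂ) + (1 + I) * z)^2) = Complex.exp (-2 * π * z^2 + A + B * z) := by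
    congr 1; simp only [A, B]; ring_nf; simp only [I_sq, I_pow_three]; ring
  have hI : ‖(1 + I : ℂ)‖ ≤ 2 := by
    refine (norm_add_le _ _).trans ?_; simp; norm_num
  have hz1 : ‖z‖ ≤ |z.re| + m := (Complex.norm_le_abs_re_add_abs_im z).trans (by linarith)
  have hx : ‖(k:ℂ) + (1 + I) * z‖ ≤ |k| + 2 * (|z.re| + m) := by
    refine (norm_add_le _ _).trans ?_
    rw [norm_mul, Complex.norm_real, Real.norm_eq_abs]
    have : ‖(1 + I : ℂ)‖ * ‖z‖ ≤ 2 * (|z.re| + m) := by gcongr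
    linarith
  rw [e, Complex.norm_exp, mul_assoc (Real.exp _), ← Real.exp_add]
  refine le_trans ?_ (mul_le_mul_of_nonneg_left (rs_gauss K z.re) (Real.exp_pos _).le)
  rw [← Real.exp_add, Real.exp_le_exp]
  have h1 : ((-2 * π * z^2 : ℂ)).re = -2 * π * (z.re^2 - z.im^2) := by
    have : (-2 * π * z^2 : ℂ) = ((-2 * π : ℝ) : ℂ) * z^2 := by push_cast; ring
    rw [this, Complex.re_ofReal_mul, pow_two z, Complex.mul_re]; ring
  rw [Complex.add_re, Complex.add_re, h1]
  have h2 := Complex.re_le_norm A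
  have h3 : (B * z).re ≤ ‖B‖ * (|z.re| + m) := by
    refine (Complex.re_le_norm _).trans ?_
    rw [norm_mul]
    gcongr
  have h4 : z.im^2 ≤ m^2 := by rw [← sq_abs]; gcongr
  have h5 := mul_le_mul_of_nonneg_left hx hW
  have h6 := mul_le_mul_of_nonneg_left h4 Real.pi_pos.le
  have h7 := mul_nonneg (sub_nonneg.2 Real.pi_gt_three.le) (sq_nonneg z.re)
  rw [hK]
  nlinarith [sq_nonneg z.re]

lemma rsX_bound (s : ℂ) (k m δ : ℝ) (hm : 0 ≤ m) (hδ : 0 < δ) : ∃ C : ℝ, ∀ z : ℂ, |z.im| ≤ m →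
    δ ≤ ‖(k:ℂ) + (1 + I) * z‖ → ‖rsX s (k + (1 + I) * z)‖ ≤ C * (1 + z.re^2)⁻¹ := by
  obtain ⟨C, hC⟩ := rsG_bound k m ‖s‖ (1/δ + π) hm (norm_nonneg _)
  refine ⟨C, fun z h1 h2 => le_trans ?_ (hC z h1)⟩
  unfold rsX
  rw [norm_mul]
  exact mul_le_mul_of_nonneg_right (rs_cpow_bound _ (-s) δ ‖s‖ hδ h2 (by simp)) (norm_nonneg _)

lemma rs_re_le_norm (z : ℂ) : |z.re| ≤ ‖(1 + I) * z‖ := by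
  rw [norm_mul]
  have : 1 ≤ ‖(1 + I : ℂ)‖ := by
    have := Complex.abs_re_le_norm (1 + I); simpa using this
  nlinarith [Complex.abs_re_le_norm z, norm_nonneg z]

lemma rs_slit {x : ℂ} (hx : 0 ≤ x.re - x.im) (h0 : x ≠ 0) : x ∈ Complex.slitPlane := by
  rw [Complex.mem_slitPlane_iff]
  by_contra h
  push Not at h
  exact h0 (Complex.ext (by simp; linarith [h.1, h.2]) (by simp [h.2]))

lemma rs_real_cpow (p : ℝ) (hp : 0 < p) (x u : ℂ) (hx : x ≠ 0) : (x * p)^u = (p:ℂ)^u * x^u := by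
  have hp0 : (p:ℂ) ≠ 0 := by exact_mod_cast hp.ne'
  rw [Complex.cpow_def_of_ne_zero (mul_ne_zero hx hp0), Complex.cpow_def_of_ne_zero hp0, Complex.cpow_def_of_ne_zero hx,
    ← Complex.exp_add, mul_comm x, Complex.log_ofReal_mul hp hx, Complex.ofReal_log hp.le]
  congr 1; ring

lemma rs_collapse (u : ℂ) (hu : 0 < u.re) (h : ℂ → ℂ) (c C : ℝ) (hc : 0 < c)
    (hcont : ContinuousOn h {z : ℂ | -(c/2) ≤ z.im ∧ z.im ≤ 0})
    (hdiff : DifferentiableOn ℂ h {z : ℂ | -(c/2) < z.im ∧ z.im < 0})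
    (hb : ∀ z : ℂ, -(c/2) ≤ z.im → z.im ≤ 0 → 1 ≤ |z.re| → ‖((1 + I) * z)^u * h z‖ ≤ C * (1 + z.re^2)⁻¹)
    (heven : ∀ p : ℝ, h (-(p:ℂ)) = h p) :
    rsL (fun x => x^u * h (x/(1 + I))) c = ((1 + I)^u + (-1 - I)^u) * ∫ p : ℝ in Set.Ioi 0, (p:ℂ)^u * h p := by
  have h1I := rs_one_add_I_ne
  set F : ℂ → ℂ := fun z => ((1 + I) * z)^u * h z with hF
  have hFc : ContinuousOn F {z : ℂ | -(c/2) ≤ z.im ∧ z.im ≤ 0} := by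
    refine ContinuousOn.mul ?_ hcont
    intro z hz
    by_cases hz0 : z = 0
    · have h2 := Complex.continuousAt_cpow_zero_of_re_pos hu
      have h3 : ContinuousAt (fun z : ℂ => (((1 + I) * z, u) : ℂ × ℂ)) z := by fun_prop
      have h4 : ContinuousAt (fun z : ℂ => ((1 + I) * z)^u) z := by
        refine ContinuousAt.comp (g := fun x : ℂ × ℂ => x.1 ^ x.2) (f := fun z : ℂ => (((1 + I) * z, u) : ℂ × ℂ)) ?_ h3
        simp only [hz0, mul_zero]; exact h2
      exact h4.continuousWithinAt
    · refine ContinuousAt.continuousWithinAt ?_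
      refine ContinuousAt.cpow (by fun_prop) (by fun_prop) (rs_slit ?_ (mul_ne_zero h1I hz0))
      simp only [Set.mem_ofPred_eq] at hz
      simp; linarith [hz.2]
  have hFd : DifferentiableOn ℂ F {z : ℂ | -(c/2) < z.im ∧ z.im < 0} := by
    refine DifferentiableOn.mul ?_ hdiff
    intro z hz
    simp only [Set.mem_ofPred_eq] at hz
    refine DifferentiableAt.differentiableWithinAt ?_
    refine DifferentiableAt.cpow (by fun_prop) (by fun_prop) (rs_slit ?_ (mul_ne_zero h1I ?_))
    · simp; linarith [hz.2]
    · intro h; rw [h] at hz; simp at hz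
  have hs := rs_strip F (-(c/2)) 0 C (by linarith) hFc hFd hb
  have e1 : rsL (fun x => x^u * h (x/(1 + I))) c = ∫ p : ℝ, F (p + (-(c/2) : ℝ) * I) := by
    have := rsL_shift (fun x => x^u * h (x/(1 + I))) 0 (-(c/2))
    have e : (0:ℝ) - 2 * (-(c/2)) = c := by ring
    rw [e] at this
    rw [← this]
    congr 1; funext p
    simp only [hF, ofReal_zero, zero_add]
    congr 2
    rw [mul_div_cancel_left₀ _ h1I]
  rw [e1, hs]
  simp only [ofReal_zero, zero_mul, add_zero]
  have hint : Integrable (fun p : ℝ => F p) := by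
    refine rs_line_integrable _ C ?_ (fun p hp => hb p (by simp; linarith) (by simp) (by simpa using hp))
    refine hFc.comp_continuous Complex.continuous_ofReal (fun p => ?_)
    simp; linarith
  rw [← intervalIntegral.integral_Iic_add_Ioi (b := 0) hint.integrableOn hint.integrableOn]
  have e2 : ∫ p : ℝ in Set.Iic 0, F p = ∫ p : ℝ in Set.Ioi 0, F ((-p : ℝ)) := by
    have := integral_comp_neg_Ioi (0:ℝ) (fun p : ℝ => F p)
    rw [this, neg_zero]
  rw [e2, add_mul, add_comm, ← integral_const_mul, ← integral_const_mul]
  congr 1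
  · refine setIntegral_congr_fun measurableSet_Ioi fun p hp => ?_
    simp only [hF]
    rw [rs_real_cpow p hp _ _ h1I]; ring
  · refine setIntegral_congr_fun measurableSet_Ioi fun p hp => ?_
    simp only [hF]
    have : (1 + I) * ((-p : ℝ) : ℂ) = (-1 - I) * p := by push_cast; ring
    rw [this, rs_real_cpow p hp _ _ (fun h => h1I (by linear_combination -h)), ofReal_neg, heven]; ring

lemma rsR_collapse (s : ℂ) (hs : 2 < s.re) :
    (starRingEnd ℂ) (rsQ (1 - (starRingEnd ℂ) s) (1/2)) = -(1 - I) * (((1 - I)^s + (-1 + I)^s) * rsK s) := by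
  have h1I := rs_one_add_I_ne
  set s' : ℂ := 1 - (starRingEnd ℂ) s with hs'
  have hre : s'.re = 1 - s.re := by simp [hs']
  set u : ℂ := -s' - 1 with hu
  set h : ℂ → ℂ := fun z => (1 + I) * Complex.exp (-2 * π * z^2) / dslope rsS 0 z with hh
  obtain ⟨C, hC⟩ := rsX_bound s' 0 (1/2) 1 (by norm_num) one_pos
  have hxe : ∀ z : ℂ, z ≠ 0 → rsX s' ((1 + I) * z) / rsS z = ((1 + I) * z)^u * h z := by
    intro z hz
    have e1 : ((1 + I) * z)^(-s') = ((1 + I) * z)^u * ((1 + I) * z) := by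
      rw [hu, Complex.cpow_sub _ _ (mul_ne_zero h1I hz), Complex.cpow_one, div_mul_cancel₀ _ (mul_ne_zero h1I hz)]
    have e2 : Complex.exp (π * I * ((1 + I) * z)^2) = Complex.exp (-2 * π * z^2) := by
      congr 1; ring_nf; simp only [I_sq, I_pow_three]; ring
    simp only [rsX, hh, e1, e2]
    rw [rsS_eq z]
    by_cases hd : dslope rsS 0 z = 0
    · simp [hd]
    field_simp
  have hsub : ∀ z : ℂ, -((1/2:ℝ)/2) ≤ z.im → z.im ≤ 0 → |z.im| < 1/2 := by
    intro z h1 h2; rw [abs_lt]; constructor <;> linarith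
  have hdiff : DifferentiableOn ℂ h {z : ℂ | |z.im| < 1/2} := by
    refine DifferentiableOn.div (by fun_prop) rsS_dslope_diff.differentiableOn (fun z hz => rsS_dslope_ne z hz)
  have key := rs_collapse u (by rw [hu]; simp [hre]; linarith) h (1/2) C (by norm_num)
    (hdiff.continuousOn.mono (fun z hz => hsub z hz.1 hz.2)) (hdiff.mono (fun z hz => hsub z hz.1.le hz.2.le))
    ?_ ?_
  · have e1 : rsQ s' (1/2) = rsL (fun x => x^u * h (x/(1 + I))) (1/2) := by
      unfold rsQ rsL
      congr 1; funext p
      set x : ℂ := ((1/2:ℝ):ℂ) + (1 + I) * p with hx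
      have hx0 : x/(1 + I) ≠ 0 := by
        refine div_ne_zero ?_ h1I
        intro h
        have := congrArg Complex.re h
        have h2 := congrArg Complex.im h
        simp [hx] at this h2
        rw [h2] at this; norm_num at this
      have h3 : (1 + I) * (x/(1 + I)) = x := mul_div_cancel₀ _ h1I
      have := hxe _ hx0
      rw [h3] at this
      refine Eq.trans ?_ this
      unfold rsS
      congr 2
      rw [mul_assoc, h3]
    rw [e1, key, map_mul]
    have e2 : (starRingEnd ℂ) ((1 + I)^u + (-1 - I)^u) = -((1 - I)^s + (-1 + I)^s)/(2 * I) := by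
      have a1 : (starRingEnd ℂ) u = s - 2 := by
        rw [hu, hs']; simp; ring
      have c1 : (starRingEnd ℂ) ((1 + I)^u) = (1 - I)^(s-2) := by
        have := Complex.conj_cpow (1 + I) (s-2) (by
          have := Complex.abs_arg_lt_pi_div_two_iff.2 (Or.inl (show 0 < (1 + I : ℂ).re by simp))
          rw [abs_lt] at this; linarith [Real.pi_pos])
        rw [← a1, Complex.conj_conj] at this
        rw [← this, a1]; simp [sub_eq_add_neg]
      have c2 : (starRingEnd ℂ) ((-1 - I)^u) = (-1 + I)^(s-2) := by
        have := Complex.conj_cpow (-1 - I) (s-2) (by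
          have : (-1 - I).arg < 0 := Complex.arg_neg_iff.2 (by simp)
          linarith [Real.pi_pos])
        rw [← a1, Complex.conj_conj] at this
        rw [← this, a1]; simp
      rw [map_add, c1, c2]
      have n1 : (1 - I) ≠ 0 := fun h => by have := congrArg Complex.re h; simp at this
      have n2 : (-1 + I) ≠ 0 := fun h => by have := congrArg Complex.re h; simp at this
      rw [Complex.cpow_sub _ _ n1, Complex.cpow_sub _ _ n2]
      have q1 : (1 - I)^(2:ℂ) = -(2 * I) := by
        rw [show (2:ℂ) = ((2:ℕ):ℂ) by norm_num, Complex.cpow_natCast]; push_cast; ring_nf; rw [I_sq]; ring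
      have q2 : (-1 + I)^(2:ℂ) = -(2 * I) := by
        rw [show (2:ℂ) = ((2:ℕ):ℂ) by norm_num, Complex.cpow_natCast]; push_cast; ring_nf; rw [I_sq]; ring
      rw [q1, q2, div_neg, div_neg]; ring
    have e3 : (starRingEnd ℂ) (∫ p : ℝ in Set.Ioi 0, (p:ℂ)^u * h p) = (1 - I) * (2 * I) * rsK s := by
      rw [← integral_conj, rsK, ← integral_const_mul]
      refine setIntegral_congr_fun measurableSet_Ioi fun p hp => ?_
      have hp : 0 < p := hp
      have hp0 : (p:ℂ) ≠ 0 := by exact_mod_cast hp.ne'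
      have d1 : (p:ℂ)^u * h p = (1 + I) * ((p:ℂ)^(-s') * Complex.exp (-2 * π * p^2) / Complex.sin (π * (1 + I) * p)) := by
        have d2 : (p:ℂ)^(-s') = (p:ℂ)^u * p := by
          rw [hu, Complex.cpow_sub _ _ hp0, Complex.cpow_one, div_mul_cancel₀ _ hp0]
        have d3 := rsS_eq p
        unfold rsS at d3
        simp only [hh]
        rw [d2, d3]
        unfold rsS
        field_simp
      rw [d1, map_mul, map_div₀, map_mul, ← Complex.exp_conj, ← Complex.sin_conj]
      have d4 : (starRingEnd ℂ) ((p:ℂ)^(-s')) = (p:ℂ)^(s-1) := by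
        have := Complex.conj_cpow (p:ℂ) (s-1) (by rw [Complex.arg_ofReal_of_nonneg hp.le]; exact Real.pi_pos.ne)
        have a1 : (starRingEnd ℂ) (s-1) = -s' := by rw [hs']; simp
        rw [Complex.conj_ofReal, a1] at this
        exact this.symm
      rw [d4]
      unfold rsKi
      simp only [map_mul, map_add, map_one, conj_I, conj_ofReal, map_pow, map_neg, Complex.conj_ofNat]
      have hI2 : (2 * I) ≠ 0 := by simp
      rw [← sub_eq_add_neg]
      field_simp
    rw [e2, e3]
    have : (2 * I) ≠ 0 := by simp
    field_simp
  · intro z h1 h2 h3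
    have hz : z ≠ 0 := fun h => by rw [h] at h3; simp at h3; linarith
    rw [← hxe z hz, norm_div]
    have h4 := rsS_ge_one z (hsub z h1 h2).le h3
    have h5 := hC z (hsub z h1 h2).le (by simpa using h3.trans (rs_re_le_norm z))
    simp only [ofReal_zero, zero_add] at h5
    exact (div_le_self (norm_nonneg _) h4).trans h5
  · intro p
    have hod : ∀ z, rsS (-z) = - rsS z := by intro z; unfold rsS; rw [mul_neg, Complex.sin_neg]
    by_cases hp : (p:ℂ) = 0
    · rw [hp, neg_zero]
    · simp only [hh]
      have : dslope rsS 0 (-(p:ℂ)) = dslope rsS 0 p := by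
        have a1 := rsS_eq p
        have a2 := rsS_eq (-(p:ℂ))
        rw [hod, a1] at a2
        have : (p:ℂ) * dslope rsS 0 (-(p:ℂ)) = p * dslope rsS 0 p := by linear_combination a2
        exact mul_left_cancel₀ hp this
      rw [this, neg_sq]


lemma rs_x_norm (c p : ℝ) (hc : 0 < c) : c/2 ≤ ‖((c:ℂ) + (1 + I) * p)‖ := by
  have h1 := Complex.abs_re_le_norm ((c:ℂ) + (1 + I) * p)
  have h2 := Complex.abs_im_le_norm ((c:ℂ) + (1 + I) * p)
  simp at h1 h2
  have h3 := le_abs_self (c + p)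
  have h4 := neg_abs_le p
  linarith

lemma rs_x_ne (c p : ℝ) (hc : 0 < c) : ((c:ℂ) + (1 + I) * p) ≠ 0 :=
  norm_pos_iff.1 (lt_of_lt_of_le (by linarith) (rs_x_norm c p hc))

lemma rs_x_slit (c p : ℝ) (hc : 0 < c) : ((c:ℂ) + (1 + I) * p) ∈ Complex.slitPlane :=
  rs_slit (by simp; linarith) (rs_x_ne c p hc)

lemma rsX_cont (s : ℂ) (c : ℝ) (hc : 0 < c) : Continuous (fun p : ℝ => rsX s (c + (1 + I) * p)) := by
  unfold rsX
  refine Continuous.mul ?_ (by fun_prop)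
  exact Continuous.cpow (by fun_prop) (by fun_prop) (fun p => rs_x_slit c p hc)

lemma rsX_int (s : ℂ) (c : ℝ) (hc : 0 < c) : Integrable (fun p : ℝ => rsX s (c + (1 + I) * p)) := by
  obtain ⟨C, hC⟩ := rsX_bound s c 0 (c/2) le_rfl (by linarith)
  refine rs_line_integrable _ C (rsX_cont s c hc) (fun p _ => ?_)
  simpa using hC p (by simp) (rs_x_norm c p hc)

lemma rs_line_diff (φ : ℝ → ℂ) (M c : ℝ) (hφ : Continuous φ) (hM : ∀ p, ‖φ p‖ ≤ M) (hc : 0 < c) :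
    Differentiable ℂ (fun s : ℂ => ∫ p : ℝ, rsX s (c + (1 + I) * p) * φ p) := by
  intro s₀
  have hM0 : 0 ≤ M := (norm_nonneg _).trans (hM 0)
  set D : ℝ := 1/(c/2) + π with hD
  obtain ⟨C, hC⟩ := rsG_bound c 0 (‖s₀‖ + 2) D le_rfl (by positivity)
  have hC' : ∀ p : ℝ, Real.exp ((‖s₀‖ + 2) * (‖(c:ℂ) + (1 + I) * p‖ + D)) * ‖Complex.exp (π * I * ((c:ℂ) + (1 + I) * p)^2)‖ ≤ C * (1 + p^2)⁻¹ := by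
    intro p; simpa using hC p (by simp)
  refine (hasDerivAt_integral_of_dominated_loc_of_deriv_le (μ := volume)
    (F := fun (s : ℂ) (p : ℝ) => rsX s (c + (1 + I) * p) * φ p)
    (F' := fun (s : ℂ) (p : ℝ) => (-Complex.log (c + (1 + I) * p) * rsX s (c + (1 + I) * p)) * φ p)
    (bound := fun p : ℝ => (C * (1 + p^2)⁻¹) * M)
    (s := Metric.ball s₀ 1) (Metric.ball_mem_nhds _ one_pos) ?_ ?_ ?_ ?_ ?_ ?_).2.differentiableAt
  · exact Filter.Eventually.of_forall fun s => ((rsX_cont s c hc).mul hφ).aestronglyMeasurable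
  · exact (rsX_int s₀ c hc).mul_bdd hφ.aestronglyMeasurable (Filter.Eventually.of_forall hM)
  · refine Continuous.aestronglyMeasurable ?_
    refine Continuous.mul (Continuous.mul ?_ (rsX_cont s₀ c hc)) hφ
    exact (Continuous.clog (by fun_prop) (fun p => rs_x_slit c p hc)).neg
  · refine Filter.Eventually.of_forall fun p s hs => ?_
    rw [norm_mul]
    refine mul_le_mul (le_trans ?_ (hC' p)) (hM p) (norm_nonneg _) ((by positivity : (0:ℝ) ≤ Real.exp _ * ‖_‖).trans (hC' p))
    have h1 := rs_log_bound _ (c/2) (by linarith) (rs_x_norm c p hc)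
    rw [← hD] at h1
    have hs' : ‖-s‖ ≤ ‖s₀‖ + 1 := by
      rw [norm_neg]
      have h3 : ‖s - s₀‖ < 1 := by simpa [dist_eq_norm] using hs
      have := norm_add_le (s - s₀) s₀
      rw [sub_add_cancel] at this; linarith
    have h2 := rs_cpow_bound _ (-s) (c/2) (‖s₀‖ + 1) (by linarith) (rs_x_norm c p hc) hs'
    rw [← hD] at h2
    set L := ‖(c:ℂ) + (1 + I) * p‖ + D
    have h4 : L ≤ Real.exp L := by linarith [Real.add_one_le_exp L]
    unfold rsX
    rw [norm_mul, norm_mul, norm_neg, ← mul_assoc]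
    refine mul_le_mul_of_nonneg_right ?_ (norm_nonneg _)
    calc _ ≤ Real.exp L * Real.exp ((‖s₀‖ + 1) * L) :=
          mul_le_mul (h1.trans h4) h2 (norm_nonneg _) (Real.exp_pos _).le
      _ = _ := by rw [← Real.exp_add]; congr 1; ring
  · exact (integrable_inv_one_add_sq.const_mul C).mul_const M
  · refine Filter.Eventually.of_forall fun p s _ => ?_
    refine HasDerivAt.mul_const ?_ _
    unfold rsX
    have h0 := rs_x_ne c p hc
    have h1 : HasDerivAt (fun s : ℂ => ((c:ℂ) + (1 + I) * p)^(-s)) (((c:ℂ) + (1 + I) * p)^(-s) * Complex.log ((c:ℂ) + (1 + I) * p) * (-1)) s :=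
      (hasDerivAt_neg s).const_cpow (Or.inl h0)
    have h2 := h1.mul_const (Complex.exp (π * I * ((c:ℂ) + (1 + I) * p)^2))
    convert h2 using 1
    ring

lemma rsQ_line (s : ℂ) : rsQ s (1/2) = ∫ p : ℝ, rsX s ((1/2:ℝ) + (1 + I) * p) * (Complex.cos (π * (1 + I) * p))⁻¹ := by
  unfold rsQ rsL
  congr 1; funext p
  beta_reduce
  rw [rs_sin_line, div_eq_mul_inv]

lemma rsQ_diff : Differentiable ℂ (fun s => rsQ s (1/2)) := by
  simp only [rsQ_line]
  exact rs_line_diff _ 1 (1/2) rs_cos_cont rs_cos_inv_le (by norm_num)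

lemma rsQ_conj_diff : Differentiable ℂ (fun s => (starRingEnd ℂ) (rsQ (1 - (starRingEnd ℂ) s) (1/2))) := by
  intro s
  have h1 : DifferentiableAt ℂ (fun s => rsQ (1 - s) (1/2)) ((starRingEnd ℂ) s) :=
    DifferentiableAt.comp (g := fun s => rsQ s (1/2)) _ (rsQ_diff _) (by fun_prop)
  have := h1.conj_conj
  rw [Complex.conj_conj] at this
  exact this

def rsEE (s : ℂ) : ℂ := (1 - I)^s + (-1 + I)^s

lemma rs_fe (s : ℂ) (hs : 0 < s.re) (hs' : 0 < s.im) :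
    rsEE s * Complex.Gamma s * ((1 + I) * riemannZeta s + rsQ s (1/2)) * (-(1 - I))
      = (1 + I) * rsκ s * (starRingEnd ℂ) (rsQ (1 - (starRingEnd ℂ) s) (1/2)) := by
  set U : Set ℂ := {s : ℂ | 0 < s.re} ∩ {s : ℂ | 0 < s.im} with hU
  have hUo : IsOpen U := (isOpen_lt continuous_const Complex.continuous_re).inter (isOpen_lt continuous_const Complex.continuous_im)
  have hpre : IsPreconnected U := ((convex_halfSpace_re_gt 0).inter (convex_halfSpace_im_gt 0)).isPreconnected
  have n1 : (1 - I) ≠ 0 := fun h => by have := congrArg Complex.re h; simp at this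
  have n2 : (-1 + I) ≠ 0 := fun h => by have := congrArg Complex.re h; simp at this
  have n3 : (2 * π * (1 + I) : ℂ) ≠ 0 := by
    have := rs_piI_ne; rw [mul_assoc]; exact mul_ne_zero two_ne_zero this
  have hne : ∀ z ∈ U, z ≠ 1 := fun z hz h => by have := hz.2; rw [h] at this; simp at this
  have h1 : AnalyticOnNhd ℂ (fun s => rsEE s * Complex.Gamma s * ((1 + I) * riemannZeta s + rsQ s (1/2)) * (-(1 - I))) U := by
    refine DifferentiableOn.analyticOnNhd (fun z hz => ?_) hUo
    refine DifferentiableAt.differentiableWithinAt ?_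
    refine DifferentiableAt.mul_const ?_ _
    refine DifferentiableAt.mul (DifferentiableAt.mul ?_ ?_) ?_
    · unfold rsEE
      exact (differentiableAt_id.const_cpow (Or.inl n1)).add (differentiableAt_id.const_cpow (Or.inl n2))
    · refine Complex.differentiableAt_Gamma _ (fun m h => ?_)
      have := hz.1
      rw [h] at this; simp at this; linarith [Nat.cast_nonneg (α := ℝ) m]
    · exact ((differentiableAt_riemannZeta (hne z hz)).const_mul _).add (rsQ_diff z)
  have h2 : AnalyticOnNhd ℂ (fun s => (1 + I) * rsκ s * (starRingEnd ℂ) (rsQ (1 - (starRingEnd ℂ) s) (1/2))) U := by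
    refine DifferentiableOn.analyticOnNhd (fun z hz => ?_) hUo
    refine DifferentiableAt.differentiableWithinAt ?_
    refine DifferentiableAt.mul (DifferentiableAt.const_mul ?_ _) (rsQ_conj_diff z)
    unfold rsκ
    exact differentiableAt_id.const_cpow (Or.inl n3)
  refine h1.eqOn_of_preconnected_of_eventuallyEq h2 hpre (z₀ := 3 + I) ⟨by simp, by simp⟩ ?_ ⟨hs, hs'⟩
  have : {s : ℂ | 2 < s.re} ∈ nhds (3 + I) :=
    (isOpen_lt continuous_const Complex.continuous_re).mem_nhds (by simp; norm_num)
  filter_upwards [this] with z hz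
  have hz : 2 < z.re := hz
  have e1 := rs_main1 z (by linarith)
  rw [rsR_collapse z hz]
  unfold rsEE
  linear_combination (((1 - I)^z + (-1 + I)^z) * (-(1 - I))) * e1

lemma rs_chi_eq (s : ℂ) (hs : 0 < s.re) (hs' : 0 < s.im) :
    rsEE s * Complex.Gamma s ≠ 0 ∧ rsκ s = chi s * (rsEE s * Complex.Gamma s) := by
  have hG : Complex.Gamma s ≠ 0 := Complex.Gamma_ne_zero_of_re_pos hs
  have n1 : (1 - I) ≠ 0 := fun h => by have := congrArg Complex.re h; simp at this
  have n0 := rs_one_add_I_ne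
  have n2 : (-1 + I) ≠ 0 := fun h => by have := congrArg Complex.re h; simp at this
  have l1 : Complex.log (1 + I) = Complex.log (1 - I) + π/2 * I := by
    have h1 := Complex.abs_arg_lt_pi_div_two_iff.2 (Or.inl (show 0 < (1 - I : ℂ).re by simp))
    rw [abs_lt] at h1
    have := (Complex.log_mul_eq_add_log_iff n1 I_ne_zero).2 ⟨by rw [arg_I]; linarith, by rw [arg_I]; linarith⟩
    rw [Complex.log_I] at this
    rw [← this]; congr 1; ring_nf; rw [I_sq]; ring
  have l2 : Complex.log (-1 + I) = Complex.log (1 + I) + π/2 * I := by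
    have h1 := Complex.abs_arg_lt_pi_div_two_iff.2 (Or.inl (show 0 < (1 + I : ℂ).re by simp))
    rw [abs_lt] at h1
    have := (Complex.log_mul_eq_add_log_iff n0 I_ne_zero).2 ⟨by rw [arg_I]; linarith, by rw [arg_I]; linarith⟩
    rw [Complex.log_I] at this
    rw [← this]; congr 1; ring_nf; rw [I_sq]; ring
  have hE : rsEE s = (1 + I)^s * (2 * Complex.cos (π * s/2)) := by
    unfold rsEE
    rw [Complex.cpow_def_of_ne_zero n1, Complex.cpow_def_of_ne_zero n2, Complex.cpow_def_of_ne_zero n0, l2, l1, Complex.cos]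
    rw [mul_div_cancel₀ _ (two_ne_zero), mul_add, ← Complex.exp_add, ← Complex.exp_add]
    rw [add_comm]
    congr 2 <;> ring
  have hκ : rsκ s = (2 * π : ℂ)^s * (1 + I)^s := by
    unfold rsκ
    have := rs_mul_cpow (a := ((2 * π : ℝ) : ℂ)) (b := 1 + I) (by simp [Real.pi_pos]) (by simp) s
    push_cast at this; exact this
  have hp : (2 * π : ℂ)^s ≠ 0 := by
    rw [Complex.cpow_def_of_ne_zero (by simp [Real.pi_ne_zero])]; exact Complex.exp_ne_zero _
  have hq : (1 + I : ℂ)^s ≠ 0 := by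
    rw [Complex.cpow_def_of_ne_zero n0]; exact Complex.exp_ne_zero _
  have hd := Complex.Gammaℝ_div_Gammaℝ_one_sub (s := s) (fun n h => by
    rw [h] at hs'; simp at hs')
  have hchi : chi s = Complex.Gammaℝ (1 - s) / Complex.Gammaℝ s := by
    unfold chi
    rw [Complex.Gammaℝ_def, Complex.Gammaℝ_def]
    have hpi : (π:ℂ) ≠ 0 := by exact_mod_cast Real.pi_ne_zero
    rw [show s - 1/2 = -(1 - s)/2 - (-s/2) by ring, Complex.cpow_sub _ _ hpi]
    have : Complex.Gamma (s/2) ≠ 0 := Complex.Gamma_ne_zero_of_re_pos (by simp; linarith)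
    have h5 : (π:ℂ)^(-s/2) ≠ 0 := by
      rw [Complex.cpow_def_of_ne_zero hpi]; exact Complex.exp_ne_zero _
    field_simp
  have g1 : Complex.Gammaℝ s ≠ 0 := Complex.Gammaℝ_ne_zero_of_re_pos hs
  have hcos : Complex.cos (π * s/2) ≠ 0 := by
    intro h
    rw [Complex.cos_eq_zero_iff] at h
    obtain ⟨k, hk⟩ := h
    have hpi : (π:ℂ) ≠ 0 := by exact_mod_cast Real.pi_ne_zero
    have : s = ((2 * k + 1 : ℝ) : ℂ) := by
      push_cast
      field_simp at hk
      exact hk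
    rw [this] at hs'
    simp at hs'
  have hne : rsEE s * Complex.Gamma s ≠ 0 := by
    rw [hE]
    exact mul_ne_zero (mul_ne_zero hq (mul_ne_zero two_ne_zero hcos)) hG
  refine ⟨hne, ?_⟩
  have g2 : Complex.Gammaℝ (1 - s) ≠ 0 := by
    intro h
    rw [h, div_zero, Complex.Gammaℂ_def] at hd
    refine absurd hd.symm (mul_ne_zero (mul_ne_zero (mul_ne_zero two_ne_zero ?_) hG) hcos)
    rw [Complex.cpow_neg]; exact inv_ne_zero hp
  rw [hchi, hE, hκ]
  rw [Complex.Gammaℂ_def, Complex.cpow_neg] at hd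
  rw [div_eq_iff g2] at hd
  rw [div_mul_eq_mul_div, eq_div_iff g1, hd]
  field_simp

lemma rs_cos_line (n : ℕ) (p : ℝ) : Complex.sin (π * (((n:ℝ) + 1/2 : ℝ) + (1 + I) * p)) = (-1)^n * Complex.cos (π * (1 + I) * p) := by
  have : (π:ℂ) * ((((n:ℝ) + 1/2 : ℝ):ℂ) + (1 + I) * p) = π * ((1/2:ℝ) + (1 + I) * p) + n * π := by
    push_cast; ring
  rw [this, Complex.sin_antiperiodic.add_nat_mul_eq, rs_sin_line]

lemma rsX_nat (s : ℂ) (k : ℕ) : rsX s k = (-1)^k * (k:ℂ)^(-s) := by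
  unfold rsX
  have : Complex.exp (π * I * (k:ℂ)^2) = (-1)^k := by
    have h : (π * I * (k:ℂ)^2) = ((k^2 : ℕ) : ℂ) * (π * I) := by push_cast; ring
    rw [h, Complex.exp_nat_mul, Complex.exp_pi_mul_I]
    rcases Nat.even_or_odd k with h | h
    · rw [h.neg_one_pow, (h.pow_of_ne_zero two_ne_zero).neg_one_pow]
    · rw [h.neg_one_pow, h.pow.neg_one_pow]
  rw [this]; ring

lemma rsQ_step (s : ℂ) (k : ℕ) (hk : 1 ≤ k) : rsQ s (k + 1/2) - rsQ s (k - 1/2) = (1 + I) * (k:ℂ)^(-s) := by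
  have hk' : (1:ℝ) ≤ k := by exact_mod_cast hk
  have hlow : ∀ z : ℂ, |z.im| ≤ 1/4 → 1/4 ≤ ‖((k:ℝ):ℂ) + (1 + I) * z‖ := by
    intro z hz
    have h1 := Complex.abs_re_le_norm (((k:ℝ):ℂ) + (1 + I) * z)
    have h2 := Complex.abs_im_le_norm (((k:ℝ):ℂ) + (1 + I) * z)
    have h3 := le_abs_self ((((k:ℝ):ℂ) + (1 + I) * z).re)
    have h4 := neg_abs_le ((((k:ℝ):ℂ) + (1 + I) * z).im)
    have h5 : (((k:ℝ):ℂ) + (1 + I) * z).re - (((k:ℝ):ℂ) + (1 + I) * z).im = k - 2 * z.im := by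
      simp; ring
    rw [abs_le] at hz
    linarith [hz.2]
  obtain ⟨C, hC⟩ := rsX_bound s k (1/4) (1/4) (by norm_num) (by norm_num)
  have h := rs_residue (rsX s) C k ?_ (fun z h1 _ => by
    have := hC z h1 (hlow z h1); simpa using this)
  · unfold rsQ
    rw [h, rsX_nat]
    have : ((-1:ℂ)^k) * (-1)^k = 1 := by rw [← mul_pow]; simp
    linear_combination ((1 + I) * (k:ℂ)^(-s)) * this
  · intro x hx
    simp only [Set.mem_ofPred_eq] at hx
    refine DifferentiableAt.differentiableWithinAt ?_
    have hx0 : x ∈ Complex.slitPlane := rs_slit (by linarith [hx.1]) (fun h => by rw [h] at hx; simp at hx; linarith [hx.1])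
    unfold rsX
    exact ((differentiableAt_id.cpow (differentiableAt_const _) hx0)).mul (by fun_prop)

lemma rsQ_shift (s : ℂ) (n : ℕ) : rsQ s (n + 1/2) = rsQ s (1/2) + (1 + I) * ∑ k ∈ Finset.Icc 1 n, (k:ℂ)^(-s) := by
  induction n with
  | zero => simp
  | succ n ih =>
    have h := rsQ_step s (n+1) (by omega)
    rw [Finset.sum_Icc_succ_top (by omega), mul_add, ← add_assoc, ← ih, ← h]
    have : ((n+1:ℕ):ℝ) - 1/2 = n + 1/2 := by push_cast; ring
    rw [this]; ring

/-- Riemann-Siegel formula -/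
lemma rs_formula (t : ℝ) (ht : 0 < t) (n : ℕ) :
    let s : ℂ := 1/2 + I * t
    let R : ℂ := (∑ k ∈ Finset.Icc 1 n, (k:ℂ)^(-s)) - rsQ s (n + 1/2) / (1 + I)
    riemannZeta s = R + chi s * (starRingEnd ℂ) R := by
  intro s R
  have hre : s.re = 1/2 := by simp [s]
  have him : s.im = t := by simp [s]
  have hR : R = - rsQ s (1/2) / (1 + I) := by
    simp only [R]
    rw [rsQ_shift]
    have := rs_one_add_I_ne
    field_simp; ring
  have hc : 1 - (starRingEnd ℂ) s = s := by
    apply Complex.ext <;> simp [s]; norm_num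
  have h1 := rs_fe s (by rw [hre]; norm_num) (by rw [him]; exact ht)
  obtain ⟨hne, h2⟩ := rs_chi_eq s (by rw [hre]; norm_num) (by rw [him]; exact ht)
  rw [hc, h2] at h1
  have n0 := rs_one_add_I_ne
  have n1 : (1 - I) ≠ 0 := fun h => by have := congrArg Complex.re h; simp at this
  have h3 : ((1 + I) * riemannZeta s + rsQ s (1/2)) * (-(1 - I)) = (1 + I) * chi s * (starRingEnd ℂ) (rsQ s (1/2)) := by
    apply mul_left_cancel₀ hne
    linear_combination h1
  rw [hR]
  simp only [map_div₀, map_neg, map_add, map_one, conj_I]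
  rw [← sub_eq_add_neg]
  field_simp
  linear_combination -h3


lemma rs_gauss_mellin (s : ℂ) (hs : s.re < 1) :
    ∫ p : ℝ in Set.Ioi 0, (p:ℂ)^(-s) * Complex.exp (-2 * π * (p:ℂ)^2) =
      1/2 * ((1/(2 * π : ℂ))^((1-s)/2) * Complex.Gamma ((1-s)/2)) := by
  have h1 := rs_gamma_r ((1-s)/2) (by simp; linarith) (2 * π) (by simp [Real.pi_pos])
  rw [← h1, ← integral_comp_rpow_Ioi_of_pos (g := fun ρ : ℝ => (ρ:ℂ)^((1-s)/2 - 1) * Complex.exp (-(2 * π * (ρ:ℂ)))) (p := 2) two_pos, ← integral_const_mul]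
  refine setIntegral_congr_fun measurableSet_Ioi fun p hp => ?_
  have hp : 0 < p := hp
  have hp0 : (p:ℂ) ≠ 0 := by exact_mod_cast hp.ne'
  simp only [Complex.real_smul]
  have e1 : ((p ^ (2:ℝ) : ℝ) : ℂ) = (p:ℂ)^2 := by
    rw [show (2:ℝ) = ((2:ℕ):ℝ) by norm_num, Real.rpow_natCast]; push_cast; rfl
  have e2 : ((2 * p ^ ((2:ℝ) - 1) : ℝ) : ℂ) = 2 * p := by
    norm_num
  have e3 : ((p:ℂ)^2)^((1-s)/2 - 1) * p = (p:ℂ)^(-s) := by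
    rw [sq, Complex.mul_cpow_ofReal_nonneg hp.le hp.le, ← Complex.cpow_add _ _ hp0]
    nth_rw 2 [← Complex.cpow_one (p:ℂ)]
    rw [← Complex.cpow_add _ _ hp0]
    congr 1; ring
  rw [e1, e2, ← e3]
  rw [show -2 * (π:ℂ) * (p:ℂ)^2 = -(2 * π * (p:ℂ)^2) by ring]
  ring

lemma rs_J_neg (s : ℂ) (hs : s.re < 0) (c : ℝ) (hc : 0 < c) :
    rsL (rsX s) c = ((1 + I)^(-s) + (-1 - I)^(-s)) * (1/2 * ((1/(2 * π : ℂ))^((1-s)/2) * Complex.Gamma ((1-s)/2))) := by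
  obtain ⟨C, hC⟩ := rsX_bound s 0 (c/2) 1 (by linarith) one_pos
  have key := rs_collapse (-s) (by simpa using hs) (fun z => Complex.exp (-2 * π * z^2)) c C hc
    (by fun_prop) (by fun_prop) ?_ ?_
  · rw [← rs_gauss_mellin s (by linarith), ← key]
    congr 1; funext x
    unfold rsX
    congr 2
    field_simp [rs_one_add_I_ne]
    ring_nf; simp only [I_sq, I_pow_three]; ring
  · intro z h1 h2 h3
    have := hC z (by rw [abs_le]; constructor <;> linarith) (by simpa using h3.trans (rs_re_le_norm z))
    simp only [ofReal_zero, zero_add] at this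
    refine le_trans (le_of_eq ?_) this
    unfold rsX
    congr 3
    ring_nf; simp only [I_sq, I_pow_three]; ring
  · intro p; simp

lemma rs_J (s : ℂ) (hs : s.re < 1) (c : ℝ) (hc : 0 < c) :
    rsL (rsX s) c = ((1 + I)^(-s) + (-1 - I)^(-s)) * (1/2 * ((1/(2 * π : ℂ))^((1-s)/2) * Complex.Gamma ((1-s)/2))) := by
  set U : Set ℂ := {s : ℂ | s.re < 1} with hU
  have hUo : IsOpen U := isOpen_lt Complex.continuous_re continuous_const
  have hpre : IsPreconnected U := (convex_halfSpace_re_lt 1).isPreconnected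
  have n2 : (-1 - I) ≠ 0 := fun h => by have := congrArg Complex.re h; simp at this
  have hpi : (2 * π : ℂ) ≠ 0 := by simp [Real.pi_ne_zero]
  have h1 : AnalyticOnNhd ℂ (fun s => rsL (rsX s) c) U := by
    refine DifferentiableOn.analyticOnNhd (Differentiable.differentiableOn ?_) hUo
    have := rs_line_diff (fun _ => 1) 1 c continuous_const (by simp) hc
    simpa [rsL] using this
  have h2 : AnalyticOnNhd ℂ (fun s => ((1 + I)^(-s) + (-1 - I)^(-s)) * (1/2 * ((1/(2 * π : ℂ))^((1-s)/2) * Complex.Gamma ((1-s)/2)))) U := by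
    refine DifferentiableOn.analyticOnNhd (fun z hz => ?_) hUo
    refine DifferentiableAt.differentiableWithinAt ?_
    refine DifferentiableAt.mul (DifferentiableAt.add ?_ ?_) (DifferentiableAt.const_mul (DifferentiableAt.mul ?_ ?_) _)
    · exact differentiableAt_id.neg.const_cpow (Or.inl rs_one_add_I_ne)
    · exact differentiableAt_id.neg.const_cpow (Or.inl n2)
    · exact DifferentiableAt.const_cpow (by fun_prop) (Or.inl (by simp [Real.pi_ne_zero]))
    · refine DifferentiableAt.comp (g := Complex.Gamma) z (Complex.differentiableAt_Gamma _ (fun m h => ?_)) (by fun_prop)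
      have hz : z.re < 1 := hz
      have := congrArg Complex.re h
      simp at this; linarith [Nat.cast_nonneg (α := ℝ) m]
  refine h1.eqOn_of_preconnected_of_eventuallyEq h2 hpre (z₀ := -1) (by simp [hU]) ?_ hs
  have : {s : ℂ | s.re < 0} ∈ nhds (-1 : ℂ) :=
    (isOpen_lt Complex.continuous_re continuous_const).mem_nhds (by simp)
  filter_upwards [this] with z hz
  exact rs_J_neg z hz c hc

/-- the phase function -/
def rsA (t : ℝ) : ℂ := (π:ℂ)^(I * t / 2) * Complex.Gamma (1/4 - I * t / 2)

lemma rs_J_half (t : ℝ) (c : ℝ) (hc : 0 < c) : ∃ κ : ℝ, 0 < κ ∧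
    rsL (rsX (1/2 + I * t)) c = κ * Complex.exp (-(π * I / 8)) * (1 + I * Real.exp (-(π * t))) * rsA t := by
  refine ⟨1/2 * Real.exp (- Real.log 2 / 2) * Real.exp (- Real.log π / 4) * Real.exp (π * t / 4), by positivity, ?_⟩
  rw [rs_J _ (by simp; norm_num) c hc]
  unfold rsA
  have hl2 : (Complex.log 2).im = 0 := by
    rw [show (2:ℂ) = ((2:ℝ):ℂ) by norm_num, ← Complex.ofReal_log (by norm_num), Complex.ofReal_im]
  have l1 : Complex.log (1 + I) = (Real.log 2 / 2 : ℝ) + π / 4 * I := by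
    have h : (1 + I) = Complex.exp ((Real.log 2 / 2 : ℝ) + π / 4 * I) := by
      rw [Complex.exp_add, ← Complex.ofReal_exp, Complex.exp_mul_I]
      rw [show (π:ℂ)/4 = ((π/4:ℝ):ℂ) by push_cast; ring, ← Complex.ofReal_cos, ← Complex.ofReal_sin,
        Real.cos_pi_div_four, Real.sin_pi_div_four, show Real.log 2 / 2 = Real.log (√2) by rw [Real.log_sqrt (by norm_num)],
        Real.exp_log (by positivity)]
      have : (((√2:ℝ):ℂ))^2 = 2 := by exact_mod_cast Real.sq_sqrt (by norm_num : (0:ℝ) ≤ 2)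
      push_cast
      linear_combination (-(1 + I)/2) * this
    rw [h, Complex.log_exp]
    · simp [hl2]; linarith [Real.pi_pos]
    · simp [hl2]; linarith [Real.pi_pos]
  have l2 : Complex.log (-1 - I) = (Real.log 2 / 2 : ℝ) - 3 * π / 4 * I := by
    have h : (-1 - I) = Complex.exp ((Real.log 2 / 2 : ℝ) - 3 * π / 4 * I) := by
      have e1 : (Real.log 2 / 2 : ℝ) - 3 * π / 4 * I = Complex.log (1 + I) - π * I := by rw [l1]; ring
      rw [e1, Complex.exp_sub, Complex.exp_log rs_one_add_I_ne, Complex.exp_pi_mul_I]; ring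
    rw [h, Complex.log_exp]
    · simp [hl2]; linarith [Real.pi_pos]
    · simp [hl2]; linarith [Real.pi_pos]
  have n2 : (-1 - I) ≠ 0 := fun h => by have := congrArg Complex.re h; simp at this
  have hpi : (π : ℂ) ≠ 0 := by simp [Real.pi_ne_zero]
  have l3 : Complex.log (1/(2 * π : ℂ)) = ((-(Real.log 2 + Real.log π) : ℝ) : ℂ) := by
    rw [show 1/(2 * π : ℂ) = ((1/(2*π) : ℝ) : ℂ) by push_cast; rfl, ← Complex.ofReal_log (by positivity)]
    congr 1
    rw [one_div, Real.log_inv, Real.log_mul two_ne_zero Real.pi_ne_zero]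
  have l4 : Complex.log π = (Real.log π : ℝ) := by rw [← Complex.ofReal_log (by positivity)]
  rw [show (1 - (1/2 + I * (t:ℂ)))/2 = 1/4 - I * t / 2 by ring]
  rw [Complex.cpow_def_of_ne_zero rs_one_add_I_ne, Complex.cpow_def_of_ne_zero n2, Complex.cpow_def_of_ne_zero (by simp [hpi]),
    Complex.cpow_def_of_ne_zero hpi, l1, l2, l3, l4]
  set G := Complex.Gamma (1/4 - I * t / 2)
  set a := Real.log 2
  set b := Real.log π
  have hI : Complex.exp (π / 2 * I) = I := by rw [Complex.exp_pi_div_two_mul_I]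
  nth_rw 7 [← hI]
  push_cast
  have : ∀ x y z w : ℂ, (x + y) * (1/2 * (z * G)) = (x * z + y * z) * (1/2 * G) := by intros; ring
  rw [this 0 0 0 0 |> fun _ => this _ _ _ 0]
  have g2 : ∀ k1 k2 k3 k4 m1 m2 q: ℂ, 1/2 * k1 * k2 * k3 * k4 * (1 + m1 * m2) * (q * G) = (k1 * k2 * k3 * k4 * q + k1 * k2 * k3 * k4 * m1 * m2 * q) * (1/2 * G) := by intros; ring
  rw [g2]
  simp only [← Complex.exp_add]
  congr 3
  · ring_nf; simp only [I_sq]; ring_nf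
  · ring_nf; simp only [I_sq]; ring_nf


lemma rsA_ne (t : ℝ) : rsA t ≠ 0 := by
  unfold rsA
  refine mul_ne_zero ?_ (Complex.Gamma_ne_zero_of_re_pos (by simp))
  rw [Complex.cpow_def_of_ne_zero (by simp [Real.pi_ne_zero])]
  exact Complex.exp_ne_zero _

lemma rsA_conj (t : ℝ) : (starRingEnd ℂ) (rsA t) = rsA (-t) := by
  unfold rsA
  rw [map_mul, ← Complex.Gamma_conj]
  have h := Complex.conj_cpow (π:ℂ) (I * (-t:ℝ) / 2) (by
    rw [Complex.arg_ofReal_of_nonneg Real.pi_pos.le]; exact Real.pi_pos.ne)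
  rw [Complex.conj_ofReal] at h
  rw [h]
  simp [Complex.conj_ofNat]

lemma rsA_cont : Continuous rsA := by
  unfold rsA
  refine Continuous.mul ?_ ?_
  · exact Continuous.const_cpow (by fun_prop) (Or.inl (by simp [Real.pi_ne_zero]))
  · refine continuous_iff_continuousAt.2 fun t => ?_
    refine ContinuousAt.comp (g := Complex.Gamma) ?_ (by fun_prop)
    refine (Complex.differentiableAt_Gamma _ (fun m h => ?_)).continuousAt
    have := congrArg Complex.re h
    simp at this
    linarith [Nat.cast_nonneg (α := ℝ) m]

lemma rs_chi_A (t : ℝ) : chi (1/2 + I * t) = rsA t / (starRingEnd ℂ) (rsA t) := by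
  rw [rsA_conj]
  unfold chi rsA
  have hpi : (π:ℂ) ≠ 0 := by simp [Real.pi_ne_zero]
  have e1 : (π:ℂ)^((1/2 + I * t : ℂ) - 1/2) = (π:ℂ)^(I * t / 2) * (π:ℂ)^(I * t / 2) := by
    rw [← Complex.cpow_add _ _ hpi]; congr 1; ring
  have e2 : (π:ℂ)^(I * (-t:ℝ) / 2) = ((π:ℂ)^(I * t / 2))⁻¹ := by
    rw [← Complex.cpow_neg]; congr 1; push_cast; ring
  have e3 : (π:ℂ)^(I * t / 2) ≠ 0 := by
    rw [Complex.cpow_def_of_ne_zero hpi]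
    exact Complex.exp_ne_zero _
  have e4 : Complex.Gamma (1/4 - I * (-t:ℝ) / 2) ≠ 0 := Complex.Gamma_ne_zero_of_re_pos (by simp)
  have e5 : (1/2 + I * (t:ℂ))/2 = 1/4 - I * (-t:ℝ) / 2 := by push_cast; ring
  have e6 : (1 - (1/2 + I * (t:ℂ)))/2 = 1/4 - I * t / 2 := by ring
  rw [e5, e6, e1, e2]
  field_simp

lemma rs_omega (t : ℝ) : (1/2 + I * t : ℂ) ∈ RSOmega := by
  right; simp; norm_num

lemma rs_phase (ϑ : ℂ → ℂ) (hϑ : IsRSTheta ϑ) (t : ℝ) :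
    Complex.exp (I * ϑ (1/2 + I * t)) = (starRingEnd ℂ) (rsA t) / (‖rsA t‖ : ℂ) := by
  obtain ⟨h1, h2, h3⟩ := hϑ
  set h : ℝ → ℂ := fun t => Complex.exp (I * ϑ (1/2 + I * t)) * rsA t / (‖rsA t‖ : ℂ) with hh
  have hn : ∀ t, (‖rsA t‖ : ℂ) ≠ 0 := fun t => by
    exact_mod_cast (norm_pos_iff.2 (rsA_ne t)).ne'
  have hopen : IsOpen RSOmega := by
    have : RSOmega = {s : ℂ | s.im ≠ 0} ∪ ({s : ℂ | 0 < s.re} ∩ {s : ℂ | s.re < 1}) := by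
      ext s; simp [RSOmega]
    rw [this]
    exact (isOpen_ne_fun Complex.continuous_im continuous_const).union
      ((isOpen_lt continuous_const Complex.continuous_re).inter (isOpen_lt Complex.continuous_re continuous_const))
  have hθc : Continuous (fun t : ℝ => ϑ (1/2 + I * t)) := by
    refine continuous_iff_continuousAt.2 fun t => ?_
    refine ContinuousAt.comp (g := ϑ) (f := fun t : ℝ => (1/2 + I * t : ℂ)) ?_ (by fun_prop)
    exact (h1.continuousOn).continuousAt (hopen.mem_nhds (rs_omega t))
  have hc : Continuous h := by
    refine Continuous.div ?_ ?_ hn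
    · exact (Complex.continuous_exp.comp (continuous_const.mul hθc)).mul rsA_cont
    · exact Complex.continuous_ofReal.comp rsA_cont.norm
  have hns : ∀ t, rsA t * (starRingEnd ℂ) (rsA t) = (‖rsA t‖ : ℂ)^2 := fun t => Complex.mul_conj' _
  have hcn : ∀ t, (starRingEnd ℂ) (rsA t) ≠ 0 := fun t => by rw [rsA_conj]; exact rsA_ne _
  have hsq : ∀ t, h t ^ 2 = 1 := by
    intro t
    have e1 := h2 _ (rs_omega t)
    rw [rs_chi_A] at e1
    have e2 : Complex.exp (I * ϑ (1/2 + I * t))^2 = (starRingEnd ℂ) (rsA t) / rsA t := by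
      rw [← Complex.exp_nat_mul, ← inv_div (rsA t), ← e1, ← Complex.exp_neg]
      congr 1; push_cast; ring
    simp only [hh]
    rw [div_pow, mul_pow, e2, ← hns]
    field_simp [rsA_ne t, hcn t]
  have hone := isPreconnected_univ.eq_or_eq_neg_of_sq_eq (f := h) (g := fun _ => (1:ℂ)) hc.continuousOn continuousOn_const
    (fun t _ => by simp [hsq t]) (by simp)
  have h0 : h 0 = 1 := by
    have a0 : rsA 0 = (Real.Gamma (1/4) : ℝ) := by
      unfold rsA
      rw [Complex.ofReal_zero]
      simp
      rw [← Complex.Gamma_ofReal]; congr 1; push_cast; ring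
    simp only [hh]
    rw [a0]
    have : (0:ℝ) < Real.Gamma (1/4) := Real.Gamma_pos_of_pos (by norm_num)
    rw [Complex.norm_real, Real.norm_of_nonneg this.le]
    simp only [ofReal_zero, mul_zero, add_zero]
    rw [h3]
    have : ((Real.Gamma (1/4) : ℝ) : ℂ) ≠ 0 := by exact_mod_cast this.ne'
    simp only [mul_zero, Complex.exp_zero, one_mul]
    exact div_self this
  have hall : h t = 1 := by
    rcases hone with hone | hone
    · exact hone (Set.mem_univ t)
    · exfalso
      have := hone (Set.mem_univ 0)
      rw [h0] at this
      simp at this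
      norm_num [Complex.ext_iff] at this
  have e1 : Complex.exp (I * ϑ (1/2 + I * t)) * rsA t = ‖rsA t‖ := by
    have := hall; simp only [hh] at this
    rwa [div_eq_one_iff_eq (hn t)] at this
  rw [eq_div_iff (hn t), ← e1]
  have := hns t
  have e3 : rsA t ≠ 0 := rsA_ne t
  refine mul_right_cancel₀ e3 ?_
  rw [mul_comm ((starRingEnd ℂ) (rsA t)), this, ← e1]; ring

/-- reduce the left-hand side -/
lemma rs_reduce (ϑ : ℂ → ℂ) (hϑ : IsRSTheta ϑ) (t : ℝ) (ht : 0 < t) :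
    Complex.exp (I * ϑ (1/2 + I*t)) * riemannZeta (1/2 + I*t)
          - Complex.exp (I * ϑ (1/2 + I*t)) * zetaSum (Real.sqrt (t/(2*π))) (1/2 + I*t)
          - Complex.exp (I * ϑ (1 - (1/2 + I*t))) *
              zetaSum (Real.sqrt (t/(2*π))) (1 - (1/2 + I*t)) =
    -((starRingEnd ℂ) (rsA t) / (‖rsA t‖ : ℂ) * (rsQ (1/2 + I * t) (⌊Real.sqrt (t/(2*π))⌋₊ + 1/2) / (1 + I))
     + (starRingEnd ℂ) ((starRingEnd ℂ) (rsA t) / (‖rsA t‖ : ℂ) * (rsQ (1/2 + I * t) (⌊Real.sqrt (t/(2*π))⌋₊ + 1/2) / (1 + I)))) := by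
  have hn : (‖rsA t‖ : ℂ) ≠ 0 := by
    exact_mod_cast (norm_pos_iff.2 (rsA_ne t)).ne'
  have hcn : (starRingEnd ℂ) (rsA t) ≠ 0 := by rw [rsA_conj]; exact rsA_ne _
  have e1 : (1 - (1/2 + I * (t:ℂ))) = 1/2 + I * ((-t:ℝ):ℂ) := by push_cast; ring
  have hf := rs_formula t ht ⌊Real.sqrt (t/(2*π))⌋₊
  simp only at hf
  rw [e1, rs_phase ϑ hϑ t, rs_phase ϑ hϑ (-t), ← rsA_conj, Complex.conj_conj, hf, rs_chi_A]
  have hz : zetaSum (Real.sqrt (t/(2*π))) (1/2 + I * ((-t:ℝ):ℂ)) = (starRingEnd ℂ) (zetaSum (Real.sqrt (t/(2*π))) (1/2 + I * t)) := by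
    unfold zetaSum
    rw [map_sum]
    refine Finset.sum_congr rfl fun n _ => ?_
    have h := Complex.conj_cpow (n:ℂ) (-(1/2 + I * ((-t:ℝ):ℂ))) (by
      rw [Complex.natCast_arg]; exact Real.pi_pos.ne)
    rw [Complex.conj_natCast] at h
    rw [h]
    simp [Complex.conj_ofNat]
  rw [hz]
  unfold zetaSum
  set S := ∑ n ∈ Finset.Icc 1 ⌊√(t / (2 * π))⌋₊, (n:ℂ) ^ (-(1/2 + I * (t:ℂ)))
  set Q := rsQ (1/2 + I * t) (⌊Real.sqrt (t/(2*π))⌋₊ + 1/2) / (1 + I)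
  have hns := Complex.mul_conj' (rsA t)
  rw [Complex.norm_conj]
  simp only [map_sub, map_mul, map_div₀, Complex.conj_conj, Complex.conj_ofReal]
  field_simp
  ring


def rsg (ω : ℂ) : ℂ := (Complex.log (1 + ω) - ω + ω^2/2) / ω^2

def rsF (w ω : ℂ) : ℂ := Complex.exp (-(1/2) * Complex.log (1 + ω) + w * rsg ω)

lemma rsg_bound (ω : ℂ) (h : ‖ω‖ ≤ 1/2) : ‖rsg ω‖ ≤ 2/3 * ‖ω‖ := by
  by_cases h0 : ω = 0
  · simp [rsg, h0]
  have h1 := Complex.norm_log_sub_logTaylor_le 2 (z := ω) (by linarith)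
  have h2 : Complex.logTaylor 3 ω = ω - ω^2/2 := by
    simp [Complex.logTaylor, Finset.sum_range_succ]; ring
  rw [show 2 + 1 = 3 from rfl, h2] at h1
  have hp : 0 < ‖ω‖ := norm_pos_iff.2 h0
  unfold rsg
  rw [norm_div, norm_pow, div_le_iff₀ (by positivity)]
  rw [show Complex.log (1 + ω) - ω + ω^2/2 = Complex.log (1 + ω) - (ω - ω^2/2) by ring]
  refine h1.trans ?_
  have h3 : (1 - ‖ω‖)⁻¹ ≤ 2 := by
    rw [inv_le_comm₀ (by linarith) two_pos]; linarith
  have h4 : 0 ≤ ‖ω‖^3 := by positivity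
  push_cast
  nlinarith [mul_le_mul_of_nonneg_left h3 h4]

lemma rsF_bound (w ω : ℂ) (h : ‖ω‖ ≤ 1/2) : ‖rsF w ω‖ ≤ Real.exp (1 + ‖w‖/3) := by
  unfold rsF
  rw [Complex.norm_exp]
  refine Real.exp_le_exp.2 ((Complex.re_le_norm _).trans ((norm_add_le _ _).trans ?_))
  rw [norm_mul, norm_mul]
  have h1 := Complex.norm_log_one_add_half_le_self h
  have h2 := rsg_bound ω h
  have h3 : ‖rsg ω‖ ≤ 1/3 := by linarith
  have h4 := mul_le_mul_of_nonneg_left h3 (norm_nonneg w)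
  have h5 : ‖(-(1/2) : ℂ)‖ = 1/2 := by rw [norm_neg]; norm_num
  rw [h5]
  linarith

lemma rs_slit1 (ω : ℂ) (h : ‖ω‖ ≤ 1/2) : 1 + ω ∈ Complex.slitPlane :=
  Complex.mem_slitPlane_of_norm_lt_one (by linarith)

lemma rsF_diffAt (w ω : ℂ) (h : ‖ω‖ ≤ 1/2) (h0 : ω ≠ 0) : DifferentiableAt ℂ (rsF w) ω := by
  have h1 : DifferentiableAt ℂ (fun ω => Complex.log (1 + ω)) ω :=
    DifferentiableAt.clog (by fun_prop) (rs_slit1 ω h)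
  have h2 : DifferentiableAt ℂ rsg ω := by
    unfold rsg
    exact DifferentiableAt.div (by fun_prop) (by fun_prop) (pow_ne_zero _ h0)
  unfold rsF
  fun_prop

lemma rsF_contOn (w : ℂ) : ContinuousOn (rsF w) (Metric.closedBall 0 (1/2)) := by
  intro ω hω
  have hω : ‖ω‖ ≤ 1/2 := by simpa using hω
  by_cases h0 : ω = 0
  · subst h0
    refine ContinuousAt.continuousWithinAt ?_
    have h1 : ContinuousAt (fun ω => Complex.log (1 + ω)) (0:ℂ) :=
      ContinuousAt.clog (by fun_prop) (rs_slit1 0 (by simp))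
    have h2 : ContinuousAt rsg 0 := by
      have e0 : rsg 0 = 0 := by simp [rsg]
      rw [ContinuousAt, e0]
      refine squeeze_zero_norm' (a := fun ω : ℂ => 2/3 * ‖ω‖) ?_ ?_
      · filter_upwards [Metric.closedBall_mem_nhds (0:ℂ) (show (0:ℝ) < 1/2 by norm_num)] with ω hω
        exact rsg_bound ω (by simpa using hω)
      · have : Continuous (fun ω : ℂ => 2/3 * ‖ω‖) := by fun_prop
        simpa using this.tendsto 0
    unfold rsF
    fun_prop
  · exact (rsF_diffAt w ω hω h0).continuousAt.continuousWithinAt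

def rsc (m : ℕ) (w : ℂ) : ℂ := (2 * π * I : ℂ)⁻¹ • ∮ ζ in C(0, 1/2), (ζ⁻¹)^(m+1) * rsF w ζ

lemma rs_circ_ne (θ : ℝ) : circleMap 0 (1/2) θ ≠ 0 := circleMap_ne_center (by norm_num)

lemma rs_circ_norm (θ : ℝ) : ‖circleMap 0 (1/2) θ‖ = 1/2 := by simp

lemma rsc_cont (m : ℕ) : Continuous (rsc m) := by
  unfold rsc circleIntegral
  simp only [smul_eq_mul]
  refine continuous_const.mul ?_
  refine intervalIntegral.continuous_parametric_intervalIntegral_of_continuous' ?_ _ _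
  have hcm : Continuous (fun p : ℂ × ℝ => circleMap 0 (1/2) p.2) := (continuous_circleMap 0 (1/2)).comp continuous_snd
  have hlog : Continuous (fun p : ℂ × ℝ => Complex.log (1 + circleMap 0 (1/2) p.2)) :=
    Continuous.clog (by fun_prop) (fun p => rs_slit1 _ (rs_circ_norm _).le)
  have hg : Continuous (fun p : ℂ × ℝ => rsg (circleMap 0 (1/2) p.2)) := by
    unfold rsg
    exact Continuous.div (by fun_prop) (by fun_prop) (fun p => pow_ne_zero _ (rs_circ_ne _))
  have hinv : Continuous (fun p : ℂ × ℝ => (circleMap 0 (1/2) p.2)⁻¹) := hcm.inv₀ (fun p => rs_circ_ne _)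
  unfold rsF
  simp only [deriv_circleMap, Function.uncurry_def]
  fun_prop

lemma rsc_bound (m : ℕ) (w : ℂ) : ‖rsc m w‖ ≤ 2^m * Real.exp (1 + ‖w‖/3) := by
  unfold rsc
  have := circleIntegral.norm_two_pi_i_inv_smul_integral_le_of_norm_le_const (c := 0) (R := 1/2) (f := fun ζ => (ζ⁻¹)^(m+1) * rsF w ζ)
    (C := 2^(m+1) * Real.exp (1 + ‖w‖/3)) (by norm_num) ?_
  · refine this.trans (le_of_eq ?_)
    rw [pow_succ]; ring
  · intro z hz
    have hz : ‖z‖ = 1/2 := by simpa using hz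
    rw [norm_mul, norm_pow, norm_inv, hz]
    refine mul_le_mul (by norm_num) (rsF_bound w z hz.le) (norm_nonneg _) (by positivity)

lemma rsF_taylor (N : ℕ) (w ω : ℂ) (h : ‖ω‖ ≤ 1/4) :
    ‖rsF w ω - ∑ m ∈ Finset.range N, rsc m w * ω^m‖ ≤ 2^(N+1) * Real.exp (1 + ‖w‖/3) * ‖ω‖^N := by
  have hc := Complex.two_pi_I_inv_smul_circleIntegral_sub_inv_smul_of_differentiable_on_off_countable
    (R := 1/2) (c := 0) (w := ω) (f := rsF w) (s := {0}) (Set.countable_singleton _) (by simp; linarith)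
    (rsF_contOn w) (fun x hx => rsF_diffAt w x (by
      have := hx.1; simp at this; linarith) (by simpa using hx.2))
  have hsph : ContinuousOn (rsF w) (Metric.sphere 0 (1/2)) := (rsF_contOn w).mono Metric.sphere_subset_closedBall
  have hinv : ContinuousOn (fun z : ℂ => z⁻¹) (Metric.sphere 0 (1/2)) := by
    refine continuousOn_id.inv₀ (fun z hz h0 => ?_)
    have hz : ‖z‖ = 1/2 := by simpa using hz
    simp at h0
    rw [h0] at hz; norm_num at hz
  have hinv2 : ContinuousOn (fun z : ℂ => (z - ω)⁻¹) (Metric.sphere 0 (1/2)) := by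
    refine (continuousOn_id.sub continuousOn_const).inv₀ (fun z hz h0 => ?_)
    have hz : ‖z‖ = 1/2 := by simpa using hz
    have h0 : z - ω = 0 := h0
    rw [sub_eq_zero.1 h0] at hz; linarith
  have hterm : ∀ m : ℕ, ContinuousOn (fun ζ : ℂ => ω ^ m • (ζ⁻¹ ^ (m + 1) * rsF w ζ)) (Metric.sphere 0 (1/2)) := by
    intro m
    have h1 : ContinuousOn (fun ζ : ℂ => ζ⁻¹ ^ (m+1)) (Metric.sphere 0 (1/2)) := hinv.pow _
    simp only [smul_eq_mul]
    exact continuousOn_const.mul (h1.mul hsph)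
  have e1 : ∑ m ∈ Finset.range N, rsc m w * ω^m =
      (2 * π * I : ℂ)⁻¹ • ∮ ζ in C(0, 1/2), ∑ m ∈ Finset.range N, ω^m • ((ζ⁻¹)^(m+1) * rsF w ζ) := by
    rw [circleIntegral.integral_fun_sum, Finset.smul_sum]
    · refine Finset.sum_congr rfl fun m _ => ?_
      rw [circleIntegral.integral_smul, smul_comm, rsc, smul_eq_mul (ω^m), mul_comm]
    · intro m _
      refine ContinuousOn.circleIntegrable (by norm_num) ?_
      exact (hterm m)
  rw [← hc, e1, ← smul_sub, ← circleIntegral.integral_sub]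
  · refine (circleIntegral.norm_two_pi_i_inv_smul_integral_le_of_norm_le_const (C := 2^(N+2) * Real.exp (1 + ‖w‖/3) * ‖ω‖^N) (by norm_num) ?_).trans (le_of_eq ?_)
    · intro z hz
      have hz : ‖z‖ = 1/2 := by simpa using hz
      have hz0 : z ≠ 0 := fun h0 => by rw [h0] at hz; norm_num at hz
      have hz1 : z - ω ≠ 0 := fun h0 => by rw [sub_eq_zero.1 h0] at hz; linarith
      have e2 : (z - ω)⁻¹ - ∑ m ∈ Finset.range N, ω^m * (z⁻¹)^(m+1) = ω^N * (z⁻¹)^N * (z - ω)⁻¹ := by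
        clear hc e1
        induction N with
        | zero => simp
        | succ k ih =>
          rw [Finset.sum_range_succ, ← sub_sub, ih]
          have a1 := mul_inv_cancel₀ hz0
          have a2 := mul_inv_cancel₀ hz1
          rw [pow_succ, pow_succ]
          linear_combination (ω^k * (z⁻¹)^k) * (-(z - ω)⁻¹ * a1 + z⁻¹ * a2)
      have e3 : (z - ω)⁻¹ • rsF w z - ∑ m ∈ Finset.range N, ω^m • ((z⁻¹)^(m+1) * rsF w z) = ω^N * (z⁻¹)^N * (z - ω)⁻¹ * rsF w z := by
        rw [← e2, sub_mul, Finset.sum_mul]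
        simp only [smul_eq_mul, mul_assoc]
      rw [e3, norm_mul, norm_mul, norm_mul, norm_pow, norm_pow, norm_inv, norm_inv, hz]
      have h4 : ‖z - ω‖⁻¹ ≤ 4 := by
        have : 1/4 ≤ ‖z - ω‖ := by
          have := norm_sub_norm_le z ω
          linarith
        rw [inv_le_comm₀ (by linarith) (by norm_num)]; linarith
      have h5 := rsF_bound w z hz.le
      calc ‖ω‖^N * (1/2)⁻¹^N * ‖z - ω‖⁻¹ * ‖rsF w z‖ ≤ ‖ω‖^N * (1/2)⁻¹^N * 4 * Real.exp (1 + ‖w‖/3) := by gcongr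
        _ = _ := by rw [pow_add]; norm_num; ring
    · rw [pow_succ 2 (N+1)]; ring
  · exact ContinuousOn.circleIntegrable (by norm_num) (hinv2.smul hsph)
  · refine ContinuousOn.circleIntegrable (by norm_num) ?_
    exact continuousOn_finsetSum _ fun m _ => (hterm m)


lemma rs_arg (P : ℝ) : (Complex.log (1 + (1 + I) * P)).im ≤ P + P^2/4 := by
  set F : ℝ → ℝ := fun P => P + P^2/4 - (Complex.log (1 + (1 + I) * P)).im with hF
  have hN : ∀ P : ℝ, 0 < 1 + 2 * P + 2 * P^2 := fun P => by nlinarith [sq_nonneg (1 + 2 * P)]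
  have hd : ∀ P : ℝ, HasDerivAt F (P * (5/2 + 3 * P + P^2) / (1 + 2 * P + 2 * P^2)) P := by
    intro P
    have hs : (1 + (1 + I) * (P:ℂ)) ∈ Complex.slitPlane := by
      have := rs_x_slit 1 P one_pos; simpa using this
    have hne := Complex.slitPlane_ne_zero hs
    have h1 : HasDerivAt (fun P : ℝ => (1 + (1 + I) * (P:ℂ))) (1 + I) P := by
      have := ((hasDerivAt_id P).ofReal_comp.const_mul (1 + I)).const_add 1
      simpa using this
    have h2 := h1.clog_real hs
    have h3 : HasDerivAt (fun P : ℝ => (Complex.log (1 + (1 + I) * P)).im) (((1 + I)/(1 + (1 + I) * (P:ℂ))).im) P := by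
      exact Complex.imCLM.hasFDerivAt.comp_hasDerivAt P h2
    have h4 : ((1 + I)/(1 + (1 + I) * (P:ℂ))).im = 1/(1 + 2 * P + 2 * P^2) := by
      rw [Complex.div_im]
      simp [Complex.normSq_apply]
      have e : (1 + P) * (1 + P) + P * P = 1 + 2 * P + 2 * P^2 := by ring
      rw [e]
      have := (hN P).ne'
      field_simp
      ring
    have h5 := ((hasDerivAt_id P).add (((hasDerivAt_id P).pow 2).div_const 4)).sub h3
    rw [h4] at h5
    refine HasDerivAt.congr_deriv (f := F) h5 ?_
    have := (hN P).ne'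
    simp
    field_simp
    ring
  have hq : ∀ P : ℝ, 0 < 5/2 + 3 * P + P^2 := fun P => by nlinarith [sq_nonneg (3/2 + P)]
  have h0 : F 0 = 0 := by simp [hF]
  have hcont : Continuous F := continuous_iff_continuousAt.2 fun P => (hd P).continuousAt
  have : 0 ≤ F P := by
    rw [← h0]
    rcases le_total 0 P with hP | hP
    · refine monotoneOn_of_deriv_nonneg (convex_Ici 0) hcont.continuousOn (fun x _ => (hd x).differentiableAt.differentiableWithinAt) ?_ (Set.self_mem_Ici) hP hP
      intro x hx
      rw [interior_Ici] at hx
      rw [(hd x).deriv]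
      exact div_nonneg (mul_nonneg (le_of_lt hx) (hq x).le) (hN x).le
    · refine antitoneOn_of_deriv_nonpos (convex_Iic 0) hcont.continuousOn (fun x _ => (hd x).differentiableAt.differentiableWithinAt) ?_ hP (Set.self_mem_Iic) hP
      intro x hx
      rw [interior_Iic] at hx
      rw [(hd x).deriv]
      exact div_nonpos_of_nonpos_of_nonneg (mul_nonpos_of_nonpos_of_nonneg (le_of_lt hx) (hq x).le) (hN x).le
  simp only [hF] at this
  linarith

def rsy (b p : ℝ) : ℂ := b + (1 + I) * p

def rsT (α b p : ℝ) : ℂ := Complex.exp (-(1/2 + I * ((2 * π * α^2 : ℝ) : ℂ)) * Complex.log (1 + rsy b p / α)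
  + 2 * π * I * α * rsy b p + π * I * (rsy b p)^2)

lemma rsT_scale (α b p : ℝ) (hα : 0 < α) (hc : 0 < α + b) :
    1 + rsy b p / α = (((α + b)/α : ℝ) : ℂ) * (1 + (1 + I) * ((p/(α + b) : ℝ) : ℂ)) := by
  have h1 : (α:ℂ) ≠ 0 := by exact_mod_cast hα.ne'
  have h2 : (α:ℂ) + b ≠ 0 := by exact_mod_cast hc.ne'
  unfold rsy
  push_cast
  field_simp
  ring

lemma rsT_X (α b p : ℝ) (hα : 0 < α) (hc : 0 < α + b) :
    rsX (1/2 + I * ((2 * π * α^2 : ℝ) : ℂ)) (((α + b : ℝ):ℂ) + (1 + I) * p) =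
      (α:ℂ)^(-(1/2 + I * ((2 * π * α^2 : ℝ) : ℂ))) * Complex.exp (π * I * α^2) * rsT α b p := by
  have h1 : (α:ℂ) ≠ 0 := by exact_mod_cast hα.ne'
  have e1 : ((α + b : ℝ):ℂ) + (1 + I) * p = (1 + rsy b p / α) * α := by
    unfold rsy; push_cast; field_simp; ring
  have hne : 1 + rsy b p / α ≠ 0 := by
    intro h
    rw [h, zero_mul] at e1
    exact rs_x_ne (α + b) p hc e1
  unfold rsX rsT
  rw [e1, rs_real_cpow α hα _ _ hne, Complex.cpow_def_of_ne_zero hne, mul_assoc ((α:ℂ)^_), mul_assoc ((α:ℂ)^_), ← Complex.exp_add, ← Complex.exp_add]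
  congr 2
  field_simp
  ring

lemma rsT_bound (α b p : ℝ) (hα : 1 ≤ α) (hb : |b| ≤ 1/2) (hc : 1 ≤ α + b) :
    ‖rsT α b p‖ ≤ Real.exp (1 + 4 * π) * Real.exp (-p^2) := by
  have hα0 : 0 < α := by linarith
  have hc0 : 0 < α + b := by linarith
  obtain ⟨hb1, hb2⟩ := abs_le.1 hb
  set L := Complex.log (1 + rsy b p / α) with hL
  have hsc := rsT_scale α b p hα0 hc0
  set P := p/(α + b) with hP
  have hQ : (1 + (1 + I) * (P:ℂ)) ≠ 0 := by
    have := rs_x_ne 1 P one_pos; simpa using this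
  have him : L.im ≤ P + P^2/4 := by
    rw [hL, hsc, Complex.log_ofReal_mul (by positivity) hQ]
    simp only [Complex.add_im, Complex.ofReal_im, zero_add]
    exact rs_arg P
  have hre : -2 ≤ L.re := by
    rw [hL, Complex.log_re]
    have h1 : 1/3 ≤ ‖1 + rsy b p / α‖ := by
      rw [hsc, norm_mul, Complex.norm_real, Real.norm_of_nonneg (by positivity)]
      have h2 : 1/2 ≤ ‖(1 + (1 + I) * (P:ℂ))‖ := by
        have := rs_x_norm 1 P one_pos; simpa using this
      have h3 : 2/3 ≤ (α + b)/α := by rw [le_div_iff₀ hα0]; linarith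
      calc (1/3 : ℝ) = 2/3 * (1/2) := by norm_num
        _ ≤ _ := mul_le_mul h3 h2 (by norm_num) (by positivity)
    have h2 := Real.one_sub_inv_le_log_of_pos (show 0 < ‖1 + rsy b p / α‖ by linarith)
    have h3 : ‖1 + rsy b p / α‖⁻¹ ≤ 3 := by
      rw [inv_le_comm₀ (by linarith) (by norm_num)]; linarith
    linarith
  unfold rsT
  rw [Complex.norm_exp, ← Real.exp_add, ← hL]
  refine Real.exp_le_exp.2 ?_
  have e1 : (-(1/2 + I * ((2 * π * α^2 : ℝ) : ℂ)) * L + 2 * π * I * α * rsy b p + π * I * (rsy b p)^2).re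
      = -(L.re)/2 + 2 * π * (α^2 * L.im) - 2 * π * (p * (α + b + p)) := by
    unfold rsy
    simp only [sq, Complex.add_re, Complex.mul_re, Complex.neg_re, Complex.add_im, Complex.mul_im, Complex.neg_im, Complex.ofReal_re, Complex.ofReal_im, Complex.I_re, Complex.I_im, Complex.one_re, Complex.one_im, Complex.re_ofNat, Complex.im_ofNat]
    norm_num
    ring
  rw [e1]
  set lam := α/(α + b) with hlam
  have hl1 : α = lam * (α + b) := by rw [hlam]; field_simp
  have hpP : p = P * (α + b) := by rw [hP]; field_simp
  have hl2 : lam ≤ 3/2 := by rw [hlam, div_le_iff₀ hc0]; linarith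
  have hl3 : 0 < lam := by positivity
  have hmu : (lam^2 - 1) * (α + b) = -b * (lam + 1) := by
    have : lam * (α + b) = α := hl1.symm
    linear_combination (lam + 1) * this
  have key : α^2 * L.im - p * (α + b + p) ≤ 2 - p^2/6 := by
    have h1 := mul_le_mul_of_nonneg_left him (sq_nonneg α)
    have h2 : α^2 * (P + P^2/4) = lam^2 * (α + b) * p + lam^2 * p^2/4 := by
      rw [hpP]; nth_rw 1 [hl1]; ring
    have h3 : lam^2 * (α + b) * p = (α + b) * p + -b * (lam + 1) * p := by
      linear_combination p * hmu
    have h4 : -b * (lam + 1) * p ≤ 5/4 * |p| := by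
      have h5 : |-b * (lam + 1)| ≤ 5/4 := by
        rw [abs_mul, abs_neg, abs_of_pos (by linarith : 0 < lam + 1)]
        calc |b| * (lam + 1) ≤ 1/2 * (5/2) := mul_le_mul hb (by linarith) (by linarith) (by norm_num)
          _ = 5/4 := by norm_num
      calc _ ≤ |-b * (lam + 1) * p| := le_abs_self _
        _ = |-b * (lam + 1)| * |p| := abs_mul _ _
        _ ≤ _ := mul_le_mul_of_nonneg_right h5 (abs_nonneg _)
    have h5 : lam^2 * p^2/4 ≤ 9/16 * p^2 := by
      have : lam^2 ≤ 9/4 := by nlinarith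
      nlinarith [sq_nonneg p]
    have h6 : p^2 = |p|^2 := (sq_abs p).symm
    nlinarith [sq_nonneg (|p| - 5/2), abs_nonneg p]
  have hpi := Real.pi_gt_three
  have := mul_le_mul_of_nonneg_left key (show 0 ≤ 2 * π by linarith)
  nlinarith [sq_nonneg p]

lemma rsT_near (α b p : ℝ) (hα : 0 < α) :
    rsT α b p = Complex.exp (2 * π * I * (rsy b p)^2) * rsF (-2 * π * I * (rsy b p)^2) (rsy b p / α) := by
  have h1 : (α:ℂ) ≠ 0 := by exact_mod_cast hα.ne'
  unfold rsT rsF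
  rw [← Complex.exp_add]
  congr 1
  set ω := rsy b p / α with hω
  have hy : rsy b p = α * ω := by rw [hω]; field_simp
  have hg : rsg ω * ω^2 = Complex.log (1 + ω) - ω + ω^2/2 := by
    unfold rsg
    by_cases h0 : ω = 0
    · simp [h0]
    · field_simp
  rw [hy]
  push_cast
  linear_combination (2 * π * I * α^2) * hg

lemma rs_w_norm (b p : ℝ) : ‖-2 * π * I * (rsy b p)^2‖ = 2 * π * ((b + p)^2 + p^2) := by
  rw [norm_mul, norm_pow]
  have h1 : ‖(-2 * π * I : ℂ)‖ = 2 * π := by simp [abs_of_pos Real.pi_pos]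
  have h2 : ‖rsy b p‖^2 = (b + p)^2 + p^2 := by
    rw [← Complex.normSq_eq_norm_sq, Complex.normSq_apply]
    simp [rsy]; ring
  rw [h1, h2]

lemma rs_gauss_w (b p : ℝ) (hb : |b| ≤ 1/2) :
    ‖Complex.exp (2 * π * I * (rsy b p)^2)‖ * Real.exp (1 + ‖-2 * π * I * (rsy b p)^2‖/3) ≤ Real.exp (1 + 4 * π) * Real.exp (-p^2) := by
  rw [rs_w_norm, Complex.norm_exp, ← Real.exp_add, ← Real.exp_add]
  refine Real.exp_le_exp.2 ?_
  have e1 : (2 * π * I * (rsy b p)^2).re = - 2 * π * (2 * (b + p) * p) := by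
    unfold rsy
    simp only [sq, Complex.add_re, Complex.mul_re, Complex.add_im, Complex.mul_im, Complex.ofReal_re, Complex.ofReal_im, Complex.I_re, Complex.I_im, Complex.one_re, Complex.one_im, Complex.re_ofNat, Complex.im_ofNat]
    ring
  rw [e1]
  obtain ⟨hb1, hb2⟩ := abs_le.1 hb
  have key : -(2 * (b + p) * p) + ((b + p)^2 + p^2)/3 ≤ 2 - p^2/6 := by
    have h4 : -b * p ≤ 1/2 * |p| := by
      calc _ ≤ |-b * p| := le_abs_self _
        _ = |b| * |p| := by rw [abs_mul, abs_neg]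
        _ ≤ _ := mul_le_mul_of_nonneg_right hb (abs_nonneg _)
    have h6 : p^2 = |p|^2 := (sq_abs p).symm
    have h7 : b^2 ≤ 1/4 := by nlinarith
    nlinarith [sq_nonneg (|p| - 1/2), abs_nonneg p]
  have hpi := Real.pi_gt_three
  have := mul_le_mul_of_nonneg_left key (show 0 ≤ 2 * π by linarith)
  nlinarith [sq_nonneg p]


lemma rsy_norm (b p : ℝ) (hb : |b| ≤ 1/2) : ‖rsy b p‖ ≤ 1 + 2 * |p| := by
  unfold rsy
  refine (norm_add_le _ _).trans ?_
  rw [norm_mul, Complex.norm_real, Complex.norm_real, Real.norm_eq_abs, Real.norm_eq_abs]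
  have : ‖(1 + I : ℂ)‖ ≤ 2 := (norm_add_le _ _).trans (by simp; norm_num)
  nlinarith [abs_nonneg p]

lemma rsy_cont (b : ℝ) : Continuous (rsy b) := by unfold rsy; fun_prop

def rsW (m : ℕ) (p : ℝ) : ℝ := (1 + 2 * |p|)^m * Real.exp (-p^2)

lemma rsW_cont (m : ℕ) : Continuous (rsW m) := by unfold rsW; fun_prop

lemma rsW_nonneg (m : ℕ) (p : ℝ) : 0 ≤ rsW m p := by unfold rsW; positivity

lemma rsW_int (m : ℕ) : Integrable (rsW m) := by
  refine Integrable.mono' (g := fun p => (m.factorial * Real.exp 1 * (2 * Real.exp (2^2/2))) * (1 + p^2)⁻¹)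
    (integrable_inv_one_add_sq.const_mul _) (rsW_cont m).aestronglyMeasurable (Filter.Eventually.of_forall fun p => ?_)
  rw [Real.norm_of_nonneg (rsW_nonneg m p)]
  have h1 := Real.pow_div_factorial_le_exp (1 + 2 * |p|) (by positivity) m
  rw [div_le_iff₀ (by positivity)] at h1
  unfold rsW
  calc _ ≤ (Real.exp (1 + 2 * |p|) * m.factorial) * Real.exp (-p^2) := by gcongr
    _ = m.factorial * Real.exp 1 * Real.exp (-p^2 + 2 * |p|) := by
      rw [Real.exp_add, Real.exp_add]; ring
    _ ≤ m.factorial * Real.exp 1 * (2 * Real.exp (2^2/2) * (1 + p^2)⁻¹) := by gcongr; exact rs_gauss 2 p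
    _ = _ := by ring

lemma rsT_cont (α b : ℝ) (hα : 0 < α) (hc : 0 < α + b) : Continuous (rsT α b) := by
  have h1 : (α:ℂ) ≠ 0 := by exact_mod_cast hα.ne'
  have hy := rsy_cont b
  have hl : Continuous (fun p => Complex.log (1 + rsy b p / α)) := by
    refine Continuous.clog (by fun_prop) (fun p => ?_)
    have e1 : ((α + b : ℝ):ℂ) + (1 + I) * p = (1 + rsy b p / α) * α := by
      unfold rsy; push_cast; field_simp; ring
    refine rs_slit ?_ ?_
    · have := rsT_scale α b p hα hc
      rw [this]
      have h2 : 0 < (α + b)/α := by positivity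
      generalize (α + b)/α = r at h2
      generalize p/(α + b) = q
      simp
      nlinarith
    · intro h
      rw [h, zero_mul] at e1
      exact rs_x_ne (α + b) p hc e1
  unfold rsT
  fun_prop

def rsMi (m : ℕ) (b p : ℝ) : ℂ := Complex.exp (2 * π * I * (rsy b p)^2) * (rsc m (-2 * π * I * (rsy b p)^2) * (rsy b p)^m)

lemma rsMi_cont (m : ℕ) (b : ℝ) : Continuous (rsMi m b) := by
  have hy := rsy_cont b
  have := rsc_cont m
  unfold rsMi
  fun_prop

def rsB : ℝ := Real.exp (1 + 4 * π)

lemma rsB_pos : 0 < rsB := Real.exp_pos _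

lemma rsMi_bound0 (m : ℕ) (b p : ℝ) (hb : |b| ≤ 1/2) :
    ‖Complex.exp (2 * π * I * (rsy b p)^2)‖ * ‖rsc m (-2 * π * I * (rsy b p)^2)‖ ≤ 2^m * rsB * Real.exp (-p^2) := by
  calc _ ≤ ‖Complex.exp (2 * π * I * (rsy b p)^2)‖ * (2^m * Real.exp (1 + ‖-2 * π * I * (rsy b p)^2‖/3)) := by
        gcongr; exact rsc_bound _ _
    _ = 2^m * (‖Complex.exp (2 * π * I * (rsy b p)^2)‖ * Real.exp (1 + ‖-2 * π * I * (rsy b p)^2‖/3)) := by ring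
    _ ≤ 2^m * (Real.exp (1 + 4 * π) * Real.exp (-p^2)) := mul_le_mul_of_nonneg_left (rs_gauss_w b p hb) (by positivity)
    _ = _ := by rw [rsB]; ring

lemma rsMi_bound (m : ℕ) (b p : ℝ) (hb : |b| ≤ 1/2) : ‖rsMi m b p‖ ≤ 2^m * rsB * rsW m p := by
  unfold rsMi rsW
  rw [norm_mul, norm_mul, ← mul_assoc, norm_pow]
  calc _ ≤ (2^m * rsB * Real.exp (-p^2)) * (1 + 2 * |p|)^m := by
        exact mul_le_mul (rsMi_bound0 m b p hb) (pow_le_pow_left₀ (norm_nonneg _) (rsy_norm b p hb) m) (by positivity) (by have := rsB_pos; positivity)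
    _ = _ := by ring

lemma rsT_expand (N : ℕ) (α b p : ℝ) (hα : 1 ≤ α) (hb : |b| ≤ 1/2) (hc : 1 ≤ α + b) :
    ‖rsT α b p - ∑ m ∈ Finset.range N, rsMi m b p * ((α:ℂ)⁻¹)^m‖ ≤ (rsB * (2^(N+1) + 4^N + ∑ m ∈ Finset.range N, 2^m * 4^N)) * (α⁻¹^N * rsW N p) := by
  have hα0 : 0 < α := by linarith
  have hB := rsB_pos
  set ω : ℂ := rsy b p / α with hω
  have e1 : ∑ m ∈ Finset.range N, rsMi m b p * ((α:ℂ)⁻¹)^m = Complex.exp (2 * π * I * (rsy b p)^2) * ∑ m ∈ Finset.range N, rsc m (-2 * π * I * (rsy b p)^2) * ω^m := by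
    rw [Finset.mul_sum]
    refine Finset.sum_congr rfl fun m _ => ?_
    rw [rsMi, hω, div_eq_mul_inv, mul_pow]; ring
  have hωn : ‖ω‖^N * Real.exp (-p^2) ≤ α⁻¹^N * rsW N p := by
    rw [hω, norm_div, Complex.norm_real, Real.norm_of_nonneg hα0.le, div_eq_mul_inv, mul_pow, rsW]
    have := pow_le_pow_left₀ (norm_nonneg _) (rsy_norm b p hb) N
    calc _ ≤ (1 + 2 * |p|)^N * α⁻¹^N * Real.exp (-p^2) := by gcongr
      _ = _ := by ring
  refine le_trans ?_ (mul_le_mul_of_nonneg_left hωn (by positivity))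
  rw [e1]
  have hsum0 : 0 ≤ ∑ m ∈ Finset.range N, (2:ℝ)^m * 4^N := by positivity
  rcases le_or_gt ‖ω‖ (1/4) with h | h
  · rw [rsT_near α b p hα0, ← mul_sub, norm_mul, ← hω]
    calc _ ≤ ‖Complex.exp (2 * π * I * (rsy b p)^2)‖ * (2^(N+1) * Real.exp (1 + ‖-2 * π * I * (rsy b p)^2‖/3) * ‖ω‖^N) := by
          gcongr; exact rsF_taylor N _ ω h
      _ = (2^(N+1) * ‖ω‖^N) * (‖Complex.exp (2 * π * I * (rsy b p)^2)‖ * Real.exp (1 + ‖-2 * π * I * (rsy b p)^2‖/3)) := by ring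
      _ ≤ (2^(N+1) * ‖ω‖^N) * (Real.exp (1 + 4 * π) * Real.exp (-p^2)) := mul_le_mul_of_nonneg_left (rs_gauss_w b p hb) (by positivity)
      _ = (rsB * (2^(N+1) + 0 + 0)) * (‖ω‖^N * Real.exp (-p^2)) := by rw [rsB]; ring
      _ ≤ _ := by gcongr; positivity
  · have h4 : 1 ≤ 4 * ‖ω‖ := by linarith
    have hpow : ∀ m ≤ N, ‖ω‖^m ≤ 4^N * ‖ω‖^N := by
      intro m hm
      rw [← mul_pow]
      calc ‖ω‖^m ≤ (4 * ‖ω‖)^m := by gcongr; linarith [norm_nonneg ω]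
        _ ≤ _ := pow_le_pow_right₀ h4 hm
    refine (norm_sub_le _ _).trans ?_
    have a1 : ‖rsT α b p‖ ≤ rsB * 4^N * (‖ω‖^N * Real.exp (-p^2)) := by
      calc _ ≤ rsB * Real.exp (-p^2) * 1 := by rw [mul_one]; exact rsT_bound α b p hα hb hc
        _ ≤ rsB * Real.exp (-p^2) * (4^N * ‖ω‖^N) := by
          gcongr
          have := hpow 0 (Nat.zero_le _); simpa using this
        _ = _ := by ring
    have a2 : ‖Complex.exp (2 * π * I * (rsy b p)^2) * ∑ m ∈ Finset.range N, rsc m (-2 * π * I * (rsy b p)^2) * ω^m‖ ≤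
        rsB * (∑ m ∈ Finset.range N, 2^m * 4^N) * (‖ω‖^N * Real.exp (-p^2)) := by
      rw [Finset.mul_sum, Finset.mul_sum, Finset.sum_mul]
      refine (norm_sum_le _ _).trans (Finset.sum_le_sum fun m hm => ?_)
      rw [norm_mul, norm_mul, ← mul_assoc, norm_pow]
      calc _ ≤ (2^m * rsB * Real.exp (-p^2)) * (4^N * ‖ω‖^N) := by
            exact mul_le_mul (rsMi_bound0 m b p hb) (hpow m (Finset.mem_range.1 hm).le) (by positivity) (by have := rsB_pos; positivity)
        _ = _ := by ring
    have a3 : 0 ≤ rsB * 2^(N+1) * (‖ω‖^N * Real.exp (-p^2)) := by positivity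
    calc _ ≤ _ := add_le_add a1 a2
      _ ≤ _ := by linarith

def rsM (φ : ℝ → ℂ) (m : ℕ) (b : ℝ) : ℂ := ∫ p : ℝ, rsMi m b p * φ p

lemma rsMi_int (φ : ℝ → ℂ) (hφ : Continuous φ) (h1 : ∀ p, ‖φ p‖ ≤ 1) (m : ℕ) (b : ℝ) (hb : |b| ≤ 1/2) :
    Integrable (fun p => rsMi m b p * φ p) := by
  refine Integrable.mono' ((rsW_int m).const_mul (2^m * rsB)) ((rsMi_cont m b).mul hφ).aestronglyMeasurable
    (Filter.Eventually.of_forall fun p => ?_)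
  rw [norm_mul]
  calc _ ≤ ‖rsMi m b p‖ * 1 := by gcongr; exact h1 p
    _ ≤ _ := by rw [mul_one]; exact rsMi_bound m b p hb

lemma rsT_int (φ : ℝ → ℂ) (hφ : Continuous φ) (h1 : ∀ p, ‖φ p‖ ≤ 1) (α b : ℝ) (hα : 1 ≤ α) (hb : |b| ≤ 1/2) (hc : 1 ≤ α + b) :
    Integrable (fun p => rsT α b p * φ p) := by
  refine Integrable.mono' ((rsW_int 0).const_mul rsB) ((rsT_cont α b (by linarith) (by linarith)).mul hφ).aestronglyMeasurable
    (Filter.Eventually.of_forall fun p => ?_)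
  rw [norm_mul]
  calc _ ≤ ‖rsT α b p‖ * 1 := by gcongr; exact h1 p
    _ ≤ _ := by rw [mul_one, rsW, pow_zero, one_mul]; exact rsT_bound α b p hα hb hc

lemma rsM_bound (φ : ℝ → ℂ) (h1 : ∀ p, ‖φ p‖ ≤ 1) (m : ℕ) :
    ∃ K : ℝ, ∀ b, |b| ≤ 1/2 → ‖rsM φ m b‖ ≤ K := by
  refine ⟨∫ p, 2^m * rsB * rsW m p, fun b hb => ?_⟩
  refine norm_integral_le_of_norm_le ((rsW_int m).const_mul (2^m * rsB)) (Filter.Eventually.of_forall fun p => ?_)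
  rw [norm_mul]
  calc _ ≤ ‖rsMi m b p‖ * 1 := by gcongr; exact h1 p
    _ ≤ _ := by rw [mul_one]; exact rsMi_bound m b p hb

lemma rs_expand (φ : ℝ → ℂ) (hφ : Continuous φ) (h1 : ∀ p, ‖φ p‖ ≤ 1) (N : ℕ) :
    ∃ K : ℝ, ∀ α b : ℝ, 1 ≤ α → |b| ≤ 1/2 → 1 ≤ α + b →
      ‖(∫ p : ℝ, rsT α b p * φ p) - ∑ m ∈ Finset.range N, rsM φ m b * ((α:ℂ)⁻¹)^m‖ ≤ K * α⁻¹^N := by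
  set K0 := (rsB * (2^(N+1) + 4^N + ∑ m ∈ Finset.range N, 2^m * 4^N)) with hK0
  refine ⟨K0 * ∫ p, rsW N p, fun α b hα hb hc => ?_⟩
  have e1 : (∫ p : ℝ, rsT α b p * φ p) - ∑ m ∈ Finset.range N, rsM φ m b * ((α:ℂ)⁻¹)^m =
      ∫ p : ℝ, (rsT α b p - ∑ m ∈ Finset.range N, rsMi m b p * ((α:ℂ)⁻¹)^m) * φ p := by
    have hi : ∀ m ∈ Finset.range N, Integrable (fun p => rsMi m b p * φ p * ((α:ℂ)⁻¹)^m) := fun m _ =>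
      (rsMi_int φ hφ h1 m b hb).mul_const _
    have e2 : ∑ m ∈ Finset.range N, rsM φ m b * ((α:ℂ)⁻¹)^m = ∫ p, ∑ m ∈ Finset.range N, rsMi m b p * φ p * ((α:ℂ)⁻¹)^m := by
      rw [integral_finsetSum _ hi]
      refine Finset.sum_congr rfl fun m _ => ?_
      rw [integral_mul_const]; rfl
    rw [e2, ← integral_sub (rsT_int φ hφ h1 α b hα hb hc) (integrable_finsetSum _ hi)]
    congr 1; funext p
    rw [sub_mul, Finset.sum_mul]
    congr 1
    exact Finset.sum_congr rfl fun m _ => by ring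
  rw [e1]
  have := norm_integral_le_of_norm_le (μ := volume) (f := fun p => (rsT α b p - ∑ m ∈ Finset.range N, rsMi m b p * ((α:ℂ)⁻¹)^m) * φ p)
    ((rsW_int N).const_mul (K0 * α⁻¹^N)) (Filter.Eventually.of_forall fun p => ?_)
  · refine this.trans (le_of_eq ?_)
    rw [integral_const_mul]; ring
  · rw [norm_mul]
    calc _ ≤ ‖(rsT α b p - ∑ m ∈ Finset.range N, rsMi m b p * ((α:ℂ)⁻¹)^m)‖ * 1 := by gcongr; exact h1 p
      _ ≤ _ := by rw [mul_one]; exact (rsT_expand N α b p hα hb hc).trans (le_of_eq (by ring))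


inductive rsHE (N : ℕ) : (ℝ → ℂ) → Prop
  | mono (c : ℝ → ℂ) (m : ℕ) (B : ℝ) (hc : ∀ a, 0 ≤ a → a < 1 → ‖c a‖ ≤ B) :
      rsHE N (fun α => c (Int.fract α) * ((α:ℂ)⁻¹)^m)
  | err (f : ℝ → ℂ) (K : ℝ) (h : ∀ α, 1 ≤ α → ‖f α‖ ≤ K * α⁻¹^N) : rsHE N f
  | add (f g : ℝ → ℂ) (hf : rsHE N f) (hg : rsHE N g) : rsHE N (fun α => f α + g α)

lemma rs_inv_norm (α : ℝ) (h : 1 ≤ α) (m : ℕ) : ‖((α:ℂ)⁻¹)^m‖ = α⁻¹^m := by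
  rw [norm_pow, norm_inv, Complex.norm_real, Real.norm_of_nonneg (by linarith)]

lemma rs_inv_le (α : ℝ) (h : 1 ≤ α) {m n : ℕ} (hmn : n ≤ m) : α⁻¹^m ≤ α⁻¹^n :=
  pow_le_pow_of_le_one (inv_nonneg.2 (by linarith)) (inv_le_one_of_one_le₀ h) hmn

lemma rs_inv_le1 (α : ℝ) (h : 1 ≤ α) (m : ℕ) : α⁻¹^m ≤ 1 :=
  pow_le_one₀ (inv_nonneg.2 (by linarith)) (inv_le_one_of_one_le₀ h)

lemma rsHE.congr {N : ℕ} {f g : ℝ → ℂ} (hf : rsHE N f) (h : ∀ α, 1 ≤ α → f α = g α) : rsHE N g := by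
  have : g = fun α => f α + (g α - f α) := by funext α; ring
  rw [this]
  exact rsHE.add _ _ hf (rsHE.err _ 0 fun α hα => by rw [h α hα]; simp)

lemma rsHE.bdd {N : ℕ} {f : ℝ → ℂ} (hf : rsHE N f) : ∃ K, ∀ α, 1 ≤ α → ‖f α‖ ≤ K := by
  induction hf with
  | mono c m B hc =>
    refine ⟨B, fun α hα => ?_⟩
    have h1 := hc (Int.fract α) (Int.fract_nonneg _) (Int.fract_lt_one _)
    rw [norm_mul, rs_inv_norm α hα]
    calc _ ≤ ‖c (Int.fract α)‖ * 1 := mul_le_mul_of_nonneg_left (rs_inv_le1 α hα m) (norm_nonneg _)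
      _ ≤ B := by rwa [mul_one]
  | err f K h =>
    refine ⟨|K|, fun α hα => (h α hα).trans ?_⟩
    have h0 : 0 ≤ α⁻¹^N := pow_nonneg (inv_nonneg.2 (by linarith)) _
    calc K * α⁻¹^N ≤ |K| * α⁻¹^N := mul_le_mul_of_nonneg_right (le_abs_self K) h0
      _ ≤ |K| * 1 := mul_le_mul_of_nonneg_left (rs_inv_le1 α hα N) (abs_nonneg _)
      _ = _ := mul_one _
  | add f g _ _ h1 h2 =>
    obtain ⟨K1, h1⟩ := h1
    obtain ⟨K2, h2⟩ := h2
    exact ⟨K1 + K2, fun α hα => (norm_add_le _ _).trans (add_le_add (h1 α hα) (h2 α hα))⟩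

lemma rsHE.err_mul {N : ℕ} {f g : ℝ → ℂ} (K : ℝ) (h : ∀ α, 1 ≤ α → ‖f α‖ ≤ K * α⁻¹^N) (hg : rsHE N g) :
    rsHE N (fun α => f α * g α) := by
  obtain ⟨B, hB⟩ := hg.bdd
  refine rsHE.err _ (K * B) fun α hα => ?_
  rw [norm_mul]
  calc _ ≤ (K * α⁻¹^N) * B := mul_le_mul (h α hα) (hB α hα) (norm_nonneg _) ((norm_nonneg _).trans (h α hα))
    _ = _ := by ring

lemma rsHE.mul {N : ℕ} {f g : ℝ → ℂ} (hf : rsHE N f) (hg : rsHE N g) : rsHE N (fun α => f α * g α) := by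
  induction hf with
  | mono c m B hc =>
    have hf := rsHE.mono (N := N) c m B hc
    induction hg with
    | mono c' m' B' hc' =>
      refine (rsHE.mono (fun a => c a * c' a) (m + m') (B * B') fun a h0 h1 => ?_).congr fun α _ => ?_
      · rw [norm_mul]
        exact mul_le_mul (hc a h0 h1) (hc' a h0 h1) (norm_nonneg _) ((norm_nonneg _).trans (hc a h0 h1))
      · rw [pow_add]; ring
    | err f K h => exact (rsHE.err_mul K h hf).congr fun α _ => mul_comm _ _
    | add f g _ _ h1 h2 => exact (rsHE.add _ _ h1 h2).congr fun α _ => by ring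
  | err f K h => exact rsHE.err_mul K h hg
  | add f g _ _ h1 h2 => exact (rsHE.add _ _ h1 h2).congr fun α _ => by ring

lemma rsHE.conj {N : ℕ} {f : ℝ → ℂ} (hf : rsHE N f) : rsHE N (fun α => (starRingEnd ℂ) (f α)) := by
  induction hf with
  | mono c m B hc =>
    refine (rsHE.mono (fun a => (starRingEnd ℂ) (c a)) m B fun a h0 h1 => ?_).congr fun α _ => ?_
    · rw [RCLike.norm_conj]; exact hc a h0 h1
    · simp
  | err f K h => exact rsHE.err _ K fun α hα => by rw [RCLike.norm_conj]; exact h α hα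
  | add f g _ _ h1 h2 => exact (rsHE.add _ _ h1 h2).congr fun α _ => by simp

lemma rsHE.const (N : ℕ) (z : ℂ) : rsHE N (fun _ => z) :=
  (rsHE.mono (fun _ => z) 0 ‖z‖ fun _ _ _ => le_rfl).congr fun α _ => by simp

lemma rsHE.pow {N : ℕ} {f : ℝ → ℂ} (hf : rsHE N f) (k : ℕ) : rsHE N (fun α => f α ^ k) := by
  induction k with
  | zero => exact (rsHE.const N 1).congr fun α _ => by simp
  | succ k ih => exact (ih.mul hf).congr fun α _ => by rw [pow_succ]

lemma rsHE.sum {N : ℕ} {F : ℕ → ℝ → ℂ} (hf : ∀ k, rsHE N (F k)) (M : ℕ) :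
    rsHE N (fun α => ∑ k ∈ Finset.range M, F k α) := by
  induction M with
  | zero => exact (rsHE.const N 0).congr fun α _ => by simp
  | succ k ih => exact (rsHE.add _ _ ih (hf k)).congr fun α _ => by rw [Finset.sum_range_succ]

lemma rsHE.extract {N : ℕ} {f : ℝ → ℂ} (hf : rsHE N f) : ∃ (c : ℕ → ℝ → ℂ) (K : ℝ), ∀ α, 1 ≤ α →
    ‖f α - ∑ m ∈ Finset.range N, c m (Int.fract α) * ((α:ℂ)⁻¹)^m‖ ≤ K * α⁻¹^N := by
  induction hf with
  | mono c m B hc =>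
    by_cases hm : m < N
    · refine ⟨fun k => if k = m then c else 0, 0, fun α hα => ?_⟩
      rw [Finset.sum_eq_single m]
      · simp
      · intro k _ hk; simp [hk]
      · intro h; exact absurd (Finset.mem_range.2 hm) h
    · refine ⟨fun _ _ => 0, B, fun α hα => ?_⟩
      simp only [zero_mul, Finset.sum_const_zero, sub_zero]
      have h1 := hc (Int.fract α) (Int.fract_nonneg _) (Int.fract_lt_one _)
      rw [norm_mul, rs_inv_norm α hα]
      exact mul_le_mul h1 (rs_inv_le α hα (not_lt.1 hm)) (pow_nonneg (inv_nonneg.2 (by linarith)) _) ((norm_nonneg _).trans h1)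
  | err f K h => exact ⟨fun _ _ => 0, K, fun α hα => by simpa using h α hα⟩
  | add f g _ _ h1 h2 =>
    obtain ⟨c1, K1, h1⟩ := h1
    obtain ⟨c2, K2, h2⟩ := h2
    refine ⟨fun m a => c1 m a + c2 m a, K1 + K2, fun α hα => ?_⟩
    have e : f α + g α - ∑ m ∈ Finset.range N, (c1 m (Int.fract α) + c2 m (Int.fract α)) * ((α:ℂ)⁻¹)^m
      = (f α - ∑ m ∈ Finset.range N, c1 m (Int.fract α) * ((α:ℂ)⁻¹)^m) + (g α - ∑ m ∈ Finset.range N, c2 m (Int.fract α) * ((α:ℂ)⁻¹)^m) := by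
      simp only [add_mul, Finset.sum_add_distrib]; ring
    rw [e, add_mul]
    exact (norm_add_le _ _).trans (add_le_add (h1 α hα) (h2 α hα))

lemma rs_isqrt (N : ℕ) : ∃ (β : ℕ → ℂ) (C r : ℝ), 0 < r ∧ 0 ≤ C ∧ ∀ z : ℂ, ‖z‖ ≤ r →
    ‖(1 + z)^(-(1/2) : ℂ) - ∑ k ∈ Finset.range N, β k * z^k‖ ≤ C * ‖z‖^N := by
  have hA : AnalyticAt ℂ (fun z : ℂ => (1 + z)^(-(1/2) : ℂ)) 0 := by
    refine AnalyticAt.cpow (by fun_prop) (by fun_prop) (by simp)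
  obtain ⟨p, hp⟩ := hA
  have h := hp.isBigO_sub_partialSum_pow N
  obtain ⟨C, hC0, hC⟩ := h.exists_nonneg
  rw [Asymptotics.isBigOWith_iff] at hC
  obtain ⟨r, hr, hC⟩ := Metric.eventually_nhds_iff.1 hC
  refine ⟨fun k => p.coeff k, C, r/2, by positivity, hC0, fun z hz => ?_⟩
  have := hC (y := z) (by simp; linarith)
  simp only [zero_add, FormalMultilinearSeries.partialSum, FormalMultilinearSeries.apply_eq_pow_smul_coeff, smul_eq_mul, norm_pow, norm_norm] at this
  refine le_trans (le_of_eq ?_) this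
  congr 2
  exact Finset.sum_congr rfl fun k _ => mul_comm _ _

/- the unit phase of D -/
lemma rsHE.unit {N : ℕ} {D : ℝ → ℂ} (hD : rsHE N D) (d : ℂ) (hd : d ≠ 0) (K : ℝ)
    (h1 : ∀ α, 1 ≤ α → ‖D α - d‖ ≤ K * α⁻¹) : rsHE N (fun α => (starRingEnd ℂ) (D α) / (‖D α‖ : ℂ)) := by
  obtain ⟨β, C, r, hr, hC, hβ⟩ := rs_isqrt N
  set g : ℝ → ℂ := fun α => D α * (starRingEnd ℂ) (D α) * ((‖d‖:ℂ)^2)⁻¹ + -1 with hg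
  have hdn : (0:ℝ) < ‖d‖ := norm_pos_iff.2 hd
  have hgH : rsHE N g := rsHE.add _ _ ((hD.mul hD.conj).mul (rsHE.const N _)) (rsHE.const N _)
  have hgr : ∀ α, g α = ((‖D α‖^2/‖d‖^2 - 1 : ℝ) : ℂ) := fun α => by
    simp only [hg, Complex.mul_conj, Complex.normSq_eq_norm_sq]
    push_cast
    ring
  obtain ⟨B, hB⟩ := hD.bdd
  have hK : 0 ≤ K := by
    have := (norm_nonneg _).trans (h1 1 le_rfl); simpa using this
  have hB0 : 0 ≤ B := (norm_nonneg _).trans (hB 1 le_rfl)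
  set K' := K * (B + ‖d‖) / ‖d‖^2 with hK'
  have hK'0 : 0 ≤ K' := by positivity
  have hgb : ∀ α, 1 ≤ α → ‖g α‖ ≤ K' * α⁻¹ := fun α hα => by
    rw [hgr, Complex.norm_real, Real.norm_eq_abs]
    have e : ‖D α‖^2/‖d‖^2 - 1 = (‖D α‖ - ‖d‖) * (‖D α‖ + ‖d‖)/‖d‖^2 := by field_simp; ring
    rw [e, abs_div, abs_mul, abs_of_nonneg (by positivity : 0 ≤ ‖D α‖ + ‖d‖), abs_of_nonneg (by positivity : 0 ≤ ‖d‖^2)]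
    have h2 := (abs_norm_sub_norm_le (D α) d).trans (h1 α hα)
    have h3 : α⁻¹ ≥ 0 := inv_nonneg.2 (by linarith)
    calc _ ≤ (K * α⁻¹) * (B + ‖d‖) / ‖d‖^2 := by
          gcongr
          exact hB α hα
      _ = _ := by rw [hK']; ring
  set S : ℝ → ℂ := fun α => ∑ k ∈ Finset.range N, β k * (g α)^k with hS
  have hSH : rsHE N S := rsHE.sum (F := fun k α => β k * (g α)^k) (fun k => (rsHE.const N (β k)).mul (hgH.pow k)) N
  set P : ℝ → ℂ := fun α => (starRingEnd ℂ) (D α) * ((‖d‖:ℂ)⁻¹ * S α) with hP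
  have hPH : rsHE N P := hD.conj.mul ((rsHE.const N _).mul hSH)
  obtain ⟨BP, hBP⟩ := hPH.bdd
  have hBP0 : 0 ≤ BP := (norm_nonneg _).trans (hBP 1 le_rfl)
  set A : ℝ := 1 + K'/r with hA
  have hA1 : 0 < A := by positivity
  have hU : ∀ α, ‖(starRingEnd ℂ) (D α) / (‖D α‖ : ℂ)‖ ≤ 1 := fun α => by
    rw [norm_div, RCLike.norm_conj, Complex.norm_real, norm_norm]
    exact div_self_le_one _
  have hE : rsHE N (fun α => (starRingEnd ℂ) (D α) / (‖D α‖ : ℂ) - P α) := by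
    refine rsHE.err _ ((1 + BP) * A^N + B * ‖d‖⁻¹ * (C * K'^N)) fun α hα => ?_
    have hα0 : 0 < α := by linarith
    have t1 : 0 ≤ (1 + BP) * A^N * α⁻¹^N := by positivity
    have t2 : 0 ≤ B * ‖d‖⁻¹ * (C * K'^N) * α⁻¹^N := by positivity
    rcases le_or_gt α A with h | h
    · have h2 : 1 ≤ A^N * α⁻¹^N := by
        rw [← mul_pow]
        refine one_le_pow₀ ?_
        rw [← div_eq_mul_inv, le_div_iff₀ hα0]; linarith
      have h3 : ‖(starRingEnd ℂ) (D α) / (‖D α‖ : ℂ) - P α‖ ≤ 1 + BP :=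
        (norm_sub_le _ _).trans (add_le_add (hU α) (hBP α hα))
      calc _ ≤ (1 + BP) * 1 := by rwa [mul_one]
        _ ≤ (1 + BP) * (A^N * α⁻¹^N) := mul_le_mul_of_nonneg_left h2 (by positivity)
        _ ≤ _ := by linarith
    · have h2 : ‖g α‖ ≤ r := by
        refine (hgb α hα).trans ?_
        rw [← div_eq_mul_inv, div_le_iff₀ hα0]
        have : K'/r ≤ α := by linarith
        rw [div_le_iff₀ hr] at this; linarith
      have h3 := hβ (g α) h2
      have e1 : (1 + g α)^(-(1/2):ℂ) = ((‖D α‖/‖d‖ : ℝ):ℂ)⁻¹ := by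
        have e2 : 1 + g α = ((‖D α‖/‖d‖ : ℝ):ℂ)^2 := by
          rw [hgr]; push_cast; ring
        have e3 : (((‖D α‖/‖d‖)^2 : ℝ))^(-(1/2) : ℝ) = (‖D α‖/‖d‖)⁻¹ := by
          rw [Real.rpow_neg (by positivity), ← Real.sqrt_eq_rpow, Real.sqrt_sq (by positivity)]
        rw [e2, ← Complex.ofReal_inv, ← e3, Complex.ofReal_cpow (by positivity)]
        push_cast; rfl
      have e2 : (starRingEnd ℂ) (D α) / (‖D α‖ : ℂ) - P α =
          (starRingEnd ℂ) (D α) * (‖d‖:ℂ)⁻¹ * ((1 + g α)^(-(1/2):ℂ) - S α) := by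
        have hdc : (‖d‖:ℂ) ≠ 0 := by exact_mod_cast hdn.ne'
        rw [e1, hP]
        push_cast
        rw [inv_div]
        field_simp
      rw [e2, norm_mul, norm_mul, RCLike.norm_conj, norm_inv, Complex.norm_real, norm_norm]
      calc _ ≤ B * ‖d‖⁻¹ * (C * ‖g α‖^N) := by
            gcongr
            exact hB α hα
        _ ≤ B * ‖d‖⁻¹ * (C * (K' * α⁻¹)^N) := by
            gcongr
            exact hgb α hα
        _ = B * ‖d‖⁻¹ * (C * K'^N) * α⁻¹^N := by rw [mul_pow]; ring
        _ ≤ _ := by linarith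
  exact (rsHE.add _ _ hPH hE).congr fun α _ => by ring


def rsV (α : ℝ) : ℂ := ∫ p : ℝ, rsT α (1/2 - Int.fract α) p * (Complex.cos (π * (1 + I) * p))⁻¹

def rsD (α : ℝ) : ℂ := ∫ p : ℝ, rsT α 0 p * 1

def rsMu (α : ℝ) : ℂ := (1 + I * (Real.exp (-(π * (2 * π * α^2))) : ℝ)) / (‖(1 + I * (Real.exp (-(π * (2 * π * α^2))) : ℝ) : ℂ)‖ : ℂ)

lemma rs_b (a : ℝ) (h0 : 0 ≤ a) (h1 : a < 1) : |1/2 - a| ≤ 1/2 := by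
  rw [abs_le]; constructor <;> linarith

lemma rs_c (α : ℝ) (h : 1 ≤ α) : α + (1/2 - Int.fract α) = (⌊α⌋₊ : ℝ) + 1/2 := by
  have h1 := Int.self_sub_fract α
  have h2 := natCast_floor_eq_intCast_floor (R := ℝ) (show (0:ℝ) ≤ α by linarith)
  rw [h2]
  linarith

lemma rs_c1 (α : ℝ) (h : 1 ≤ α) : 1 ≤ α + (1/2 - Int.fract α) := by
  rw [rs_c α h]
  have : 1 ≤ ⌊α⌋₊ := Nat.one_le_floor_iff α |>.2 h
  have : (1:ℝ) ≤ ⌊α⌋₊ := by exact_mod_cast this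
  linarith

lemma rsV_HE (N : ℕ) : rsHE N rsV := by
  obtain ⟨K, hK⟩ := rs_expand (fun p => (Complex.cos (π * (1 + I) * p))⁻¹) rs_cos_cont rs_cos_inv_le N
  have h1 : rsHE N (fun α => ∑ m ∈ Finset.range N, rsM (fun p => (Complex.cos (π * (1 + I) * p))⁻¹) m (1/2 - Int.fract α) * ((α:ℂ)⁻¹)^m) := by
    refine rsHE.sum (F := fun m α => rsM (fun p => (Complex.cos (π * (1 + I) * p))⁻¹) m (1/2 - Int.fract α) * ((α:ℂ)⁻¹)^m) (fun m => ?_) N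
    obtain ⟨B, hB⟩ := rsM_bound (fun p => (Complex.cos (π * (1 + I) * p))⁻¹) rs_cos_inv_le m
    exact rsHE.mono (fun a => rsM (fun p => (Complex.cos (π * (1 + I) * p))⁻¹) m (1/2 - a)) m B fun a h0 h1 => hB _ (rs_b a h0 h1)
  refine (rsHE.add _ _ h1 (rsHE.err (fun α => rsV α - ∑ m ∈ Finset.range N, rsM (fun p => (Complex.cos (π * (1 + I) * p))⁻¹) m (1/2 - Int.fract α) * ((α:ℂ)⁻¹)^m) K fun α hα => ?_)).congr fun α _ => by ring
  exact hK α (1/2 - Int.fract α) hα (rs_b _ (Int.fract_nonneg _) (Int.fract_lt_one _)) (rs_c1 α hα)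

lemma rsD_expand (N : ℕ) : ∃ K : ℝ, ∀ α, 1 ≤ α → ‖rsD α - ∑ m ∈ Finset.range N, rsM (fun _ => 1) m 0 * ((α:ℂ)⁻¹)^m‖ ≤ K * α⁻¹^N := by
  obtain ⟨K, hK⟩ := rs_expand (fun _ => 1) continuous_const (by simp) N
  exact ⟨K, fun α hα => hK α 0 hα (by simp) (by simpa using hα)⟩

lemma rsD_HE (N : ℕ) : rsHE N rsD := by
  obtain ⟨K, hK⟩ := rsD_expand N
  have h1 : rsHE N (fun α => ∑ m ∈ Finset.range N, rsM (fun _ => 1) m 0 * ((α:ℂ)⁻¹)^m) :=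
    rsHE.sum (F := fun m α => rsM (fun _ => 1) m 0 * ((α:ℂ)⁻¹)^m) (fun m =>
      rsHE.mono (fun _ => rsM (fun _ => 1) m 0) m _ fun a h0 h1 => le_rfl) N
  exact (rsHE.add _ _ h1 (rsHE.err (fun α => rsD α - ∑ m ∈ Finset.range N, rsM (fun _ => 1) m 0 * ((α:ℂ)⁻¹)^m) K hK)).congr fun α _ => by ring

lemma rsc_zero (w : ℂ) : rsc 0 w = 1 := by
  have h := rsF_taylor 1 w 0 (by norm_num)
  simp [rsF, rsg] at h
  have := sub_eq_zero.1 h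
  exact this.symm

lemma rs_d0 : rsM (fun _ => 1) 0 0 ≠ 0 := by
  have e : rsM (fun _ => 1) 0 0 = ∫ p : ℝ, ((Real.exp (-(4 * π) * p^2) : ℝ) : ℂ) := by
    unfold rsM
    congr 1; funext p
    rw [rsMi, rsc_zero, rsy]
    simp only [pow_zero, mul_one]
    rw [Complex.ofReal_exp]
    congr 1
    push_cast
    have hI := Complex.I_sq
    linear_combination (2 * π * p^2 * (I + 2)) * hI
  have e2 : ∫ p : ℝ, ((Real.exp (-(4 * π) * p^2) : ℝ) : ℂ) = ((∫ p : ℝ, Real.exp (-(4 * π) * p^2) : ℝ) : ℂ) := integral_ofReal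
  rw [e, e2, integral_gaussian]
  have : 0 < √(π / (4 * π)) := Real.sqrt_pos.2 (by positivity)
  exact_mod_cast this.ne'

lemma rsU_HE (N : ℕ) : rsHE N (fun α => (starRingEnd ℂ) (rsD α) / (‖rsD α‖ : ℂ)) := by
  obtain ⟨K, hK⟩ := rsD_expand 1
  refine (rsD_HE N).unit _ rs_d0 K fun α hα => ?_
  have := hK α hα
  simpa using this

lemma rsMu_HE (N : ℕ) : rsHE N rsMu := by
  refine (rsHE.add _ _ (rsHE.const N 1) (rsHE.err (fun α => rsMu α - 1) (2 * N.factorial) fun α hα => ?_)).congr fun α _ => by ring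
  set ε := Real.exp (-(π * (2 * π * α^2))) with hε
  have hε0 : 0 < ε := Real.exp_pos _
  have hα0 : 0 < α := by linarith
  have h1 : ε ≤ N.factorial * α⁻¹^N := by
    have h2 := Real.pow_div_factorial_le_exp α hα0.le N
    have h3 : ε ≤ Real.exp (-α) := by
      refine Real.exp_le_exp.2 (neg_le_neg ?_)
      have := Real.pi_gt_three
      have q1 : 1 ≤ π * (2 * π) := by nlinarith
      have q2 : α ≤ α^2 := by nlinarith
      calc α ≤ 1 * α^2 := by linarith
        _ ≤ π * (2 * π) * α^2 := mul_le_mul_of_nonneg_right q1 (sq_nonneg α)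
        _ = _ := by ring
    refine h3.trans ?_
    rw [Real.exp_neg, inv_pow, ← div_eq_mul_inv, ← inv_div]
    exact inv_anti₀ (by positivity) h2
  unfold rsMu
  rw [← hε]
  set z : ℂ := 1 + I * (ε:ℂ) with hz
  have hz1 : ‖z - 1‖ = ε := by rw [hz]; simp [abs_of_pos hε0]
  have hz2 : 1 ≤ ‖z‖ := by
    have := Complex.re_le_norm z
    have e : z.re = 1 := by simp [hz]
    linarith
  have hz3 : ‖z‖ ≤ 1 + ε := by
    have := norm_add_le (1:ℂ) (z - 1)
    rw [hz1] at this; simpa using this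
  have hz0 : (‖z‖:ℂ) ≠ 0 := by
    have : ‖z‖ ≠ 0 := by linarith
    exact_mod_cast this
  have e : z / (‖z‖:ℂ) - 1 = ((z - 1) - ((‖z‖ - 1 : ℝ):ℂ)) / (‖z‖:ℂ) := by
    push_cast; field_simp; ring
  rw [e, norm_div, Complex.norm_real, norm_norm]
  have h4 : ‖(z - 1) - ((‖z‖ - 1 : ℝ):ℂ)‖ ≤ 2 * ε := by
    refine (norm_sub_le _ _).trans ?_
    rw [hz1, Complex.norm_real, Real.norm_of_nonneg (by linarith)]; linarith
  calc _ ≤ ‖(z - 1) - ((‖z‖ - 1 : ℝ):ℂ)‖ := div_le_self (norm_nonneg _) hz2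
    _ ≤ 2 * ε := h4
    _ ≤ _ := by linarith

def rsZ (α : ℝ) : ℂ := Complex.exp (-(π * I / 8)) * (1 + I)⁻¹ * (rsMu α * ((starRingEnd ℂ) (rsD α) / (‖rsD α‖ : ℂ)) * rsV α)

lemma rsZ_HE (N : ℕ) : rsHE N (fun α => rsZ α + (starRingEnd ℂ) (rsZ α)) := by
  have : rsHE N rsZ := (rsHE.const N _).mul (((rsMu_HE N).mul (rsU_HE N)).mul (rsV_HE N))
  exact rsHE.add _ _ this this.conj

lemma rs_Qeq (α : ℝ) (hα : 1 ≤ α) : rsQ (1/2 + I * ((2 * π * α^2 : ℝ) : ℂ)) (⌊α⌋₊ + 1/2) =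
    (-1)^⌊α⌋₊ * ((α:ℂ)^(-(1/2 + I * ((2 * π * α^2 : ℝ) : ℂ))) * Complex.exp (π * I * α^2)) * rsV α := by
  have hc := rs_c α hα
  have h1 := rs_c1 α hα
  unfold rsQ rsL rsV
  rw [← integral_const_mul]
  congr 1; funext p
  have e1 := rsT_X α (1/2 - Int.fract α) p (by linarith) (by linarith)
  rw [hc] at e1
  have e2 := rs_cos_line ⌊α⌋₊ p
  have e3 : ((⌊α⌋₊ : ℂ) + 1/2) = (((⌊α⌋₊ : ℝ) + 1/2 : ℝ):ℂ) := by push_cast; ring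
  beta_reduce
  try rw [e3]
  rw [e1, e2]
  have e4 : ((-1:ℂ)^⌊α⌋₊)⁻¹ = (-1)^⌊α⌋₊ := by rw [← inv_pow]; norm_num
  rw [div_eq_mul_inv, mul_inv, e4]
  ring

lemma rs_Jeq (α : ℝ) (hα : 1 ≤ α) : rsL (rsX (1/2 + I * ((2 * π * α^2 : ℝ) : ℂ))) α =
    ((α:ℂ)^(-(1/2 + I * ((2 * π * α^2 : ℝ) : ℂ))) * Complex.exp (π * I * α^2)) * rsD α := by
  unfold rsL rsD
  rw [← integral_const_mul]
  congr 1; funext p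
  have e1 := rsT_X α 0 p (by linarith) (by linarith)
  rw [add_zero] at e1
  rw [e1, mul_one]

lemma rs_main (α : ℝ) (hα : 1 ≤ α) :
    (starRingEnd ℂ) (rsA (2 * π * α^2)) / (‖rsA (2 * π * α^2)‖ : ℂ) * (rsQ (1/2 + I * ((2 * π * α^2 : ℝ) : ℂ)) (⌊α⌋₊ + 1/2) / (1 + I))
     = (-1)^⌊α⌋₊ * ((α^(-(1/2:ℝ)) : ℝ) : ℂ) * rsZ α := by
  have hα0 : 0 < α := by linarith
  obtain ⟨κ, hκ, hJ⟩ := rs_J_half (2 * π * α^2) α hα0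
  rw [rs_Jeq α hα] at hJ
  rw [rs_Qeq α hα]
  unfold rsZ rsMu
  set A := rsA (2 * π * α^2) with hA
  have hA0 : A ≠ 0 := rsA_ne _
  set ε := Real.exp (-(π * (2 * π * α^2))) with hε
  set z : ℂ := 1 + I * (ε:ℂ) with hz
  have hz0 : z ≠ 0 := by
    intro h
    have := congrArg Complex.re h
    simp [hz] at this
  set W : ℂ := (α:ℂ)^(-(1/2 + I * ((2 * π * α^2 : ℝ) : ℂ))) * Complex.exp (π * I * α^2) with hW
  have hWn : ‖W‖ = α^(-(1/2:ℝ)) := by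
    rw [hW, norm_mul, Complex.norm_cpow_eq_rpow_re_of_pos hα0, Complex.norm_exp]
    have e1 : (-(1/2 + I * ((2 * π * α^2 : ℝ) : ℂ))).re = -(1/2:ℝ) := by
      simp [sq]
    have e2 : (π * I * (α:ℂ)^2).re = 0 := by simp [sq]
    rw [e1, e2, Real.exp_zero, mul_one]
  rw [← hWn]
  have hWp : 0 < ‖W‖ := by rw [hWn]; positivity
  have hW0 : W ≠ 0 := norm_pos_iff.1 hWp
  set E : ℂ := Complex.exp (-(π * I / 8)) with hE
  have hEn : ‖E‖ = 1 := by
    rw [hE, Complex.norm_exp]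
    have : (-(π * I / 8) : ℂ).re = 0 := by simp
    rw [this, Real.exp_zero]
  have hE0 : E ≠ 0 := Complex.exp_ne_zero _
  have hEE : E * (starRingEnd ℂ) E = 1 := by
    rw [Complex.mul_conj, Complex.normSq_eq_norm_sq, hEn]; norm_num
  have hzz : z * (starRingEnd ℂ) z = (‖z‖:ℂ)^2 := by
    rw [Complex.mul_conj, Complex.normSq_eq_norm_sq]; push_cast; rfl
  have hWW : W * (starRingEnd ℂ) W = (‖W‖:ℂ)^2 := by
    rw [Complex.mul_conj, Complex.normSq_eq_norm_sq]; push_cast; rfl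
  set D := rsD α
  have hn : ‖W‖ * ‖D‖ = κ * ‖z‖ * ‖A‖ := by
    have := congrArg norm hJ
    simpa [norm_mul, hEn, abs_of_pos hκ] using this
  have hAp := norm_pos_iff.2 hA0
  have hzp := norm_pos_iff.2 hz0
  have hDp : 0 < ‖D‖ := by
    have : 0 < ‖W‖ * ‖D‖ := by rw [hn]; positivity
    exact pos_of_mul_pos_right this hWp.le
  have hJc : (starRingEnd ℂ) W * (starRingEnd ℂ) D = κ * (starRingEnd ℂ) E * (starRingEnd ℂ) z * (starRingEnd ℂ) A := by
    have := congrArg (starRingEnd ℂ) hJ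
    simpa only [map_mul, Complex.conj_ofReal] using this
  have hnc : (‖W‖:ℂ) * ‖D‖ = κ * ‖z‖ * ‖A‖ := by exact_mod_cast hn
  have cA : (‖A‖:ℂ) ≠ 0 := by exact_mod_cast hAp.ne'
  have cz : (‖z‖:ℂ) ≠ 0 := by exact_mod_cast hzp.ne'
  have cD : (‖D‖:ℂ) ≠ 0 := by exact_mod_cast hDp.ne'
  have cW : (‖W‖:ℂ) ≠ 0 := by exact_mod_cast hWp.ne'
  have cκ : (κ:ℂ) ≠ 0 := by exact_mod_cast hκ.ne'
  have key : (starRingEnd ℂ) A / (‖A‖:ℂ) * W = (‖W‖:ℂ) * E * (z / (‖z‖:ℂ)) * ((starRingEnd ℂ) D / (‖D‖:ℂ)) := by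
    rw [div_mul_eq_mul_div, div_eq_iff cA]
    have h2 : (starRingEnd ℂ) A * W * (κ * (‖z‖:ℂ)^2 * ‖D‖) = (‖W‖:ℂ) * E * z * (starRingEnd ℂ) D * ‖A‖ * (κ * ‖z‖) := by
      have h3 : E * z * ((starRingEnd ℂ) W * (starRingEnd ℂ) D) = κ * (‖z‖:ℂ)^2 * (starRingEnd ℂ) A := by
        rw [hJc, ← hzz]; linear_combination (κ * z * (starRingEnd ℂ) z * (starRingEnd ℂ) A) * hEE
      linear_combination (-W * (‖D‖:ℂ)) * h3 + (E * z * (starRingEnd ℂ) D * ‖D‖) * hWW + (‖W‖:ℂ) * E * z * (starRingEnd ℂ) D * hnc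
    have h4 : (κ * (‖z‖:ℂ)^2 * ‖D‖) ≠ 0 := by simp [cκ, cz, cD]
    refine mul_right_cancel₀ h4 ?_
    rw [h2]
    field_simp
  have h1I : (1 + I : ℂ) ≠ 0 := by
    intro h
    have := congrArg Complex.re h
    simp at this
  calc _ = ((starRingEnd ℂ) A / (‖A‖:ℂ) * W) * ((-1)^⌊α⌋₊ * rsV α * (1 + I)⁻¹) := by ring
    _ = _ := by rw [key]; ring



lemma rs_alpha_pow (t : ℝ) (ht : 0 < t) (m : ℕ) :
    (Real.sqrt (t/(2*π)))⁻¹^m = (2*π)^((m:ℝ)/2) * t^(-(m:ℝ)/2) := by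
  have hp : 0 < 2 * π := by positivity
  have e : (-(m:ℝ)/2) = -((m:ℝ)/2) := by ring
  rw [Real.sqrt_eq_rpow, ← Real.rpow_neg (by positivity), ← Real.rpow_natCast, ← Real.rpow_mul (by positivity),
    Real.div_rpow ht.le hp.le, e]
  have e1 : -(1/2 : ℝ) * m = -((m:ℝ)/2) := by ring
  rw [e1, Real.rpow_neg hp.le, div_inv_eq_mul, mul_comm]

lemma rs_alpha_half (t : ℝ) (ht : 0 < t) :
    (Real.sqrt (t/(2*π)))^(-(1/2:ℝ)) = (2*π/t)^((1:ℝ)/4) := by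
  have hp : 0 < 2 * π := by positivity
  rw [Real.sqrt_eq_rpow, ← Real.rpow_mul (by positivity), ← inv_div t (2*π), Real.inv_rpow (by positivity), ← Real.rpow_neg (by positivity)]
  norm_num

theorem statement3 (N : ℕ) (ϑ : ℂ → ℂ) (hϑ : IsRSTheta ϑ) :
    ∃ Cf : ℕ → ℝ → ℂ, ∃ K : ℝ, ∀ t : ℝ, 2 * π ≤ t →
      ‖Complex.exp (I * ϑ (1/2 + I*t)) * riemannZeta (1/2 + I*t)
          - Complex.exp (I * ϑ (1/2 + I*t)) * zetaSum (Real.sqrt (t/(2*π))) (1/2 + I*t)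
          - Complex.exp (I * ϑ (1 - (1/2 + I*t))) *
              zetaSum (Real.sqrt (t/(2*π))) (1 - (1/2 + I*t))
          - (-1:ℂ)^(⌊Real.sqrt (t/(2*π))⌋₊ + 1) * (((2*π/t) ^ ((1:ℝ)/4) : ℝ) : ℂ) *
              ∑ m ∈ Finset.range N,
                Cf m (Int.fract (Real.sqrt (t/(2*π)))) * ((t ^ (-(m:ℝ)/2) : ℝ) : ℂ)‖
        ≤ K * t ^ (-(N:ℝ)/2 - 1/4) := by
  obtain ⟨c, K, hK⟩ := (rsZ_HE N).extract
  refine ⟨fun m a => c m a * (((2*π)^((m:ℝ)/2) : ℝ) : ℂ), K * (2*π)^((N:ℝ)/2) * (2*π)^((1:ℝ)/4), fun t ht => ?_⟩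
  have hp : 0 < 2 * π := by positivity
  have ht0 : 0 < t := by linarith
  rw [rs_reduce ϑ hϑ t ht0]
  have hpow := rs_alpha_pow t ht0
  have hhalf := rs_alpha_half t ht0
  set α := Real.sqrt (t/(2*π)) with hα
  have hα1 : 1 ≤ α := by
    rw [hα, Real.one_le_sqrt, le_div_iff₀ hp]; linarith
  have htα : t = 2 * π * α^2 := by
    rw [hα, Real.sq_sqrt (by positivity)]; field_simp
  have hm := rs_main α hα1
  rw [← htα, hhalf] at hm
  rw [hm]
  have hq0 : 0 ≤ (2*π/t)^((1:ℝ)/4) := by positivity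
  have hsum : ∑ m ∈ Finset.range N, c m (Int.fract α) * (((2*π)^((m:ℝ)/2) : ℝ) : ℂ) * ((t ^ (-(m:ℝ)/2) : ℝ) : ℂ)
      = ∑ m ∈ Finset.range N, c m (Int.fract α) * ((α:ℂ)⁻¹)^m := by
    refine Finset.sum_congr rfl fun m _ => ?_
    have := hpow m
    rw [mul_assoc, ← Complex.ofReal_mul, ← this]
    push_cast; rfl
  rw [hsum]
  have e : -((-1:ℂ)^⌊α⌋₊ * (((2*π/t)^((1:ℝ)/4) : ℝ) : ℂ) * rsZ α + (starRingEnd ℂ) ((-1)^⌊α⌋₊ * (((2*π/t)^((1:ℝ)/4) : ℝ) : ℂ) * rsZ α))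
      - (-1:ℂ)^(⌊α⌋₊ + 1) * (((2*π/t)^((1:ℝ)/4) : ℝ) : ℂ) * ∑ m ∈ Finset.range N, c m (Int.fract α) * ((α:ℂ)⁻¹)^m
      = (-1:ℂ)^(⌊α⌋₊ + 1) * (((2*π/t)^((1:ℝ)/4) : ℝ) : ℂ) * (rsZ α + (starRingEnd ℂ) (rsZ α) - ∑ m ∈ Finset.range N, c m (Int.fract α) * ((α:ℂ)⁻¹)^m) := by
    rw [map_mul, map_mul, Complex.conj_ofReal, map_pow, map_neg, map_one, pow_succ]
    ring
  rw [e, norm_mul, norm_mul, norm_pow, norm_neg, norm_one, one_pow, one_mul, Complex.norm_real, Real.norm_of_nonneg hq0]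
  refine (mul_le_mul_of_nonneg_left (hK α hα1) hq0).trans (le_of_eq ?_)
  rw [hpow N, Real.div_rpow hp.le ht0.le, Real.rpow_sub ht0]
  ring


end
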